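/- Suppose β > β₂^m. Then there exist a γ-invariant set Θ₀ ⊆ Θ of full m-measure (independent of β) and a measurable function r_β : Θ × ℝ → [0,1], (1/2)-periodic in the second variable, such that for every θ ∈ Θ₀: the map α ↦ r_β(θ,α) is strictly positive and continuous, 𝒜_β(θ) = {r·v(α) : α ∈ [0,1), 0 ≤ r ≤ r_β(θ,α)}, and the set 𝒯_β(θ) = ∂𝒜_β(θ) = {r_β(θ,α)·v(α) : α ∈ [0,1)} is the global pullback attractor outside the zero section: for every δ > 0 there exists an f_β-forward invariant random compact set K_{β,δ} ⊆ Θ×ℝ² with B̄₁(0) ∖ B_δ(0) ⊆ K_{β,δ}(θ) for all θ ∈ Θ₀ and 𝒯_β(θ) = ⋂_{n∈ℕ} f^n_{β,γ^{−n}θ}(K_{β,δ}(γ^{−n}θ)). If in addition λ_m(A) > 0, then the random two-point forward attractor Ψ_β(θ) = {±c_β(θ)·v(α_u(θ))} (as in the intermediate parameter regime) still exists, satisfies Ψ_β(θ) ⊆ 𝒯_β(θ), and lim_{n→∞} dist(f^n_{β,θ}(v), Ψ_β(γ^n θ)) = 0 for every v ∈ ℝ² ∖ ℝ·v(α_s(θ)).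 -/

import Mathlib

open Filter MeasureTheory Metric Set
open scoped Topology

noncomputable section

/-- ℝ² with the Euclidean norm. -/
abbrev R2 : Type := EuclideanSpace ℝ (Fin 2)

/-- Action of a 2×2 real matrix on Euclidean ℝ². -/
def mulVecE (M : Matrix (Fin 2) (Fin 2) ℝ) (v : R2) : R2 :=
  (WithLp.equiv 2 (Fin 2 → ℝ)).symm (M.mulVec ((WithLp.equiv 2 (Fin 2 → ℝ)) v))

/-- Operator norm of a 2×2 real matrix induced by the Euclidean norm on ℝ². -/
def opNorm (M : Matrix (Fin 2) (Fin 2) ℝ) : ℝ :=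
  ‖(Matrix.toEuclideanCLM (𝕜 := ℝ) M : R2 →L[ℝ] R2)‖

/-- The cocycle `A_n(θ) = A(γ^{n-1}θ) ⋯ A(θ)`. -/
def coc {Θ : Type*} (γ : Θ → Θ) (A : Θ → Matrix (Fin 2) (Fin 2) ℝ) :
    ℕ → Θ → Matrix (Fin 2) (Fin 2) ℝ
  | 0, _ => 1
  | n + 1, θ => coc γ A n (γ θ) * A θ

/-- Maximal Lyapunov exponent `λ_max(A) = sup_θ limsup (1/n) log‖A_n(θ)‖`. -/
def lyapMax {Θ : Type*} (γ : Θ → Θ) (A : Θ → Matrix (Fin 2) (Fin 2) ℝ) : ℝ :=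
  ⨆ θ : Θ, Filter.limsup (fun n : ℕ => Real.log (opNorm (coc γ A n θ)) / n) Filter.atTop

/-- The hypotheses on `h`: C² on [0,∞), strictly increasing, strictly concave, bounded,
nonnegative, `h 0 = 0`, `h' 0 = 1`. -/
def GoodH (h : ℝ → ℝ) : Prop :=
  ContDiffOn ℝ 2 h (Set.Ici 0) ∧ StrictMonoOn h (Set.Ici 0) ∧
    StrictConcaveOn ℝ (Set.Ici 0) h ∧ BddAbove (h '' Set.Ici 0) ∧
    (∀ x ∈ Set.Ici (0 : ℝ), 0 ≤ h x) ∧ h 0 = 0 ∧ derivWithin h (Set.Ici 0) 0 = 1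

/-- The scaling condition `sup_{x ≥ 0} h(x) ≤ (sup_θ ‖A(θ)‖)⁻¹`. -/
def Scaled {Θ : Type*} (A : Θ → Matrix (Fin 2) (Fin 2) ℝ) (h : ℝ → ℝ) : Prop :=
  ∀ x ∈ Set.Ici (0 : ℝ), h x ≤ (⨆ θ : Θ, opNorm (A θ))⁻¹

open scoped Classical in
/-- The fibre maps `f_{β,θ}(v) = h(β‖v‖)·A(θ)·v/‖v‖`, `f_{β,θ}(0) = 0`. -/
def fibMap {Θ : Type*} (A : Θ → Matrix (Fin 2) (Fin 2) ℝ) (h : ℝ → ℝ) (β : ℝ)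
    (θ : Θ) (v : R2) : R2 :=
  if v = 0 then 0 else (h (β * ‖v‖) / ‖v‖) • mulVecE (A θ) v

/-- The skew product `f_β(θ,v) = (γθ, f_{β,θ}(v))`. -/
def skewProd {Θ : Type*} (γ : Θ → Θ) (A : Θ → Matrix (Fin 2) (Fin 2) ℝ) (h : ℝ → ℝ)
    (β : ℝ) : Θ × R2 → Θ × R2 :=
  fun p => (γ p.1, fibMap A h β p.1 p.2)

/-- The global attractor `𝒜_β = ⋂_{n∈ℕ} f_β^n(Θ × B̄₁(0))`. -/
def globalAttractor {Θ : Type*} (γ : Θ → Θ) (A : Θ → Matrix (Fin 2) (Fin 2) ℝ)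
    (h : ℝ → ℝ) (β : ℝ) : Set (Θ × R2) :=
  ⋂ n : ℕ, (skewProd γ A h β)^[n] '' (Set.univ ×ˢ Metric.closedBall (0 : R2) 1)

/-- The fibre `𝒜_β(θ) = {x : (θ,x) ∈ 𝒜_β}` of the global attractor. -/
def attractorFib {Θ : Type*} (γ : Θ → Θ) (A : Θ → Matrix (Fin 2) (Fin 2) ℝ)
    (h : ℝ → ℝ) (β : ℝ) (θ : Θ) : Set R2 :=
  {x : R2 | (θ, x) ∈ globalAttractor γ A h β}

/-- `v(α) = (cos 2πα, sin 2πα)ᵗ`. -/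
def vFull (α : ℝ) : R2 :=
  (WithLp.equiv 2 (Fin 2 → ℝ)).symm ![Real.cos (2 * Real.pi * α), Real.sin (2 * Real.pi * α)]

/-- `(cos πα, sin πα)ᵗ`, representing the projective point `α ∈ 𝕋 ≅ ℝP¹`. -/
def vHalf (α : ℝ) : R2 :=
  (WithLp.equiv 2 (Fin 2 → ℝ)).symm ![Real.cos (Real.pi * α), Real.sin (Real.pi * α)]

/-- The projective angle coordinate `p(w) = (1/π)·arg(w) mod 1 ∈ [0,1)` of a nonzero
vector `w ∈ ℝ²`; for `w ≠ 0` this equals `(1/π)·arctan(w₂/w₁) mod 1`. -/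
def projAngle (w : R2) : ℝ :=
  Int.fract (Complex.arg (Complex.ofReal (w 0) + Complex.ofReal (w 1) * Complex.I) / Real.pi)

/-- The projective action `g(θ,α) = (γθ, g_θ(α))` of the cocycle on `Θ × 𝕋`,
where `𝕋` is modelled by the fundamental domain `[0,1) ⊆ ℝ`. -/
def gMap {Θ : Type*} (γ : Θ → Θ) (A : Θ → Matrix (Fin 2) (Fin 2) ℝ) :
    Θ × ℝ → Θ × ℝ :=
  fun p => (γ p.1, projAngle (mulVecE (A p.1) (vHalf p.2)))

/-- `Ω(θ,α) = ‖A(θ)(cos πα, sin πα)ᵗ‖`. -/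
def Omega {Θ : Type*} (A : Θ → Matrix (Fin 2) (Fin 2) ℝ) (p : Θ × ℝ) : ℝ :=
  ‖mulVecE (A p.1) (vHalf p.2)‖

/-- The fibre maps `F_{β,θ,α}(r) = h(βr)·Ω(θ,α)` of the double skew product. -/
def dsFib {Θ : Type*} (A : Θ → Matrix (Fin 2) (Fin 2) ℝ) (h : ℝ → ℝ) (β : ℝ)
    (p : Θ × ℝ) (r : ℝ) : ℝ :=
  h (β * r) * Omega A p

/-- The double skew product `F_β(θ,α,r) = (g(θ,α), h(βr)·Ω(θ,α))` on `Θ × 𝕋 × [0,∞)`. -/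
def dsMap {Θ : Type*} (γ : Θ → Θ) (A : Θ → Matrix (Fin 2) (Fin 2) ℝ) (h : ℝ → ℝ)
    (β : ℝ) : Θ × ℝ × ℝ → Θ × ℝ × ℝ :=
  fun p => ((gMap γ A (p.1, p.2.1)).1, (gMap γ A (p.1, p.2.1)).2, dsFib A h β (p.1, p.2.1) p.2.2)

/-- `Ω_n(θ,α) = ∏_{i=0}^{n-1} Ω(g^i(θ,α))`. -/
def OmegaProd {Θ : Type*} (γ : Θ → Θ) (A : Θ → Matrix (Fin 2) (Fin 2) ℝ) (n : ℕ)
    (p : Θ × ℝ) : ℝ :=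
  ∏ i ∈ Finset.range n, Omega A ((gMap γ A)^[i] p)

/-- `Γ(a,b) = inf_{a ≤ x ≤ 1} inf_{0 < q ≤ b} h(qx)/(q·h(x))`. -/
def GammaH (h : ℝ → ℝ) (a b : ℝ) : ℝ :=
  sInf {y : ℝ | ∃ x ∈ Set.Icc a 1, ∃ q ∈ Set.Ioc (0 : ℝ) b, y = h (q * x) / (q * h x)}

/-- The inverse `g⁻¹(θ,α) = (γ⁻¹θ, projective angle of A(γ⁻¹θ)⁻¹·v(α))` of the
projective action. -/
def gInv {Θ : Type*} (γinv : Θ → Θ) (A : Θ → Matrix (Fin 2) (Fin 2) ℝ) :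
    Θ × ℝ → Θ × ℝ :=
  fun p => (γinv p.1, projAngle (mulVecE (A (γinv p.1))⁻¹ (vHalf p.2)))

/-- `F^n_{β,g^{-n}(θ,α)}(1)`, the pullback iterate defining the upper bounding graph. -/
def pullback1 {Θ : Type*} (γ : Θ → Θ) (γinv : Θ → Θ) (A : Θ → Matrix (Fin 2) (Fin 2) ℝ)
    (h : ℝ → ℝ) (β : ℝ) (n : ℕ) (p : Θ × ℝ) : ℝ :=
  ((dsMap γ A h β)^[n] (((gInv γinv A)^[n] p).1, ((gInv γinv A)^[n] p).2, 1)).2.2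

/-- The set of points satisfying one of countably many measurable conditions infinitely often. -/
lemma measurableSet_frequently {Θ : Type*} [MeasurableSpace Θ] {s : ℕ → Set Θ}
    (hs : ∀ n, MeasurableSet (s n)) : MeasurableSet {θ | ∃ᶠ n in atTop, θ ∈ s n} := by
  have : {θ | ∃ᶠ n in atTop, θ ∈ s n} = ⋂ N : ℕ, ⋃ n : ℕ, ⋃ _ : N ≤ n, s n := by
    ext θ
    simp [frequently_atTop]
  rw [this]
  exact MeasurableSet.iInter fun N => MeasurableSet.iUnion fun n => MeasurableSet.iUnion fun _ =>
    hs n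

/-- Greedy covering bound for a subadditive cocycle: outside the bad set `B`, a value below
average `t` is reached within `N` steps. -/
lemma subadditive_cover_bound {Θ : Type*} {T : Θ → Θ} {a : ℕ → Θ → ℝ} {C t : ℝ}
    (ht : 0 ≤ t) (hC0 : 0 ≤ C) (hC : ∀ n θ, a n θ ≤ C * n)
    (hsub : ∀ n k θ, a (n + k) θ ≤ a n θ + a k (T^[n] θ)) (B : Set Θ) (N : ℕ)
    (hB : ∀ θ ∉ B, ∃ k, 1 ≤ k ∧ k ≤ N ∧ a k θ ≤ t * k) (n : ℕ) (θ : Θ) :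
    a n θ ≤ t * n + C * ∑ j ∈ Finset.range n, B.indicator 1 (T^[j] θ) + C * N := by
  induction n using Nat.strong_induction_on generalizing θ with
  | _ n ih =>
  have hind : ∀ x : Θ, (0 : ℝ) ≤ B.indicator 1 x := fun x =>
    Set.indicator_nonneg (fun _ _ => zero_le_one) x
  have hsum : ∀ k θ, (0 : ℝ) ≤ ∑ j ∈ Finset.range k, B.indicator 1 (T^[j] θ) := fun k θ =>
    Finset.sum_nonneg fun j _ => hind _
  rcases le_or_gt n N with hn | hn
  · have h1 := hC n θ
    have h2 : C * n ≤ C * N := by gcongr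
    have h3 := hsum n θ
    have : 0 ≤ t * n := by positivity
    have := mul_nonneg hC0 h3
    linarith
  · by_cases hθ : θ ∈ B
    · obtain ⟨k, rfl⟩ : ∃ k, n = 1 + k := ⟨n - 1, by omega⟩
      have h1 := hsub 1 k θ
      have h2 := ih k (by omega) (T^[1] θ)
      have h3 := hC 1 θ
      rw [add_comm 1 k, Finset.sum_range_succ']
      simp only [Function.iterate_zero, id, Set.indicator_of_mem hθ, Pi.one_apply,
        Function.iterate_succ_apply]
      simp only [Function.iterate_one] at h1 h2
      push_cast at *
      rw [add_comm k 1]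
      nlinarith
    · obtain ⟨k, hk1, hkN, hk⟩ := hB θ hθ
      obtain ⟨l, rfl⟩ : ∃ l, n = k + l := ⟨n - k, by omega⟩
      have h1 := hsub k l θ
      have h2 := ih l (by omega) (T^[k] θ)
      rw [Finset.sum_range_add]
      have h3 := hsum k θ
      have h4 : ∀ j, T^[j] (T^[k] θ) = T^[k + j] θ := fun j => by
        rw [add_comm, Function.iterate_add_apply]
      simp only [h4] at h2
      have := mul_nonneg hC0 h3
      push_cast
      linarith

/-- Lower half of Kingman's theorem for bounded nonnegative subadditive cocycles. -/
lemma subadditive_ae_lower {Θ : Type*} [MeasurableSpace Θ] {μ : Measure Θ}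
    [IsProbabilityMeasure μ] {T : Θ → Θ} (hT : Ergodic T μ) {a : ℕ → Θ → ℝ} {C lam : ℝ}
    (ham : ∀ n, Measurable (a n)) (h0 : ∀ n θ, 0 ≤ a n θ) (hC : ∀ n θ, a n θ ≤ C * n)
    (hsub : ∀ n k θ, a (n + k) θ ≤ a n θ + a k (T^[n] θ))
    (hlam : Tendsto (fun n : ℕ => (∫ θ, a n θ ∂μ) / n) atTop (𝓝 lam)) {t : ℝ} (ht : t < lam) :
    ∀ᵐ θ ∂μ, ∀ᶠ n : ℕ in atTop, t * n < a n θ := by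
  have hne : Nonempty Θ := by
    by_contra hcon
    rw [not_nonempty_iff] at hcon
    exact IsProbabilityMeasure.ne_zero μ (Measure.eq_zero_of_isEmpty μ)
  obtain ⟨θ₁⟩ := hne
  have hC0 : 0 ≤ C := by
    have := (h0 1 θ₁).trans (hC 1 θ₁)
    simpa using this
  rcases lt_or_ge t 0 with ht0 | ht0
  · refine Eventually.of_forall fun θ => ?_
    filter_upwards [eventually_ge_atTop 1] with n hn
    have : (0 : ℝ) < n := by exact_mod_cast hn
    exact (mul_neg_of_neg_of_pos ht0 this).trans_le (h0 n θ)
  obtain ⟨s, hts, hsl⟩ := exists_between ht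
  have hs0 : 0 ≤ s := ht0.trans hts.le
  let E : Set Θ := {θ | ∃ q : ℚ, (q : ℝ) < s ∧ ∃ᶠ n : ℕ in atTop, a n θ ≤ q * n}
  have hEm : MeasurableSet E := by
    have : E = ⋃ q : ℚ, ⋃ _ : (q : ℝ) < s,
        {θ | ∃ᶠ n : ℕ in atTop, θ ∈ {θ | a n θ ≤ q * n}} := by
      ext θ; simp [E]
    rw [this]
    exact MeasurableSet.iUnion fun q => MeasurableSet.iUnion fun _ =>
      measurableSet_frequently fun n => measurableSet_le (ham n) measurable_const
  have hTE : T ⁻¹' E ⊆ E := by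
    rintro θ ⟨q, hq, hf⟩
    obtain ⟨q', hqq', hq's⟩ := exists_rat_btwn hq
    refine ⟨q', hq's, ?_⟩
    have hev : ∀ᶠ n : ℕ in atTop, C - q' ≤ ((q' : ℝ) - q) * n := by
      have : Tendsto (fun n : ℕ => ((q' : ℝ) - q) * n) atTop atTop :=
        tendsto_natCast_atTop_atTop.const_mul_atTop (sub_pos.2 hqq')
      exact this.eventually_ge_atTop _
    have h1 : ∃ᶠ n : ℕ in atTop, a (n + 1) θ ≤ q' * (n + 1 : ℕ) := by
      refine (hf.and_eventually hev).mono fun n hn => ?_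
      have := hsub 1 n θ
      have h1C := hC 1 θ
      rw [add_comm 1 n] at this
      simp only [Function.iterate_one] at this
      push_cast at *
      nlinarith [hn.1, hn.2]
    rw [frequently_atTop] at h1 ⊢
    intro N
    obtain ⟨n, hn, hn'⟩ := h1 N
    exact ⟨n + 1, by omega, hn'⟩
  rcases hT.ae_empty_or_univ_of_preimage_ae_le hEm.nullMeasurableSet
    (Eventually.of_forall hTE) with hE | hE
  · have : ∀ᵐ θ ∂μ, θ ∉ E := by
      filter_upwards [measure_eq_zero_iff_ae_notMem.1 (ae_eq_empty.1 hE)] with θ hθ hθE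
      exact hθ hθE
    filter_upwards [this] with θ hθ
    obtain ⟨q, htq, hqs⟩ := exists_rat_btwn hts
    have h1 : ¬ ∃ᶠ n : ℕ in atTop, a n θ ≤ q * n := fun hf => hθ ⟨q, hqs, hf⟩
    rw [not_frequently] at h1
    filter_upwards [h1] with n hn
    have : t * n ≤ q * n := by gcongr
    exact this.trans_lt (not_le.1 hn)
  · exfalso
    have hE' : μ Eᶜ = 0 := by
      rw [← ae_eq_univ]; exact hE
    let B : ℕ → Set Θ := fun N => {θ | ∀ n, 1 ≤ n → n ≤ N → s * n < a n θ}
    have hBm : ∀ N, MeasurableSet (B N) := fun N => by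
      have : B N = ⋂ n : ℕ, ⋂ _ : 1 ≤ n, ⋂ _ : n ≤ N, {θ | s * n < a n θ} := by
        ext θ; simp [B]
      rw [this]
      exact MeasurableSet.iInter fun n => MeasurableSet.iInter fun _ =>
        MeasurableSet.iInter fun _ => measurableSet_lt measurable_const (ham n)
    have hBanti : Antitone B := fun N M hNM θ hθ n h1 hn => hθ n h1 (hn.trans hNM)
    have hBE : ⋂ N, B N ⊆ Eᶜ := by
      rintro θ hθ ⟨q, hq, hf⟩
      rw [frequently_atTop] at hf
      obtain ⟨n, hn, hn'⟩ := hf 1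
      have := (mem_iInter.1 hθ n) n hn le_rfl
      have h3 : (q : ℝ) * n ≤ s * n := by gcongr
      linarith
    have hBt : Tendsto (fun N => μ.real (B N)) atTop (𝓝 0) := by
      have h1 := tendsto_measure_iInter_atTop (μ := μ) (fun N => (hBm N).nullMeasurableSet)
        hBanti ⟨0, measure_ne_top _ _⟩
      rw [measure_mono_null hBE hE'] at h1
      have := (ENNReal.tendsto_toReal ENNReal.zero_ne_top).comp h1
      simpa [Function.comp_def, measureReal_def] using this
    have hint : ∀ n, Integrable (a n) μ := fun n =>
      Integrable.of_bound (ham n).aestronglyMeasurable (C * n) (Eventually.of_forall fun θ => by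
        rw [Real.norm_of_nonneg (h0 n θ)]; exact hC n θ)
    have hbound : ∀ N, lam ≤ s + C * μ.real (B N) := by
      intro N
      have h1 : ∀ n : ℕ, ∫ θ, a n θ ∂μ ≤ s * n + C * (n * μ.real (B N)) + C * N := by
        intro n
        have hindi : Integrable ((B N).indicator (1 : Θ → ℝ)) μ :=
          (integrable_const (1 : ℝ)).indicator (hBm N)
        have hj : ∀ j, Integrable (fun θ => (B N).indicator (1 : Θ → ℝ) (T^[j] θ)) μ := fun j =>
          (hT.toMeasurePreserving.iterate j).integrable_comp_of_integrable hindi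
        have hji : ∀ j, ∫ θ, (B N).indicator (1 : Θ → ℝ) (T^[j] θ) ∂μ = μ.real (B N) := fun j => by
          have hmp := hT.toMeasurePreserving.iterate j
          have h2 : (fun θ => (B N).indicator (1 : Θ → ℝ) (T^[j] θ)) =
              (T^[j] ⁻¹' B N).indicator 1 := by
            ext θ; simp [Set.indicator]
          rw [h2, integral_indicator_one (hmp.measurable (hBm N)), measureReal_def,
            hmp.measure_preimage (hBm N).nullMeasurableSet, measureReal_def]
        have hsumint : Integrable (fun θ => ∑ j ∈ Finset.range n,
            (B N).indicator (1 : Θ → ℝ) (T^[j] θ)) μ := integrable_finsetSum _ fun j _ => hj j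
        calc ∫ θ, a n θ ∂μ ≤ ∫ θ, (s * n + C * ∑ j ∈ Finset.range n,
              (B N).indicator (1 : Θ → ℝ) (T^[j] θ) + C * N) ∂μ := by
              refine integral_mono (hint n) ?_ fun θ => ?_
              · exact ((integrable_const _).add (hsumint.const_mul C)).add (integrable_const _)
              · refine subadditive_cover_bound hs0 hC0 hC hsub (B N) N (fun θ hθ => ?_) n θ
                simp only [B, mem_ofPred_eq, not_forall, not_lt] at hθ
                obtain ⟨k, h1, h2, h3⟩ := hθ
                exact ⟨k, h1, h2, h3⟩
          _ = s * n + C * (n * μ.real (B N)) + C * N := by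
              have h2 : ∫ θ, (s * n + C * ∑ j ∈ Finset.range n,
                  (B N).indicator (1 : Θ → ℝ) (T^[j] θ)) ∂μ = s * n + C * (n * μ.real (B N)) := by
                rw [integral_add (integrable_const _) (hsumint.const_mul C),
                  integral_const_mul C, integral_finsetSum _ fun j _ => hj j]
                simp [hji]
              rw [integral_add (f := fun θ => s * n + C * ∑ j ∈ Finset.range n,
                  (B N).indicator (1 : Θ → ℝ) (T^[j] θ))
                ((integrable_const _).add (hsumint.const_mul C)) (integrable_const _), h2]
              simp
      have h2 : Tendsto (fun n : ℕ => s + C * μ.real (B N) + C * N * (1 / (n : ℝ))) atTop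
          (𝓝 (s + C * μ.real (B N) + C * N * 0)) :=
        tendsto_const_nhds.add (tendsto_one_div_atTop_nhds_zero_nat.const_mul _)
      rw [mul_zero, add_zero] at h2
      refine le_of_tendsto_of_tendsto hlam h2 ?_
      filter_upwards [eventually_ge_atTop 1] with n hn
      have hn0 : (0 : ℝ) < n := by exact_mod_cast hn
      rw [div_le_iff₀ hn0]
      refine (h1 n).trans (le_of_eq ?_)
      field_simp
    have h3 : Tendsto (fun N => s + C * μ.real (B N)) atTop (𝓝 (s + C * 0)) :=
      tendsto_const_nhds.add (hBt.const_mul C)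
    rw [mul_zero, add_zero] at h3
    exact absurd (ge_of_tendsto' h3 hbound) (not_le.2 hsl)

/-- Upper half of Birkhoff's theorem for bounded nonnegative observables. -/
lemma birkhoff_ae_upper {Θ : Type*} [MeasurableSpace Θ] {μ : Measure Θ}
    [IsProbabilityMeasure μ] {T : Θ → Θ} (hT : Ergodic T μ) {φ : Θ → ℝ} {C : ℝ}
    (hφ : Measurable φ) (h0 : ∀ θ, 0 ≤ φ θ) (hC : ∀ θ, φ θ ≤ C) {t : ℝ}
    (ht : ∫ θ, φ θ ∂μ < t) :
    ∀ᵐ θ ∂μ, ∀ᶠ n : ℕ in atTop, ∑ j ∈ Finset.range n, φ (T^[j] θ) < t * n := by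
  have hint : Integrable φ μ :=
    Integrable.of_bound hφ.aestronglyMeasurable C (Eventually.of_forall fun θ => by
      rw [Real.norm_of_nonneg (h0 θ)]; exact hC θ)
  have hmp := hT.toMeasurePreserving
  have hj : ∀ j, Integrable (fun θ => C - φ (T^[j] θ)) μ := fun j =>
    (integrable_const C).sub ((hmp.iterate j).integrable_comp_of_integrable hint)
  have hji : ∀ j, ∫ θ, (C - φ (T^[j] θ)) ∂μ = C - ∫ θ, φ θ ∂μ := fun j => by
    rw [integral_sub (g := fun θ => φ (T^[j] θ)) (integrable_const C)
      ((hmp.iterate j).integrable_comp_of_integrable hint)]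
    have h1 : ∫ θ, φ (T^[j] θ) ∂μ = ∫ θ, φ θ ∂μ := by
      have h2 := integral_map (μ := μ) (hmp.iterate j).measurable.aemeasurable (f := φ)
        hφ.aestronglyMeasurable
      rw [(hmp.iterate j).map_eq] at h2
      exact h2.symm
    rw [h1]; simp
  have key := subadditive_ae_lower hT (a := fun n θ => ∑ j ∈ Finset.range n, (C - φ (T^[j] θ)))
    (C := C) (lam := C - ∫ θ, φ θ ∂μ) (t := C - t)
    (fun n => Finset.measurable_sum _ fun j _ =>
      measurable_const.sub (hφ.comp (hmp.iterate j).measurable))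
    (fun n θ => Finset.sum_nonneg fun j _ => sub_nonneg.2 (hC _))
    (fun n θ => by
      refine (Finset.sum_le_sum (g := fun _ => C) fun j _ => ?_).trans ?_
      · linarith [h0 (T^[j] θ)]
      · simp [mul_comm])
    (fun n k θ => by
      rw [Finset.sum_range_add]
      refine add_le_add le_rfl (le_of_eq (Finset.sum_congr rfl fun j _ => ?_))
      rw [add_comm n j, Function.iterate_add_apply])
    (by
      refine Tendsto.congr' ?_ (tendsto_const_nhds (x := C - ∫ θ, φ θ ∂μ))
      filter_upwards [eventually_ge_atTop 1] with n hn
      have hn0 : (n : ℝ) ≠ 0 := by positivity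
      rw [integral_finsetSum _ fun j _ => hj j]
      simp only [hji, Finset.sum_const, Finset.card_range, nsmul_eq_mul]
      field_simp)
    (by linarith)
  filter_upwards [key] with θ hθ
  filter_upwards [hθ] with n hn
  rw [Finset.sum_sub_distrib] at hn
  simp only [Finset.sum_const, Finset.card_range, nsmul_eq_mul] at hn
  linarith

/-- A subadditive cocycle is bounded by the averaged ergodic sums of its `N`-th term. -/
lemma subadditive_le_ergodic_sum {Θ : Type*} {T : Θ → Θ} {a : ℕ → Θ → ℝ} {C : ℝ}
    (h0 : ∀ n θ, 0 ≤ a n θ) (hC : ∀ n θ, a n θ ≤ C * n)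
    (hsub : ∀ n k θ, a (n + k) θ ≤ a n θ + a k (T^[n] θ)) (N n : ℕ) (θ : Θ) :
    N * a n θ ≤ ∑ j ∈ Finset.range n, a N (T^[j] θ) + 2 * C * N * N := by
  have hC0 : 0 ≤ C := by
    have := (h0 1 θ).trans (hC 1 θ)
    simpa using this
  have hW : ∀ m θ, ∑ i ∈ Finset.range N, a (m + N - i) (T^[i] θ) ≤
      ∑ j ∈ Finset.range m, a N (T^[j] θ) + C * N * N := by
    intro m
    induction m with
    | zero =>
      intro θ
      simp only [Finset.range_zero, Finset.sum_empty, zero_add]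
      calc ∑ i ∈ Finset.range N, a (N - i) (T^[i] θ) ≤ ∑ i ∈ Finset.range N, C * N := by
            refine Finset.sum_le_sum fun i _ => (hC _ _).trans ?_
            gcongr
            exact Nat.sub_le _ _
        _ = C * N * N := by simp; ring
    | succ m ih =>
      intro θ
      have h1 := ih (T θ)
      have h2 : ∑ i ∈ Finset.range (N + 1), a (m + 1 + N - i) (T^[i] θ) =
          ∑ i ∈ Finset.range N, a (m + 1 + N - i) (T^[i] θ) + a (m + 1) (T^[N] θ) := by
        rw [Finset.sum_range_succ]; simp
      rw [Finset.sum_range_succ'] at h2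
      have h3 : ∀ i, a (m + 1 + N - (i + 1)) (T^[i + 1] θ) = a (m + N - i) (T^[i] (T θ)) := by
        intro i
        rw [Function.iterate_succ_apply]
        congr 1
        omega
      simp only [h3, Nat.sub_zero, Function.iterate_zero, id] at h2
      have h4 := hsub N (m + 1) θ
      rw [Finset.sum_range_succ']
      simp only [Function.iterate_succ_apply, Function.iterate_zero, id]
      rw [show m + 1 + N = N + (m + 1) by omega] at *
      linarith
  rcases le_or_gt n N with hn | hn
  · have h1 : a n θ ≤ C * N := (hC n θ).trans (by gcongr)
    have h2 : (N : ℝ) * a n θ ≤ N * (C * N) := by gcongr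
    have h3 : 0 ≤ ∑ j ∈ Finset.range n, a N (T^[j] θ) := Finset.sum_nonneg fun j _ => h0 _ _
    have h4 : 0 ≤ C * N * N := by positivity
    linarith
  · obtain ⟨m, rfl⟩ : ∃ m, n = m + N := ⟨n - N, by omega⟩
    have h1 : N * a (m + N) θ ≤ ∑ i ∈ Finset.range N, (a (m + N - i) (T^[i] θ) + C * N) := by
      calc N * a (m + N) θ = ∑ i ∈ Finset.range N, a (m + N) θ := by simp
        _ ≤ _ := by
          refine Finset.sum_le_sum fun i hi => ?_
          have hi := Finset.mem_range.1 hi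
          have hiN : C * i ≤ C * N := by gcongr
          have h2 := hsub i (m + N - i) θ
          rw [show i + (m + N - i) = m + N by omega] at h2
          linarith [hC i θ]
    rw [Finset.sum_add_distrib] at h1
    simp only [Finset.sum_const, Finset.card_range, nsmul_eq_mul] at h1
    have h3 : ∑ j ∈ Finset.range m, a N (T^[j] θ) ≤ ∑ j ∈ Finset.range (m + N), a N (T^[j] θ) :=
      Finset.sum_le_sum_of_subset_of_nonneg (Finset.range_mono (by omega)) fun j _ _ => h0 _ _
    linarith [hW m θ]

/-- Kingman's subadditive ergodic theorem for bounded nonnegative cocycles over an ergodic map. -/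
theorem subadditive_ergodic {Θ : Type*} [MeasurableSpace Θ] {μ : Measure Θ}
    [IsProbabilityMeasure μ] {T : Θ → Θ} (hT : Ergodic T μ) {a : ℕ → Θ → ℝ} {C lam : ℝ}
    (ham : ∀ n, Measurable (a n)) (h0 : ∀ n θ, 0 ≤ a n θ) (hC : ∀ n θ, a n θ ≤ C * n)
    (hsub : ∀ n k θ, a (n + k) θ ≤ a n θ + a k (T^[n] θ))
    (hlam : Tendsto (fun n : ℕ => (∫ θ, a n θ ∂μ) / n) atTop (𝓝 lam)) :
    ∀ᵐ θ ∂μ, Tendsto (fun n : ℕ => a n θ / n) atTop (𝓝 lam) := by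
  have hlow : ∀ᵐ θ ∂μ, ∀ q : ℚ, (q : ℝ) < lam → ∀ᶠ n : ℕ in atTop, q * n < a n θ := by
    rw [ae_all_iff]
    intro q
    by_cases hq : (q : ℝ) < lam
    · filter_upwards [subadditive_ae_lower hT ham h0 hC hsub hlam hq] with θ hθ _ using hθ
    · exact Eventually.of_forall fun θ h => absurd h hq
  have hup : ∀ᵐ θ ∂μ, ∀ q : ℚ, lam < (q : ℝ) → ∀ᶠ n : ℕ in atTop, a n θ ≤ q * n := by
    rw [ae_all_iff]
    intro q
    by_cases hq : lam < (q : ℝ)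
    · obtain ⟨s, hs, hsq⟩ := exists_between hq
      obtain ⟨N, hN1, hN⟩ : ∃ N : ℕ, 1 ≤ N ∧ (∫ θ, a N θ ∂μ) / N < s :=
        ((eventually_ge_atTop 1).and (hlam.eventually_lt_const hs)).exists
      have hN0 : (0 : ℝ) < N := by exact_mod_cast hN1
      rw [div_lt_iff₀ hN0] at hN
      filter_upwards [birkhoff_ae_upper hT (ham N) (h0 N) (hC N) hN] with θ hθ _
      have hev : ∀ᶠ n : ℕ in atTop, 2 * C * N ≤ ((q : ℝ) - s) * n := by
        have : Tendsto (fun n : ℕ => ((q : ℝ) - s) * n) atTop atTop :=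
          tendsto_natCast_atTop_atTop.const_mul_atTop (sub_pos.2 hsq)
        exact this.eventually_ge_atTop _
      filter_upwards [hθ, hev] with n h1 h2
      have h3 := subadditive_le_ergodic_sum h0 hC hsub N n θ
      have h4 : (N : ℝ) * a n θ ≤ N * (q * n) := by
        have := mul_le_mul_of_nonneg_right h2 hN0.le
        nlinarith
      exact le_of_mul_le_mul_left h4 hN0
    · exact Eventually.of_forall fun θ h => absurd h hq
  filter_upwards [hlow, hup] with θ h1 h2
  rw [tendsto_order]
  refine ⟨fun t ht => ?_, fun t ht => ?_⟩
  · obtain ⟨q, htq, hq⟩ := exists_rat_btwn ht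
    filter_upwards [h1 q hq, eventually_ge_atTop 1] with n hn hn1
    have hn0 : (0 : ℝ) < n := by exact_mod_cast hn1
    exact htq.trans ((lt_div_iff₀ hn0).2 hn)
  · obtain ⟨q, hq, hqt⟩ := exists_rat_btwn ht
    filter_upwards [h2 q hq, eventually_ge_atTop 1] with n hn hn1
    have hn0 : (0 : ℝ) < n := by exact_mod_cast hn1
    exact ((div_le_iff₀ hn0).2 hn).trans_lt hqt

/-- Linear growth up to a small linear error and a constant. -/
lemma exists_abs_sub_le_of_tendsto_div {a : ℕ → ℝ} {lam : ℝ}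
    (ha : Tendsto (fun n : ℕ => a n / n) atTop (𝓝 lam)) {ε : ℝ} (hε : 0 < ε) :
    ∃ D : ℝ, 0 ≤ D ∧ ∀ n : ℕ, |a n - lam * n| ≤ ε * n + D := by
  obtain ⟨N, hN⟩ := (Metric.tendsto_atTop.1 ha) ε hε
  refine ⟨∑ i ∈ Finset.range (N + 1), |a i - lam * i|,
    Finset.sum_nonneg fun i _ => abs_nonneg _, fun n => ?_⟩
  have hD : 0 ≤ ∑ i ∈ Finset.range (N + 1), |a i - lam * i| :=
    Finset.sum_nonneg fun i _ => abs_nonneg _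
  rcases lt_or_ge n (N + 1) with hn | hn
  · have h1 := Finset.single_le_sum (f := fun i : ℕ => |a i - lam * i|)
      (fun i _ => abs_nonneg _) (Finset.mem_range.2 hn)
    have : 0 ≤ ε * n := by positivity
    linarith
  · have hn0 : (0 : ℝ) < n := by
      have : 0 < n := by omega
      exact_mod_cast this
    have h1 := hN n (by omega)
    rw [Real.dist_eq] at h1
    have h2 : a n - lam * n = (a n / n - lam) * n := by field_simp
    rw [h2, abs_mul, abs_of_pos hn0]
    have : |a n / n - lam| * n ≤ ε * n := by gcongr
    linarith

/-- A full-measure property holds along entire orbits on an invariant measurable set of full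
measure. -/
lemma exists_invariant_full_measure {Θ : Type*} [MeasurableSpace Θ] {m : Measure Θ}
    [IsProbabilityMeasure m] (γ : Θ ≃ Θ) (hγ : MeasurePreserving γ m m)
    (hγ' : MeasurePreserving γ.symm m m) {p : Θ → Prop} (hp : ∀ᵐ θ ∂m, p θ) :
    ∃ Θ₀ : Set Θ, MeasurableSet Θ₀ ∧ γ ⁻¹' Θ₀ = Θ₀ ∧ m Θ₀ = 1 ∧ ∀ θ ∈ Θ₀, p θ := by
  obtain ⟨G, hGp, hGm, hG0⟩ := exists_measurable_superset_of_null (ae_iff.1 hp)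
  have hmp : ∀ k : ℤ, MeasurePreserving (γ ^ k : Equiv.Perm Θ) m m := by
    intro k
    rcases Int.eq_nat_or_neg k with ⟨n, rfl | rfl⟩
    · have : ((γ ^ (n : ℤ) : Equiv.Perm Θ) : Θ → Θ) = γ^[n] := by
        rw [zpow_natCast, ← Equiv.Perm.iterate_eq_pow]
      rw [this]
      exact hγ.iterate n
    · have : ((γ ^ (-(n : ℤ)) : Equiv.Perm Θ) : Θ → Θ) = γ.symm^[n] := by
        rw [zpow_neg, ← inv_zpow, zpow_natCast, ← Equiv.Perm.iterate_eq_pow]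
        rfl
      rw [this]
      exact hγ'.iterate n
  refine ⟨⋂ k : ℤ, (γ ^ k : Equiv.Perm Θ) ⁻¹' Gᶜ,
    MeasurableSet.iInter fun k => (hmp k).measurable hGm.compl, ?_, ?_, ?_⟩
  · ext θ
    have h1 : ∀ k : ℤ, (γ ^ k : Equiv.Perm Θ) (γ θ) = (γ ^ (k + 1) : Equiv.Perm Θ) θ :=
      fun k => by rw [zpow_add_one]; rfl
    have h2 : ∀ k : ℤ, (γ ^ k : Equiv.Perm Θ) θ = (γ ^ (k - 1) : Equiv.Perm Θ) (γ θ) :=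
      fun k => by rw [h1, sub_add_cancel]
    rw [mem_preimage, mem_iInter, mem_iInter]
    refine ⟨fun h k => ?_, fun h k => ?_⟩
    · rw [mem_preimage, h2]
      exact h (k - 1)
    · rw [mem_preimage, h1]
      exact h (k + 1)
  · rw [← prob_compl_eq_zero_iff (MeasurableSet.iInter fun k => (hmp k).measurable hGm.compl),
      compl_iInter, measure_iUnion_null_iff]
    intro k
    rw [← preimage_compl, compl_compl, (hmp k).measure_preimage hGm.nullMeasurableSet, hG0]
  · intro θ hθ
    have h1 := mem_iInter.1 hθ 0
    by_contra hcon
    exact h1 (hGp hcon)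

lemma mulVecE_zero_coord (M : Matrix (Fin 2) (Fin 2) ℝ) (v : R2) :
    mulVecE M v 0 = M 0 0 * v 0 + M 0 1 * v 1 := by
  simp [mulVecE]

lemma mulVecE_one_coord (M : Matrix (Fin 2) (Fin 2) ℝ) (v : R2) :
    mulVecE M v 1 = M 1 0 * v 0 + M 1 1 * v 1 := by
  simp [mulVecE]

lemma R2.ext {x y : R2} (h0 : x 0 = y 0) (h1 : x 1 = y 1) : x = y := by
  ext i
  fin_cases i
  · exact h0
  · exact h1

lemma R2.norm_sq (v : R2) : ‖v‖ ^ 2 = v 0 ^ 2 + v 1 ^ 2 := by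
  rw [EuclideanSpace.norm_sq_eq]
  simp [Fin.sum_univ_two]

lemma mulVecE_mul (M N : Matrix (Fin 2) (Fin 2) ℝ) (v : R2) :
    mulVecE (M * N) v = mulVecE M (mulVecE N v) := by
  simp only [mulVecE, WithLp.equiv_apply, WithLp.equiv_symm_apply, Matrix.mulVec_mulVec]

lemma mulVecE_one (v : R2) : mulVecE 1 v = v := by
  simp [mulVecE]

lemma mulVecE_smul (M : Matrix (Fin 2) (Fin 2) ℝ) (t : ℝ) (v : R2) :
    mulVecE M (t • v) = t • mulVecE M v := by
  apply R2.ext <;> simp [mulVecE_zero_coord, mulVecE_one_coord] <;> ring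

lemma mulVecE_zero (M : Matrix (Fin 2) (Fin 2) ℝ) : mulVecE M 0 = 0 := by
  simpa using mulVecE_smul M 0 0

lemma norm_mulVecE_le (M : Matrix (Fin 2) (Fin 2) ℝ) (v : R2) :
    ‖mulVecE M v‖ ≤ opNorm M * ‖v‖ :=
  (Matrix.toEuclideanCLM (𝕜 := ℝ) M : R2 →L[ℝ] R2).le_opNorm v

lemma opNorm_le_of_forall {M : Matrix (Fin 2) (Fin 2) ℝ} {c : ℝ} (hc : 0 ≤ c)
    (h : ∀ v, ‖mulVecE M v‖ ≤ c * ‖v‖) : opNorm M ≤ c :=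
  (Matrix.toEuclideanCLM (𝕜 := ℝ) M : R2 →L[ℝ] R2).opNorm_le_bound hc h

lemma opNorm_nonneg (M : Matrix (Fin 2) (Fin 2) ℝ) : 0 ≤ opNorm M := norm_nonneg _

lemma opNorm_mul_le (M N : Matrix (Fin 2) (Fin 2) ℝ) : opNorm (M * N) ≤ opNorm M * opNorm N := by
  refine opNorm_le_of_forall (mul_nonneg (opNorm_nonneg _) (opNorm_nonneg _)) fun v => ?_
  rw [mulVecE_mul, mul_assoc]
  exact (norm_mulVecE_le _ _).trans
    (mul_le_mul_of_nonneg_left (norm_mulVecE_le _ _) (opNorm_nonneg _))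

lemma opNorm_one : opNorm 1 ≤ 1 :=
  opNorm_le_of_forall zero_le_one fun v => by rw [mulVecE_one, one_mul]

/-- The signed area spanned by two plane vectors. -/
def wedge (x y : R2) : ℝ := x 0 * y 1 - x 1 * y 0

lemma wedge_mulVecE (M : Matrix (Fin 2) (Fin 2) ℝ) (x y : R2) :
    wedge (mulVecE M x) (mulVecE M y) = M.det * wedge x y := by
  simp only [wedge, mulVecE_zero_coord, mulVecE_one_coord, Matrix.det_fin_two]
  ring

lemma wedge_sq_add_inner_sq (x y : R2) :
    wedge x y ^ 2 + (x 0 * y 0 + x 1 * y 1) ^ 2 = ‖x‖ ^ 2 * ‖y‖ ^ 2 := by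
  rw [R2.norm_sq, R2.norm_sq, wedge]
  ring

lemma abs_wedge_le (x y : R2) : |wedge x y| ≤ ‖x‖ * ‖y‖ := by
  refine abs_le_of_sq_le_sq ?_ (by positivity)
  nlinarith [wedge_sq_add_inner_sq x y, sq_nonneg (x 0 * y 0 + x 1 * y 1)]

/-- Rotation by a quarter turn. -/
def quarterTurn (x : R2) : R2 := !₂[-(x 1), x 0]

lemma norm_quarterTurn (x : R2) : ‖quarterTurn x‖ = ‖x‖ := by
  rw [← sq_eq_sq₀ (norm_nonneg _) (norm_nonneg _), R2.norm_sq, R2.norm_sq]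
  simp [quarterTurn]
  ring

lemma wedge_quarterTurn (x : R2) : wedge x (quarterTurn x) = ‖x‖ ^ 2 := by
  rw [R2.norm_sq]
  simp [wedge, quarterTurn]
  ring

lemma mulVecE_inv_mulVecE {M : Matrix (Fin 2) (Fin 2) ℝ} (hM : M.det = 1) (v : R2) :
    mulVecE M⁻¹ (mulVecE M v) = v := by
  rw [← mulVecE_mul, Matrix.nonsing_inv_mul _ (by simp [hM]), mulVecE_one]

lemma mulVecE_mulVecE_inv {M : Matrix (Fin 2) (Fin 2) ℝ} (hM : M.det = 1) (v : R2) :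
    mulVecE M (mulVecE M⁻¹ v) = v := by
  rw [← mulVecE_mul, Matrix.mul_nonsing_inv _ (by simp [hM]), mulVecE_one]

lemma det_inv_eq_one {M : Matrix (Fin 2) (Fin 2) ℝ} (hM : M.det = 1) : M⁻¹.det = 1 := by
  rw [Matrix.det_nonsing_inv, hM, Ring.inverse_one]

lemma norm_le_opNorm_mul {M : Matrix (Fin 2) (Fin 2) ℝ} (hM : M.det = 1) (v : R2) :
    ‖v‖ ≤ opNorm M * ‖mulVecE M v‖ := by
  rcases eq_or_ne v 0 with rfl | hv
  · simpa using mul_nonneg (opNorm_nonneg M) (norm_nonneg _)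
  have h1 : ‖v‖ ^ 2 ≤ ‖mulVecE M v‖ * (opNorm M * ‖v‖) := by
    calc ‖v‖ ^ 2 = |wedge (mulVecE M v) (mulVecE M (quarterTurn v))| := by
          rw [wedge_mulVecE, hM, one_mul, wedge_quarterTurn, abs_of_nonneg (by positivity)]
      _ ≤ ‖mulVecE M v‖ * ‖mulVecE M (quarterTurn v)‖ := abs_wedge_le _ _
      _ ≤ ‖mulVecE M v‖ * (opNorm M * ‖v‖) := by
          gcongr
          exact (norm_mulVecE_le _ _).trans_eq (by rw [norm_quarterTurn])
  have hv' : 0 < ‖v‖ := norm_pos_iff.2 hv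
  nlinarith

lemma one_le_opNorm {M : Matrix (Fin 2) (Fin 2) ℝ} (hM : M.det = 1) : 1 ≤ opNorm M := by
  have h1 := norm_le_opNorm_mul hM (EuclideanSpace.single 0 1)
  have h2 := norm_mulVecE_le M (EuclideanSpace.single 0 1)
  simp only [PiLp.norm_single, norm_one, mul_one] at h1 h2
  nlinarith [opNorm_nonneg M, norm_nonneg (mulVecE M (EuclideanSpace.single 0 1))]

lemma mulVecE_ne_zero {M : Matrix (Fin 2) (Fin 2) ℝ} (hM : M.det = 1) {v : R2} (hv : v ≠ 0) :
    mulVecE M v ≠ 0 := fun h => hv <| by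
  rw [← mulVecE_inv_mulVecE hM v, h, mulVecE_zero]

lemma opNorm_inv {M : Matrix (Fin 2) (Fin 2) ℝ} (hM : M.det = 1) : opNorm M⁻¹ = opNorm M := by
  have key : ∀ {N : Matrix (Fin 2) (Fin 2) ℝ}, N.det = 1 → opNorm N⁻¹ ≤ opNorm N := fun hN =>
    opNorm_le_of_forall (opNorm_nonneg _) fun v =>
      (norm_le_opNorm_mul hN _).trans_eq (by rw [mulVecE_mulVecE_inv hN])
  refine le_antisymm (key hM) ?_
  have := key (det_inv_eq_one hM)
  rwa [Matrix.nonsing_inv_nonsing_inv _ (by simp [hM])] at this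

lemma continuous_mulVecE (M : Matrix (Fin 2) (Fin 2) ℝ) : Continuous (mulVecE M) :=
  (Matrix.toEuclideanCLM (𝕜 := ℝ) M : R2 →L[ℝ] R2).continuous

lemma measurable_R2_of_coord {α : Type*} [MeasurableSpace α] {f : α → R2}
    (h0 : Measurable fun a => f a 0) (h1 : Measurable fun a => f a 1) : Measurable f := by
  have : f = fun a => WithLp.toLp 2 ![f a 0, f a 1] := by
    ext a i
    fin_cases i <;> rfl
  rw [this]
  refine (WithLp.measurable_toLp 2 (Fin 2 → ℝ)).comp (measurable_pi_iff.2 fun i => ?_)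
  fin_cases i
  · exact h0
  · exact h1

lemma measurable_R2_coord (i : Fin 2) : Measurable fun x : R2 => x i :=
  (PiLp.continuous_apply 2 _ i).measurable

lemma measurable_mulVecE {α : Type*} [MeasurableSpace α] {M : α → Matrix (Fin 2) (Fin 2) ℝ}
    (hM : ∀ i j, Measurable fun a => M a i j) {f : α → R2} (hf : Measurable f) :
    Measurable fun a => mulVecE (M a) (f a) := by
  have h : ∀ i, Measurable fun a => f a i := fun i => (measurable_R2_coord i).comp hf
  apply measurable_R2_of_coord
  · simp only [mulVecE_zero_coord]
    exact ((hM 0 0).mul (h 0)).add ((hM 0 1).mul (h 1))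
  · simp only [mulVecE_one_coord]
    exact ((hM 1 0).mul (h 0)).add ((hM 1 1).mul (h 1))

lemma measurable_opNorm {α : Type*} [MeasurableSpace α] {M : α → Matrix (Fin 2) (Fin 2) ℝ}
    (hM : ∀ i j, Measurable fun a => M a i j) : Measurable fun a => opNorm (M a) := by
  have hc : Continuous fun N : Fin 2 → Fin 2 → ℝ => opNorm (Matrix.of N) := by
    let L : (Fin 2 → Fin 2 → ℝ) →ₗ[ℝ] (R2 →L[ℝ] R2) :=
      { toFun := fun N => Matrix.toEuclideanCLM (n := Fin 2) (𝕜 := ℝ) (Matrix.of N)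
        map_add' := fun N N' => map_add (Matrix.toEuclideanCLM (n := Fin 2) (𝕜 := ℝ)) _ _
        map_smul' := fun t N => map_smul (Matrix.toEuclideanCLM (n := Fin 2) (𝕜 := ℝ)) t _ }
    have h1 : Continuous L := L.continuous_of_finiteDimensional
    exact h1.norm
  exact hc.measurable.comp (measurable_pi_iff.2 fun i => measurable_pi_iff.2 fun j => hM i j)

lemma measurable_matrix_inv {α : Type*} [MeasurableSpace α] {M : α → Matrix (Fin 2) (Fin 2) ℝ}
    (hM : ∀ i j, Measurable fun a => M a i j) (hdet : ∀ a, (M a).det = 1) (i j : Fin 2) :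
    Measurable fun a => (M a)⁻¹ i j := by
  have h : ∀ a, (M a)⁻¹ = !![M a 1 1, -M a 0 1; -M a 1 0, M a 0 0] := fun a => by
    rw [Matrix.inv_def, hdet, Ring.inverse_one, one_smul, Matrix.adjugate_fin_two]
  simp only [h]
  fin_cases i <;> fin_cases j
  · exact hM 1 1
  · exact (hM 0 1).neg
  · exact (hM 1 0).neg
  · exact hM 0 0

section Cocycle
variable {Θ : Type*} {T : Θ → Θ} {A : Θ → Matrix (Fin 2) (Fin 2) ℝ}

lemma coc_add (n k : ℕ) (θ : Θ) : coc T A (n + k) θ = coc T A k (T^[n] θ) * coc T A n θ := by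
  induction n generalizing θ with
  | zero => simp [coc]
  | succ n ih =>
    rw [Nat.add_right_comm, coc, ih, coc, Function.iterate_succ_apply, Matrix.mul_assoc]

lemma coc_one (θ : Θ) : coc T A 1 θ = A θ := by simp [coc]

lemma coc_succ (n : ℕ) (θ : Θ) : coc T A (n + 1) θ = A (T^[n] θ) * coc T A n θ := by
  rw [coc_add, coc_one]

lemma det_coc (hdet : ∀ θ, (A θ).det = 1) (n : ℕ) (θ : Θ) : (coc T A n θ).det = 1 := by
  induction n generalizing θ with
  | zero => simp [coc]
  | succ n ih => rw [coc, Matrix.det_mul, ih, hdet, one_mul]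

lemma measurable_coc [MeasurableSpace Θ] (hT : Measurable T)
    (hA : ∀ i j, Measurable fun θ => A θ i j) (n : ℕ) (i j : Fin 2) :
    Measurable fun θ => coc T A n θ i j := by
  induction n generalizing i j with
  | zero => simp [coc]
  | succ n ih =>
    simp only [coc, Matrix.mul_apply, Fin.sum_univ_two]
    exact (((ih i 0).comp hT).mul (hA 0 j)).add (((ih i 1).comp hT).mul (hA 1 j))

/-- The logarithmic norm growth of a cocycle. -/
def logCoc (T : Θ → Θ) (A : Θ → Matrix (Fin 2) (Fin 2) ℝ) (n : ℕ) (θ : Θ) : ℝ :=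
  Real.log (opNorm (coc T A n θ))

lemma measurable_logCoc [MeasurableSpace Θ] (hT : Measurable T)
    (hA : ∀ i j, Measurable fun θ => A θ i j) (n : ℕ) : Measurable (logCoc T A n) :=
  Real.measurable_log.comp (measurable_opNorm (measurable_coc hT hA n))

lemma opNorm_coc_pos (hdet : ∀ θ, (A θ).det = 1) (n : ℕ) (θ : Θ) : 0 < opNorm (coc T A n θ) :=
  zero_lt_one.trans_le (one_le_opNorm (det_coc hdet n θ))

lemma exp_logCoc (hdet : ∀ θ, (A θ).det = 1) (n : ℕ) (θ : Θ) :
    Real.exp (logCoc T A n θ) = opNorm (coc T A n θ) :=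
  Real.exp_log (opNorm_coc_pos hdet n θ)

lemma logCoc_nonneg (hdet : ∀ θ, (A θ).det = 1) (n : ℕ) (θ : Θ) : 0 ≤ logCoc T A n θ :=
  Real.log_nonneg (one_le_opNorm (det_coc hdet n θ))

lemma logCoc_add_le (hdet : ∀ θ, (A θ).det = 1) (n k : ℕ) (θ : Θ) :
    logCoc T A (n + k) θ ≤ logCoc T A n θ + logCoc T A k (T^[n] θ) := by
  rw [logCoc, logCoc, logCoc, ← Real.log_mul (opNorm_coc_pos hdet _ _).ne'
    (opNorm_coc_pos hdet _ _).ne', coc_add, mul_comm (opNorm _)]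
  refine Real.log_le_log ?_ (opNorm_mul_le _ _)
  rw [← coc_add]
  exact opNorm_coc_pos hdet _ _

lemma logCoc_le (hdet : ∀ θ, (A θ).det = 1) {C : ℝ} (hC : ∀ θ, opNorm (A θ) ≤ C) (n : ℕ) (θ : Θ) :
    logCoc T A n θ ≤ Real.log C * n := by
  induction n generalizing θ with
  | zero =>
    have : opNorm (1 : Matrix (Fin 2) (Fin 2) ℝ) = 1 :=
      le_antisymm opNorm_one (one_le_opNorm (by simp))
    simp [logCoc, coc, this]
  | succ n ih =>
    have h1 : logCoc T A 1 (T^[n] θ) ≤ Real.log C := by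
      rw [logCoc, coc_one]
      exact Real.log_le_log (zero_lt_one.trans_le (one_le_opNorm (hdet _))) (hC _)
    have := logCoc_add_le (T := T) hdet n 1 θ
    push_cast
    linarith [ih θ]

/-- The generator of the inverse cocycle over the inverse of the base map. -/
def invGen (γ : Θ ≃ Θ) (A : Θ → Matrix (Fin 2) (Fin 2) ℝ) (θ : Θ) : Matrix (Fin 2) (Fin 2) ℝ :=
  (A (γ.symm θ))⁻¹

/-- The inverse cocycle. -/
abbrev bcoc (γ : Θ ≃ Θ) (A : Θ → Matrix (Fin 2) (Fin 2) ℝ) : ℕ → Θ → Matrix (Fin 2) (Fin 2) ℝ :=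
  coc γ.symm (invGen γ A)

lemma det_invGen (γ : Θ ≃ Θ) (hdet : ∀ θ, (A θ).det = 1) (θ : Θ) : (invGen γ A θ).det = 1 :=
  det_inv_eq_one (hdet _)

lemma measurable_invGen [MeasurableSpace Θ] {γ : Θ ≃ Θ} (hγ' : Measurable γ.symm)
    (hdet : ∀ θ, (A θ).det = 1) (hA : ∀ i j, Measurable fun θ => A θ i j) (i j : Fin 2) :
    Measurable fun θ => invGen γ A θ i j :=
  measurable_matrix_inv (fun i j => (hA i j).comp hγ') (fun _ => hdet _) i j

lemma opNorm_invGen (γ : Θ ≃ Θ) (hdet : ∀ θ, (A θ).det = 1) (θ : Θ) :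
    opNorm (invGen γ A θ) = opNorm (A (γ.symm θ)) := opNorm_inv (hdet _)

lemma invGen_apply (γ : Θ ≃ Θ) (A : Θ → Matrix (Fin 2) (Fin 2) ℝ) (θ : Θ) :
    invGen γ A (γ θ) = (A θ)⁻¹ := by rw [invGen, Equiv.symm_apply_apply]

lemma bcoc_succ_mulVecE (γ : Θ ≃ Θ) (hdet : ∀ θ, (A θ).det = 1) (n : ℕ) (θ : Θ) (v : R2) :
    mulVecE (bcoc γ A (n + 1) (γ θ)) (mulVecE (A θ) v) = mulVecE (bcoc γ A n θ) v := by
  rw [bcoc, coc, Equiv.symm_apply_apply, mulVecE_mul, invGen_apply, mulVecE_inv_mulVecE (hdet _)]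

lemma bcoc_iterate_mulVecE (γ : Θ ≃ Θ) (hdet : ∀ θ, (A θ).det = 1) (n : ℕ) (θ : Θ) (v : R2) :
    mulVecE (bcoc γ A n (γ^[n] θ)) (mulVecE (coc γ A n θ) v) = v := by
  induction n with
  | zero => simp [coc, mulVecE_one]
  | succ n ih =>
    rw [coc_succ, mulVecE_mul, Function.iterate_succ_apply', bcoc_succ_mulVecE γ hdet, ih]

lemma opNorm_bcoc_iterate (γ : Θ ≃ Θ) (hdet : ∀ θ, (A θ).det = 1) (n : ℕ) (θ : Θ) :
    opNorm (bcoc γ A n (γ^[n] θ)) = opNorm (coc γ A n θ) := by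
  rw [← opNorm_inv (det_coc hdet n θ)]
  congr 1
  symm
  apply Matrix.inv_eq_left_inv
  refine Matrix.ext_of_mulVec_single fun i => ?_
  have h := bcoc_iterate_mulVecE γ hdet n θ (WithLp.toLp 2 (Pi.single i 1))
  rw [← mulVecE_mul] at h
  rw [Matrix.one_mulVec]
  exact congrArg (WithLp.equiv 2 (Fin 2 → ℝ)) h

lemma logCoc_bcoc_iterate (γ : Θ ≃ Θ) (hdet : ∀ θ, (A θ).det = 1) (n : ℕ) (θ : Θ) :
    logCoc γ.symm (invGen γ A) n (γ^[n] θ) = logCoc γ A n θ := by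
  rw [logCoc, logCoc, opNorm_bcoc_iterate γ hdet]

end Cocycle

section CocycleErgodic
variable {Θ : Type*} [MeasurableSpace Θ] {A : Θ → Matrix (Fin 2) (Fin 2) ℝ}

lemma Ergodic.equiv_symm {γ : Θ ≃ Θ} {m : Measure Θ} (hγ : Measurable γ)
    (hγ' : Measurable γ.symm) (herg : Ergodic γ m) : Ergodic γ.symm m :=
  Ergodic.symm (e := ⟨γ, hγ, hγ'⟩) herg

lemma ae_tendsto_logCoc {T : Θ → Θ} {m : Measure Θ} [IsProbabilityMeasure m] (hT : Ergodic T m)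
    (hdet : ∀ θ, (A θ).det = 1) (hA : ∀ i j, Measurable fun θ => A θ i j) {C : ℝ}
    (hC : ∀ θ, opNorm (A θ) ≤ C) {lam : ℝ}
    (hlam : Tendsto (fun n : ℕ => (∫ θ, logCoc T A n θ ∂m) / n) atTop (𝓝 lam)) :
    ∀ᵐ θ ∂m, Tendsto (fun n : ℕ => logCoc T A n θ / n) atTop (𝓝 lam) :=
  subadditive_ergodic hT (measurable_logCoc hT.measurable hA) (logCoc_nonneg hdet)
    (logCoc_le hdet hC) (logCoc_add_le hdet) hlam

lemma integral_logCoc_inv {γ : Θ ≃ Θ} {m : Measure Θ} (hγ : MeasurePreserving γ m m)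
    (hγ' : Measurable γ.symm) (hdet : ∀ θ, (A θ).det = 1)
    (hA : ∀ i j, Measurable fun θ => A θ i j) (n : ℕ) :
    ∫ θ, logCoc γ.symm (invGen γ A) n θ ∂m = ∫ θ, logCoc γ A n θ ∂m := by
  have hn := hγ.iterate n
  have h := integral_map (μ := m) (φ := γ^[n]) hn.measurable.aemeasurable
    (f := logCoc γ.symm (invGen γ A) n)
    (measurable_logCoc hγ' (measurable_invGen hγ' hdet hA) n).aestronglyMeasurable
  rw [hn.map_eq] at h
  rw [h]
  simp only [logCoc_bcoc_iterate γ hdet]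

end CocycleErgodic

lemma norm_vFull (α : ℝ) : ‖vFull α‖ = 1 := by
  rw [← sq_eq_sq₀ (norm_nonneg _) zero_le_one, R2.norm_sq]
  simp [vFull]

lemma vFull_zero_coord (α : ℝ) : vFull α 0 = Real.cos (2 * Real.pi * α) := by simp [vFull]

lemma vFull_one_coord (α : ℝ) : vFull α 1 = Real.sin (2 * Real.pi * α) := by simp [vFull]

/-- The squared Frobenius norm. -/
def frobSq (M : Matrix (Fin 2) (Fin 2) ℝ) : ℝ := M 0 0 ^ 2 + M 0 1 ^ 2 + M 1 0 ^ 2 + M 1 1 ^ 2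

/-- The point of the unit disc representing the conformal class of `MᵀM`; it points in the
(doubled) direction which is contracted most by `M`. -/
def contrDir (M : Matrix (Fin 2) (Fin 2) ℝ) : ℂ :=
  ⟨(M 0 1 ^ 2 + M 1 1 ^ 2 - M 0 0 ^ 2 - M 1 0 ^ 2) / frobSq M,
    -2 * (M 0 0 * M 0 1 + M 1 0 * M 1 1) / frobSq M⟩

lemma opNorm_sq_le_frobSq (M : Matrix (Fin 2) (Fin 2) ℝ) : opNorm M ^ 2 ≤ frobSq M := by
  have hF : 0 ≤ frobSq M := by unfold frobSq; positivity
  rw [← Real.sq_sqrt hF]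
  refine pow_le_pow_left₀ (opNorm_nonneg _) (opNorm_le_of_forall (Real.sqrt_nonneg _) fun v => ?_) 2
  rw [← sq_le_sq₀ (norm_nonneg _) (by positivity), mul_pow, Real.sq_sqrt hF, R2.norm_sq,
    R2.norm_sq, mulVecE_zero_coord, mulVecE_one_coord, frobSq]
  nlinarith [sq_nonneg (M 0 0 * v 1 - M 0 1 * v 0), sq_nonneg (M 1 0 * v 1 - M 1 1 * v 0)]

lemma frobSq_le (M : Matrix (Fin 2) (Fin 2) ℝ) : frobSq M ≤ 2 * opNorm M ^ 2 := by
  have key : ∀ i : Fin 2, M 0 i ^ 2 + M 1 i ^ 2 ≤ opNorm M ^ 2 := fun i => by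
    have h := norm_mulVecE_le M (EuclideanSpace.single i 1)
    simp only [PiLp.norm_single, norm_one, mul_one] at h
    have h2 := pow_le_pow_left₀ (norm_nonneg _) h 2
    rw [R2.norm_sq, mulVecE_zero_coord, mulVecE_one_coord] at h2
    fin_cases i <;> simpa using h2
  have h0 := key 0
  have h1 := key 1
  unfold frobSq
  linarith

lemma frobSq_pos {M : Matrix (Fin 2) (Fin 2) ℝ} (hM : M.det = 1) : 0 < frobSq M :=
  (by have := one_le_opNorm hM; positivity : 0 < opNorm M ^ 2).trans_le (opNorm_sq_le_frobSq M)

lemma two_mul_norm_mulVecE_sq {M : Matrix (Fin 2) (Fin 2) ℝ} (hM : M.det = 1) (v : R2) :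
    2 * ‖mulVecE M v‖ ^ 2 = frobSq M * (‖v‖ ^ 2 -
      ((contrDir M).re * (v 0 ^ 2 - v 1 ^ 2) + (contrDir M).im * (2 * v 0 * v 1))) := by
  have := (frobSq_pos hM).ne'
  simp only [contrDir, R2.norm_sq, mulVecE_zero_coord, mulVecE_one_coord]
  field_simp
  rw [frobSq]
  ring

lemma frobSq_sq_mul {M : Matrix (Fin 2) (Fin 2) ℝ} (hM : M.det = 1) :
    frobSq M ^ 2 * (1 - ((contrDir M).re ^ 2 + (contrDir M).im ^ 2)) = 4 := by
  have := (frobSq_pos hM).ne'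
  simp only [contrDir]
  field_simp
  rw [Matrix.det_fin_two] at hM
  have h2 : (4 : ℝ) = 4 * (M 0 0 * M 1 1 - M 0 1 * M 1 0) ^ 2 := by rw [hM]; ring
  rw [h2, frobSq]
  ring

lemma frobSq_mul_frobSq_mul {B M : Matrix (Fin 2) (Fin 2) ℝ} (hB : B.det = 1) (hM : M.det = 1) :
    frobSq M * frobSq (B * M) * (1 - ((contrDir M).re * (contrDir (B * M)).re +
      (contrDir M).im * (contrDir (B * M)).im)) = 2 * frobSq B := by
  have h1 := (frobSq_pos hM).ne'
  have h2 := (frobSq_pos (M := B * M) (by rw [Matrix.det_mul, hB, hM, one_mul])).ne'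
  simp only [contrDir]
  field_simp
  rw [Matrix.det_fin_two] at hM
  have h3 : 2 * frobSq B = 2 * frobSq B * (M 0 0 * M 1 1 - M 0 1 * M 1 0) ^ 2 := by
    rw [hM]; ring
  rw [h3]
  simp only [frobSq, Matrix.mul_apply, Fin.sum_univ_two]
  ring

lemma dist_contrDir_mul_le {B M : Matrix (Fin 2) (Fin 2) ℝ} (hB : B.det = 1) (hM : M.det = 1)
    {C : ℝ} (hC : opNorm B ≤ C) :
    dist (contrDir M) (contrDir (B * M)) ≤ 3 * C / (opNorm M * opNorm (B * M)) := by
  have hBM : (B * M).det = 1 := by rw [Matrix.det_mul, hB, hM, one_mul]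
  have o1 := one_le_opNorm hM
  have o2 := one_le_opNorm hBM
  have o3 := one_le_opNorm hB
  have f1 := opNorm_sq_le_frobSq M
  have f2 := opNorm_sq_le_frobSq (B * M)
  have hk := frobSq_mul_frobSq_mul hB hM
  have hb := frobSq_le B
  have p1 := frobSq_sq_mul hM
  have p2 := frobSq_sq_mul hBM
  have q1 : (contrDir M).re ^ 2 + (contrDir M).im ^ 2 ≤ 1 := by
    by_contra hcon
    nlinarith [sq_nonneg (frobSq M)]
  have q2 : (contrDir (B * M)).re ^ 2 + (contrDir (B * M)).im ^ 2 ≤ 1 := by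
    by_contra hcon
    nlinarith [sq_nonneg (frobSq (B * M))]
  have hdist : dist (contrDir M) (contrDir (B * M)) ^ 2 =
      ((contrDir M).re - (contrDir (B * M)).re) ^ 2 +
      ((contrDir M).im - (contrDir (B * M)).im) ^ 2 := by
    rw [Complex.dist_eq, ← Complex.normSq_eq_norm_sq, Complex.normSq_apply]
    simp
    ring
  have hle : dist (contrDir M) (contrDir (B * M)) ^ 2 ≤
      2 * (1 - ((contrDir M).re * (contrDir (B * M)).re +
      (contrDir M).im * (contrDir (B * M)).im)) := by
    rw [hdist]; nlinarith
  have o4 : 0 ≤ 3 * C := by linarith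
  rw [le_div_iff₀ (by positivity), ← sq_le_sq₀ (by positivity) o4, mul_pow]
  have hff : (opNorm M * opNorm (B * M)) ^ 2 ≤ frobSq M * frobSq (B * M) := by
    rw [mul_pow]
    exact mul_le_mul f1 f2 (sq_nonneg _) (frobSq_pos hM).le
  calc dist (contrDir M) (contrDir (B * M)) ^ 2 * (opNorm M * opNorm (B * M)) ^ 2
      ≤ 2 * (1 - ((contrDir M).re * (contrDir (B * M)).re +
      (contrDir M).im * (contrDir (B * M)).im)) * (frobSq M * frobSq (B * M)) :=
        mul_le_mul hle hff (by positivity) ((sq_nonneg _).trans hle)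
    _ = 4 * frobSq B := by linarith
    _ ≤ 8 * opNorm B ^ 2 := by linarith
    _ ≤ (3 * C) ^ 2 := by nlinarith

section Oseledets

variable {M B : ℕ → Matrix (Fin 2) (Fin 2) ℝ} {C lam : ℝ}

/-- The data of a bounded sequence of unimodular products with exponential norm growth. -/
structure HypProd (M B : ℕ → Matrix (Fin 2) (Fin 2) ℝ) (C lam : ℝ) : Prop where
  step : ∀ n, M (n + 1) = B n * M n
  det_step : ∀ n, (B n).det = 1
  det_prod : ∀ n, (M n).det = 1
  bound : ∀ n, opNorm (B n) ≤ C
  pos : 0 < lam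
  growth : Tendsto (fun n : ℕ => Real.log (opNorm (M n)) / n) atTop (𝓝 lam)

lemma HypProd.exists_growth (H : HypProd M B C lam) {ε : ℝ} (hε : 0 < ε) :
    ∃ D : ℝ, ∀ n : ℕ, Real.exp ((lam - ε) * n - D) ≤ opNorm (M n) ∧
      opNorm (M n) ≤ Real.exp ((lam + ε) * n + D) := by
  obtain ⟨D, -, hD⟩ := exists_abs_sub_le_of_tendsto_div H.growth hε
  refine ⟨D, fun n => ?_⟩
  have hpos : 0 < opNorm (M n) := zero_lt_one.trans_le (one_le_opNorm (H.det_prod n))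
  have := abs_le.1 (hD n)
  constructor
  · rw [← Real.le_log_iff_exp_le hpos]; linarith
  · rw [← Real.log_le_iff_le_exp hpos]; linarith

lemma HypProd.exists_dist_le (H : HypProd M B C lam) : ∃ D : ℝ, 0 ≤ D ∧ ∀ n : ℕ,
    dist (contrDir (M n)) (contrDir (M (n + 1))) ≤ D * Real.exp (-(3 / 2) * lam) ^ n := by
  obtain ⟨D, hD⟩ := H.exists_growth (ε := lam / 4) (by linarith [H.pos])
  have hC : 0 ≤ C := (opNorm_nonneg _).trans (H.bound 0)
  refine ⟨3 * C * Real.exp (2 * D), by positivity, fun n => ?_⟩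
  have h1 := dist_contrDir_mul_le (H.det_step n) (H.det_prod n) (H.bound n)
  rw [← H.step] at h1
  refine h1.trans ?_
  rw [mul_assoc, div_eq_mul_inv]
  gcongr
  have h2 := (hD n).1
  have h3 := (hD (n + 1)).1
  rw [inv_le_comm₀ (mul_pos ((Real.exp_pos _).trans_le h2) ((Real.exp_pos _).trans_le h3))
    (by positivity)]
  calc (Real.exp (2 * D) * Real.exp (-(3 / 2) * lam) ^ n)⁻¹
      = Real.exp ((lam - lam / 4) * n - D) * Real.exp ((lam - lam / 4) * n - D) := by
        rw [← Real.exp_nat_mul, ← Real.exp_add, ← Real.exp_add, ← Real.exp_neg]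
        ring_nf
    _ ≤ Real.exp ((lam - lam / 4) * n - D) * Real.exp ((lam - lam / 4) * (n + 1 : ℕ) - D) := by
        gcongr <;> linarith [H.pos]
    _ ≤ _ := mul_le_mul h2 h3 (by positivity) (opNorm_nonneg _)

lemma HypProd.exists_tendsto (H : HypProd M B C lam) :
    ∃ S : ℂ, Tendsto (fun n => contrDir (M n)) atTop (𝓝 S) := by
  obtain ⟨D, -, hD⟩ := H.exists_dist_le
  exact cauchySeq_tendsto_of_complete (cauchySeq_of_le_geometric _ D
    (by rw [Real.exp_lt_one_iff]; linarith [H.pos]) hD)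

/-- A unit vector whose doubled direction is that of `S`. -/
def halfDir (S : ℂ) : R2 := vFull (S.arg / (4 * Real.pi))

lemma norm_halfDir (S : ℂ) : ‖halfDir S‖ = 1 := norm_vFull _

lemma halfDir_sq {S : ℂ} (hS : ‖S‖ = 1) :
    halfDir S 0 ^ 2 - halfDir S 1 ^ 2 = S.re ∧ 2 * halfDir S 0 * halfDir S 1 = S.im := by
  have h0 : S ≠ 0 := by rintro rfl; simp at hS
  have e : 2 * Real.pi * (S.arg / (4 * Real.pi)) = S.arg / 2 := by
    field_simp
    ring
  have hc := Complex.cos_arg h0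
  have hs := Complex.sin_arg S
  have hc2 := Real.cos_two_mul (S.arg / 2)
  have hs2 := Real.sin_two_mul (S.arg / 2)
  rw [mul_div_cancel₀ _ two_ne_zero] at hc2 hs2
  rw [hS, div_one] at hc hs
  rw [halfDir, vFull_zero_coord, vFull_one_coord, e, ← hc, ← hs, hc2, hs2]
  refine ⟨?_, ?_⟩
  · nlinarith [Real.sin_sq_add_cos_sq (S.arg / 2)]
  · ring

variable {S : ℂ}

lemma HypProd.one_sub_norm_sq (H : HypProd M B C lam) (n : ℕ) :
    1 - ‖contrDir (M n)‖ ^ 2 = 4 / frobSq (M n) ^ 2 := by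
  have h1 := frobSq_sq_mul (H.det_prod n)
  have h2 := frobSq_pos (H.det_prod n)
  rw [← Complex.normSq_eq_norm_sq, Complex.normSq_apply]
  field_simp
  linarith

lemma HypProd.tendsto_opNorm (H : HypProd M B C lam) :
    Tendsto (fun n => opNorm (M n)) atTop atTop := by
  obtain ⟨D, hD⟩ := H.exists_growth (ε := lam / 2) (by linarith [H.pos])
  refine tendsto_atTop_mono (fun n => (hD n).1) (Real.tendsto_exp_atTop.comp ?_)
  refine tendsto_atTop_add_const_right _ _ ?_
  exact tendsto_natCast_atTop_atTop.const_mul_atTop (by linarith [H.pos])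

lemma HypProd.tendsto_frobSq (H : HypProd M B C lam) :
    Tendsto (fun n => frobSq (M n)) atTop atTop :=
  tendsto_atTop_mono (fun n => (by
    have := opNorm_sq_le_frobSq (M n)
    have := one_le_opNorm (H.det_prod n)
    nlinarith : opNorm (M n) ≤ frobSq (M n))) H.tendsto_opNorm

lemma HypProd.norm_lim (H : HypProd M B C lam)
    (hS : Tendsto (fun n => contrDir (M n)) atTop (𝓝 S)) : ‖S‖ = 1 := by
  have h1 : Tendsto (fun n => 1 - ‖contrDir (M n)‖ ^ 2) atTop (𝓝 (1 - ‖S‖ ^ 2)) :=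
    (hS.norm.pow 2).const_sub 1
  have h2 : Tendsto (fun n => 4 / frobSq (M n) ^ 2) atTop (𝓝 0) :=
    tendsto_const_nhds.div_atTop ((tendsto_pow_atTop two_ne_zero).comp H.tendsto_frobSq)
  simp only [H.one_sub_norm_sq] at h1
  have := tendsto_nhds_unique h1 h2
  have h3 : ‖S‖ ^ 2 = 1 := by linarith
  rwa [pow_eq_one_iff_of_nonneg (norm_nonneg _) two_ne_zero] at h3

lemma HypProd.tendsto_zero (H : HypProd M B C lam)
    (hS : Tendsto (fun n => contrDir (M n)) atTop (𝓝 S)) :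
    Tendsto (fun n => ‖mulVecE (M n) (halfDir S)‖) atTop (𝓝 0) := by
  obtain ⟨D, hD0, hD⟩ := H.exists_dist_le
  have hr : Real.exp (-(3 / 2) * lam) < 1 := by rw [Real.exp_lt_one_iff]; linarith [H.pos]
  have hdist := dist_le_of_le_geometric_of_tendsto _ D hr hD hS
  obtain ⟨E, hE⟩ := H.exists_growth (ε := lam / 4) (by linarith [H.pos])
  obtain ⟨hq0, hq1⟩ := halfDir_sq (H.norm_lim hS)
  have hsq : ∀ n, ‖mulVecE (M n) (halfDir S)‖ ^ 2 =
      frobSq (M n) * dist (contrDir (M n)) S ^ 2 / 4 + 1 / frobSq (M n) := fun n => by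
    have h1 := two_mul_norm_mulVecE_sq (H.det_prod n) (halfDir S)
    have h2 := frobSq_sq_mul (H.det_prod n)
    have h3 := frobSq_pos (H.det_prod n)
    have h4 : S.re ^ 2 + S.im ^ 2 = 1 := by
      have := H.norm_lim hS
      rw [← sq_eq_sq₀ (norm_nonneg _) zero_le_one, ← Complex.normSq_eq_norm_sq,
        Complex.normSq_apply] at this
      linarith
    rw [hq0, hq1, norm_halfDir] at h1
    have hd : dist (contrDir (M n)) S ^ 2 =
        ((contrDir (M n)).re - S.re) ^ 2 + ((contrDir (M n)).im - S.im) ^ 2 := by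
      rw [Complex.dist_eq, ← Complex.normSq_eq_norm_sq, Complex.normSq_apply]
      simp
      ring
    rw [hd]
    set F := frobSq (M n)
    have h5 : 1 / F = F * (1 - ((contrDir (M n)).re ^ 2 + (contrDir (M n)).im ^ 2)) / 4 := by
      field_simp
      linarith
    rw [h5]
    have : S.re ^ 2 = 1 - S.im ^ 2 := by linarith
    linear_combination (1 / 2) * h1 - F / 4 * h4
  have hlim : Tendsto (fun n => ‖mulVecE (M n) (halfDir S)‖ ^ 2) atTop (𝓝 0) := by
    simp only [hsq]
    rw [← add_zero (0 : ℝ)]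
    refine Tendsto.add ?_ (tendsto_const_nhds.div_atTop H.tendsto_frobSq)
    have hle : ∀ n : ℕ, frobSq (M n) * dist (contrDir (M n)) S ^ 2 / 4 ≤
        Real.exp (2 * E) * (D / (1 - Real.exp (-(3 / 2) * lam))) ^ 2 *
          Real.exp (-(1 / 2) * lam) ^ n := fun n => by
      have h1 : frobSq (M n) ≤ 2 * Real.exp ((lam + lam / 4) * n + E) ^ 2 :=
        (frobSq_le _).trans (by gcongr; exacts [opNorm_nonneg _, (hE n).2])
      have h2 : dist (contrDir (M n)) S ^ 2 ≤
          (D * Real.exp (-(3 / 2) * lam) ^ n / (1 - Real.exp (-(3 / 2) * lam))) ^ 2 := by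
        gcongr; exact hdist n
      calc frobSq (M n) * dist (contrDir (M n)) S ^ 2 / 4
          ≤ 2 * Real.exp ((lam + lam / 4) * n + E) ^ 2 *
            (D * Real.exp (-(3 / 2) * lam) ^ n / (1 - Real.exp (-(3 / 2) * lam))) ^ 2 / 4 := by
            gcongr
        _ = 1 / 2 * ((D / (1 - Real.exp (-(3 / 2) * lam))) ^ 2 *
            (Real.exp ((lam + lam / 4) * n + E) ^ 2 * (Real.exp (-(3 / 2) * lam) ^ n) ^ 2)) := by
            ring
        _ = 1 / 2 * ((D / (1 - Real.exp (-(3 / 2) * lam))) ^ 2 *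
            (Real.exp (2 * E) * Real.exp (-(1 / 2) * lam) ^ n)) := by
            congr 2
            simp only [← Real.exp_nat_mul, ← Real.exp_add]
            push_cast
            ring_nf
        _ ≤ 1 * ((D / (1 - Real.exp (-(3 / 2) * lam))) ^ 2 *
            (Real.exp (2 * E) * Real.exp (-(1 / 2) * lam) ^ n)) := by
            gcongr; norm_num
        _ = _ := by ring
    refine squeeze_zero (fun n => by have := (frobSq_pos (H.det_prod n)).le; positivity) hle ?_
    have := (tendsto_pow_atTop_nhds_zero_of_lt_one (Real.exp_pos (-(1 / 2) * lam)).le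
      (by rw [Real.exp_lt_one_iff]; linarith [H.pos])).const_mul
        (Real.exp (2 * E) * (D / (1 - Real.exp (-(3 / 2) * lam))) ^ 2)
    rwa [mul_zero] at this
  have := hlim.sqrt
  simpa [Real.sqrt_sq] using this

lemma HypProd.eventually_le (H : HypProd M B C lam)
    (hS : Tendsto (fun n => contrDir (M n)) atTop (𝓝 S)) {v : R2} (hv : wedge v (halfDir S) ≠ 0) :
    ∀ᶠ n in atTop, |wedge v (halfDir S)| / 2 * opNorm (M n) ≤ ‖mulVecE (M n) v‖ := by
  obtain ⟨hq0, hq1⟩ := halfDir_sq (H.norm_lim hS)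
  have hid : ‖v‖ ^ 2 - (S.re * (v 0 ^ 2 - v 1 ^ 2) + S.im * (2 * v 0 * v 1)) =
      2 * wedge v (halfDir S) ^ 2 := by
    have h1 := R2.norm_sq (halfDir S)
    rw [norm_halfDir] at h1
    rw [← hq0, ← hq1, R2.norm_sq, wedge]
    linear_combination (v 0 ^ 2 + v 1 ^ 2) * h1
  have hlim : Tendsto (fun n => ‖v‖ ^ 2 - ((contrDir (M n)).re * (v 0 ^ 2 - v 1 ^ 2) +
      (contrDir (M n)).im * (2 * v 0 * v 1))) atTop (𝓝 (2 * wedge v (halfDir S) ^ 2)) := by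
    rw [← hid]
    exact ((((Complex.continuous_re.tendsto S).comp hS).mul_const _).add
      (((Complex.continuous_im.tendsto S).comp hS).mul_const _)).const_sub _
  have hpos : 0 < wedge v (halfDir S) ^ 2 := by positivity
  filter_upwards [hlim.eventually (lt_mem_nhds (by linarith :
    wedge v (halfDir S) ^ 2 < 2 * wedge v (halfDir S) ^ 2))] with n hn
  rw [← sq_le_sq₀ (mul_nonneg (by positivity) (opNorm_nonneg _)) (norm_nonneg _), mul_pow, div_pow,
    sq_abs]
  have h1 := two_mul_norm_mulVecE_sq (H.det_prod n) v
  have h2 := opNorm_sq_le_frobSq (M n)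
  have h3 := frobSq_pos (H.det_prod n)
  nlinarith [mul_le_mul h2 hn.le hpos.le h3.le]

end Oseledets

lemma exists_smul_of_wedge_eq_zero {x y : R2} (hy : ‖y‖ = 1) (h : wedge x y = 0) :
    ∃ t : ℝ, |t| = ‖x‖ ∧ x = t • y := by
  have h2 := R2.norm_sq y
  rw [hy] at h2
  have hx : x = (x 0 * y 0 + x 1 * y 1) • y := by
    simp only [wedge] at h
    apply R2.ext
    · simp only [PiLp.smul_apply, smul_eq_mul]
      linear_combination x 0 * h2 + y 1 * h
    · simp only [PiLp.smul_apply, smul_eq_mul]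
      linear_combination x 1 * h2 - y 0 * h
  refine ⟨x 0 * y 0 + x 1 * y 1, ?_, hx⟩
  conv_rhs => rw [hx]
  rw [norm_smul, hy, mul_one, Real.norm_eq_abs]

lemma wedge_smul_left (t : ℝ) (x y : R2) : wedge (t • x) y = t * wedge x y := by
  simp [wedge]; ring

lemma wedge_smul_right (t : ℝ) (x y : R2) : wedge x (t • y) = t * wedge x y := by
  simp [wedge]; ring

lemma measurable_contrDir {α : Type*} [MeasurableSpace α] {M : α → Matrix (Fin 2) (Fin 2) ℝ}
    (hM : ∀ i j, Measurable fun a => M a i j) : Measurable fun a => contrDir (M a) := by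
  have hF : Measurable fun a => frobSq (M a) :=
    (((((hM 0 0).pow_const 2).add ((hM 0 1).pow_const 2)).add ((hM 1 0).pow_const 2)).add
      ((hM 1 1).pow_const 2))
  refine Complex.measurableEquivRealProd.symm.measurable.comp (Measurable.prodMk ?_ ?_)
  · exact (((((hM 0 1).pow_const 2).add ((hM 1 1).pow_const 2)).sub ((hM 0 0).pow_const 2)).sub
      ((hM 1 0).pow_const 2)).div hF
  · exact ((((hM 0 0).mul (hM 0 1)).add ((hM 1 0).mul (hM 1 1))).const_mul _).div hF

lemma measurable_vFull : Measurable vFull := by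
  apply measurable_R2_of_coord
  · simp only [vFull_zero_coord]; fun_prop
  · simp only [vFull_one_coord]; fun_prop

section
variable {Θ : Type*} [MeasurableSpace Θ] {A : Θ → Matrix (Fin 2) (Fin 2) ℝ}
  {m : Measure Θ} [IsProbabilityMeasure m] {C lam : ℝ}

lemma ae_hypProd {T : Θ → Θ} (hT : Ergodic T m)
    (hdet : ∀ θ, (A θ).det = 1) (hA : ∀ i j, Measurable fun θ => A θ i j)
    (hC : ∀ θ, opNorm (A θ) ≤ C) (hpos : 0 < lam)
    (hlam : Tendsto (fun n : ℕ => (∫ θ, logCoc T A n θ ∂m) / n) atTop (𝓝 lam)) :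
    ∀ᵐ θ ∂m, HypProd (fun n => coc T A n θ) (fun n => A (T^[n] θ)) C lam := by
  filter_upwards [ae_tendsto_logCoc hT hdet hA hC hlam] with θ hθ
  exact ⟨fun n => coc_succ n θ, fun _ => hdet _, fun n => det_coc hdet n θ, fun _ => hC _, hpos, hθ⟩

/-- Measurable choice of the contracted direction of a hyperbolic cocycle. -/
lemma exists_contracted_angle {T : Θ → Θ} (hT : Ergodic T m)
    (hdet : ∀ θ, (A θ).det = 1) (hA : ∀ i j, Measurable fun θ => A θ i j)
    (hC : ∀ θ, opNorm (A θ) ≤ C) (hpos : 0 < lam)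
    (hlam : Tendsto (fun n : ℕ => (∫ θ, logCoc T A n θ ∂m) / n) atTop (𝓝 lam)) :
    ∃ α : Θ → ℝ, Measurable α ∧ ∀ᵐ θ ∂m,
      Tendsto (fun n => opNorm (coc T A n θ)) atTop atTop ∧
      Tendsto (fun n => ‖mulVecE (coc T A n θ) (vFull (α θ))‖) atTop (𝓝 0) ∧
      ∀ v, wedge v (vFull (α θ)) ≠ 0 → ∃ c > 0, ∀ᶠ n in atTop,
        c * opNorm (coc T A n θ) ≤ ‖mulVecE (coc T A n θ) v‖ := by
  have H := ae_hypProd hT hdet hA hC hpos hlam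
  obtain ⟨S, hS, hSlim⟩ := measurable_limit_of_tendsto_metrizable_ae (μ := m) (L := atTop)
    (f := fun n θ => contrDir (coc T A n θ))
    (fun n => (measurable_contrDir (measurable_coc hT.measurable hA n)).aemeasurable)
    (H.mono fun θ hθ => hθ.exists_tendsto)
  refine ⟨fun θ => (S θ).arg / (4 * Real.pi), (Complex.measurable_arg.comp hS).div_const _, ?_⟩
  filter_upwards [H, hSlim] with θ hθ hl
  refine ⟨hθ.tendsto_opNorm, hθ.tendsto_zero hl, fun v hv => ⟨_, ?_, hθ.eventually_le hl hv⟩⟩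
  have : 0 < |wedge v (halfDir (S θ))| := abs_pos.2 hv
  positivity

lemma measure_eq_zero_of_tendsto_of_tendsto {E : Set Θ} (hE : MeasurableSet E) {T : Θ → Θ}
    (hT : MeasurePreserving T m m) {f g : ℕ → Θ → ℝ} (hf : ∀ n, Measurable (f n))
    (hg : ∀ n, Measurable (g n)) (hg0 : ∀ᵐ θ ∂m, Tendsto (fun n => g n θ) atTop (𝓝 0))
    (hf0 : ∀ᵐ θ ∂m, θ ∈ E → Tendsto (fun n => f n θ) atTop (𝓝 0))
    (hfg : ∀ᵐ θ ∂m, ∀ n, f n θ * g n (T^[n] θ) = 1) : m E = 0 := by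
  have h1 := tendstoInMeasure_of_tendsto_ae (fun n => (hg n).aestronglyMeasurable) hg0
  have h2 := tendstoInMeasure_of_tendsto_ae (μ := m) (f := fun n => E.indicator (f n)) (g := 0)
    (fun n => ((hf n).indicator hE).aestronglyMeasurable) (by
      filter_upwards [hf0] with θ hθ
      by_cases hθE : θ ∈ E
      · simpa [hθE] using hθ hθE
      · simp [hθE])
  have h3 := (h1 (1 : ENNReal) one_pos).add (h2 1 one_pos)
  simp only [add_zero] at h3
  refine le_antisymm (ge_of_tendsto' h3 fun n => ?_) zero_le
  have hS : MeasurableSet {x | (1 : ENNReal) ≤ edist (g n x) 0} :=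
    measurableSet_le measurable_const ((hg n).edist measurable_const)
  rw [← (hT.iterate n).measure_preimage hS.nullMeasurableSet]
  refine le_trans (measure_mono_ae ?_) (measure_union_le _ _)
  filter_upwards [hfg] with θ hθ hθE
  have key : ∀ x : ℝ, 1 ≤ edist x 0 ↔ 1 ≤ |x| := fun x => by
    rw [edist_dist, Real.dist_0_eq_abs, ENNReal.one_le_ofReal]
  by_cases hc : 1 ≤ |f n θ|
  · right
    change (1 : ENNReal) ≤ edist (E.indicator (f n) θ) 0
    rw [key, indicator_of_mem hθE]
    exact hc
  · left
    change (1 : ENNReal) ≤ edist (g n (T^[n] θ)) 0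
    rw [key]
    by_contra hcon
    have := congrArg abs (hθ n)
    rw [abs_mul, abs_one] at this
    nlinarith [abs_nonneg (f n θ), abs_nonneg (g n (T^[n] θ))]

/-- Measurable stable and unstable directions of an ergodic unimodular planar cocycle with positive
exponent. -/
theorem exists_oseledets {γ : Θ ≃ Θ} (hγ' : Measurable γ.symm) (herg : Ergodic γ m)
    (hdet : ∀ θ, (A θ).det = 1) (hA : ∀ i j, Measurable fun θ => A θ i j)
    (hC : ∀ θ, opNorm (A θ) ≤ C) (hpos : 0 < lam)
    (hlam : Tendsto (fun n : ℕ => (∫ θ, logCoc γ A n θ ∂m) / n) atTop (𝓝 lam)) :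
    ∃ αu αs : Θ → ℝ, Measurable αu ∧ Measurable αs ∧ ∀ᵐ θ ∂m,
      wedge (vFull (αu θ)) (vFull (αs θ)) ≠ 0 ∧
      wedge (mulVecE (A θ) (vFull (αu θ))) (vFull (αu (γ θ))) = 0 ∧
      ∀ v, wedge v (vFull (αs θ)) ≠ 0 → ∃ c > 0, ∀ᶠ n in atTop,
        c * opNorm (coc γ A n θ) ≤ ‖mulVecE (coc γ A n θ) v‖ := by
  have hmp := herg.toMeasurePreserving
  obtain ⟨αs, hsm, hs⟩ := exists_contracted_angle herg hdet hA hC hpos hlam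
  obtain ⟨αu, hum, hu⟩ := exists_contracted_angle (herg.equiv_symm hmp.measurable hγ')
    (det_invGen γ hdet) (measurable_invGen hγ' hdet hA)
    (fun θ => (opNorm_invGen γ hdet θ).trans_le (hC _)) hpos
    (by simpa only [integral_logCoc_inv hmp hγ' hdet hA] using hlam)
  have hinv : ∀ᵐ θ ∂m, wedge (mulVecE (A θ) (vFull (αu θ))) (vFull (αu (γ θ))) = 0 := by
    filter_upwards [hu, hmp.quasiMeasurePreserving.ae hu] with θ h1 h2
    by_contra hcon
    obtain ⟨c, hc, hev⟩ := h2.2.2 _ hcon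
    have t1 : Tendsto (fun n => c * opNorm (bcoc γ A (n + 1) (γ θ))) atTop atTop :=
      ((tendsto_add_atTop_iff_nat 1).2 h2.1).const_mul_atTop hc
    refine not_tendsto_nhds_of_tendsto_atTop (tendsto_atTop_mono' _ ?_ t1) 0 h1.2.1
    filter_upwards [(tendsto_add_atTop_nat 1).eventually hev] with n hn
    rwa [bcoc_succ_mulVecE γ hdet] at hn
  refine ⟨αu, αs, hum, hsm, ?_⟩
  have hpar : ∀ᵐ θ ∂m, ∀ n, wedge (mulVecE (coc γ A n θ) (vFull (αu θ)))
      (vFull (αu (γ^[n] θ))) = 0 := by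
    have hall : ∀ᵐ θ ∂m, ∀ n, wedge (mulVecE (A (γ^[n] θ)) (vFull (αu (γ^[n] θ))))
        (vFull (αu (γ (γ^[n] θ)))) = 0 :=
      ae_all_iff.2 fun n => (hmp.iterate n).quasiMeasurePreserving.ae hinv
    filter_upwards [hall] with θ hθ n
    induction n with
    | zero => simp [coc, mulVecE_one, wedge]; ring
    | succ n ih =>
      obtain ⟨t, -, ht⟩ := exists_smul_of_wedge_eq_zero (norm_vFull _) ih
      rw [coc_succ, mulVecE_mul, ht, mulVecE_smul, wedge_smul_left, Function.iterate_succ_apply',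
        hθ n, mul_zero]
  have hE : m {θ | wedge (vFull (αu θ)) (vFull (αs θ)) = 0} = 0 := by
    have mu : Measurable fun θ => vFull (αu θ) := measurable_vFull.comp hum
    have ms : Measurable fun θ => vFull (αs θ) := measurable_vFull.comp hsm
    have mc : ∀ i {f : Θ → R2}, Measurable f → Measurable fun θ => f θ i :=
      fun i _ hf => (measurable_R2_coord i).comp hf
    refine measure_eq_zero_of_tendsto_of_tendsto
      (f := fun n θ => ‖mulVecE (coc γ A n θ) (vFull (αu θ))‖)
      (g := fun n θ => ‖mulVecE (bcoc γ A n θ) (vFull (αu θ))‖) (T := γ) ?_ hmp ?_ ?_ ?_ ?_ ?_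
    · exact measurableSet_eq_fun
        (((mc 0 mu).mul (mc 1 ms)).sub ((mc 1 mu).mul (mc 0 ms))) measurable_const
    · exact fun n => (measurable_mulVecE (measurable_coc hmp.measurable hA n) mu).norm
    · exact fun n => (measurable_mulVecE
        (measurable_coc hγ' (measurable_invGen hγ' hdet hA) n) mu).norm
    · exact hu.mono fun θ h => h.2.1
    · filter_upwards [hs] with θ h hw
      obtain ⟨t, ht1, ht⟩ := exists_smul_of_wedge_eq_zero (norm_vFull _) hw
      rw [norm_vFull] at ht1
      simpa [ht, mulVecE_smul, norm_smul, ht1] using h.2.1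
    · filter_upwards [hpar] with θ h n
      obtain ⟨t, ht1, ht⟩ := exists_smul_of_wedge_eq_zero (norm_vFull _) (h n)
      have := bcoc_iterate_mulVecE γ hdet n θ (vFull (αu θ))
      rw [ht, mulVecE_smul] at this
      rw [← ht1, ← Real.norm_eq_abs, ← norm_smul, this, norm_vFull]
  filter_upwards [hs, hinv, measure_eq_zero_iff_ae_notMem.1 hE] with θ h1 h2 h3
  exact ⟨h3, h2, h1.2.2⟩

end

/-- The properties of the rescaled radial profile `x ↦ h (β x)` on `[0, ∞)`, extended by `0`. -/
structure Profile (φ : ℝ → ℝ) (β L : ℝ) : Prop where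
  cont : Continuous φ
  zero : φ 0 = 0
  mono : StrictMonoOn φ (Ici 0)
  concave : StrictConcaveOn ℝ (Ici 0) φ
  le : ∀ x, φ x ≤ L
  slope : ∀ β' < β, ∃ x₀ > 0, ∀ x ∈ Icc 0 x₀, β' * x ≤ φ x

lemma GoodH.profile {h : ℝ → ℝ} (hh : GoodH h) {β L : ℝ} (hβ : 0 < β)
    (hL : ∀ x ∈ Ici (0 : ℝ), h x ≤ L) : Profile (fun x => h (β * max x 0)) β L := by
  obtain ⟨hC2, hmono, hconc, -, -, h0, hd⟩ := hh
  have hmem : ∀ x : ℝ, β * max x 0 ∈ Ici (0 : ℝ) := fun x => mul_nonneg hβ.le (le_max_right _ _)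
  have hmax : ∀ x ∈ Ici (0 : ℝ), max x 0 = x := fun x hx => max_eq_left hx
  refine ⟨?_, by simp [h0], ?_, ?_, fun x => hL _ (hmem x), fun β' hβ' => ?_⟩
  · exact hC2.continuousOn.comp_continuous (by fun_prop) hmem
  · intro x hx y hy hxy
    simp only [hmax x hx, hmax y hy]
    exact hmono (mul_nonneg hβ.le hx) (mul_nonneg hβ.le hy) (by gcongr)
  · refine ⟨convex_Ici 0, fun x hx y hy hxy a b ha hb hab => ?_⟩
    have hz : a • x + b • y ∈ Ici (0 : ℝ) := convex_Ici 0 hx hy ha.le hb.le hab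
    simp only [hmax x hx, hmax y hy, hmax _ hz]
    have := hconc.2 (show β * x ∈ Ici (0 : ℝ) from mul_nonneg hβ.le hx)
      (show β * y ∈ Ici (0 : ℝ) from mul_nonneg hβ.le hy) (by simpa [hβ.ne'] using hxy) ha hb hab
    convert this using 2
    simp only [smul_eq_mul]
    ring
  · have hder : HasDerivWithinAt h 1 (Ici 0) 0 := by
      rw [← hd]
      exact ((hC2.differentiableOn (by norm_num)) 0 self_mem_Ici).hasDerivWithinAt
    have ht := (hasDerivWithinAt_iff_tendsto_slope.1 hder)
    have hset : Ici (0 : ℝ) \ {0} = Ioi 0 := by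
      ext x
      simp [lt_iff_le_and_ne, eq_comm]
    rw [hset] at ht
    have hlt : β' / β < 1 := (div_lt_one hβ).2 hβ'
    have hev := ht.eventually (lt_mem_nhds hlt)
    obtain ⟨y₀, hy₀, hy⟩ := mem_nhdsGT_iff_exists_Ioc_subset.1 hev
    have hy₀ : 0 < y₀ := hy₀
    refine ⟨y₀ / β, by positivity, fun x hx => ?_⟩
    rw [hmax x hx.1]
    rcases hx.1.eq_or_lt with rfl | hx0
    · simp [h0]
    have := hy (show β * x ∈ Ioc 0 y₀ from ⟨by positivity, by
      have := hx.2; rw [le_div_iff₀ hβ] at this; linarith⟩)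
    simp only [Set.mem_ofPred_eq, slope_def_field, sub_zero, h0] at this
    rw [lt_div_iff₀ (by positivity)] at this
    have e : β' / β * (β * x) = β' * x := by field_simp
    rw [e] at this
    exact this.le

namespace Profile
variable {φ : ℝ → ℝ} {β L : ℝ}

lemma pos (P : Profile φ β L) {x : ℝ} (hx : 0 < x) : 0 < φ x := by
  rw [← P.zero]; exact P.mono self_mem_Ici hx.le hx

lemma nonneg (P : Profile φ β L) {x : ℝ} (hx : 0 ≤ x) : 0 ≤ φ x := by
  rw [← P.zero]; exact P.mono.monotoneOn self_mem_Ici hx hx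

lemma L_pos (P : Profile φ β L) : 0 < L := (P.pos one_pos).trans_le (P.le 1)

lemma mono' (P : Profile φ β L) {x y : ℝ} (hx : 0 ≤ x) (hxy : x ≤ y) : φ x ≤ φ y :=
  P.mono.monotoneOn hx (hx.trans hxy) hxy

lemma div_le (P : Profile φ β L) {s r : ℝ} (hs : 0 ≤ s) (hsr : s ≤ r) (hr : 0 < r) :
    s / r * φ r ≤ φ s := by
  have := P.concave.concaveOn.2 (self_mem_Ici : (0 : ℝ) ∈ Ici 0) hr.le
    (sub_nonneg.2 ((div_le_one hr).2 hsr)) (div_nonneg hs hr.le) (by ring)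
  simp only [P.zero, smul_eq_mul, mul_zero, zero_add] at this
  rwa [div_mul_cancel₀ _ hr.ne'] at this

lemma exists_contraction (P : Profile φ β L) {a : ℝ} (ha : 0 < a) :
    ∃ k, 0 ≤ k ∧ k < 1 ∧ ∀ s r, a ≤ s → s ≤ r →
    1 - φ s / φ r ≤ k * (1 - s / r) := by
  have hη : 0 < 2 * φ (a / 2) - φ a := by
    have := P.concave.2 (self_mem_Ici : (0 : ℝ) ∈ Ici 0) ha.le ha.ne
      (by norm_num : (0 : ℝ) < 1 / 2) (by norm_num : (0 : ℝ) < 1 / 2) (by norm_num)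
    simp only [P.zero, smul_eq_mul, mul_zero, zero_add] at this
    rw [one_div_mul_eq_div, one_div_mul_eq_div] at this
    linarith
  have hmono : φ (a / 2) ≤ φ a := P.mono' (by positivity) (by linarith)
  have hL := P.L_pos
  have hle := P.le a
  refine ⟨1 - (2 * φ (a / 2) - φ a) / L, ?_, ?_, fun s r has hsr => ?_⟩
  · rw [sub_nonneg, div_le_one hL]; linarith
  · have : 0 < (2 * φ (a / 2) - φ a) / L := by positivity
    linarith
  rcases hsr.eq_or_lt with rfl | hsr
  · have h1 : s ≠ 0 := (ha.trans_le has).ne'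
    have h2 : φ s ≠ 0 := (P.pos (ha.trans_le has)).ne'
    simp [h1, h2]
  have hs : 0 < s := ha.trans_le has
  have hr : 0 < r := hs.trans hsr
  have hφr := P.pos hr
  set σ := (φ r - φ s) / (r - s) with hσ
  have hσe : σ * (r - s) = φ r - φ s := div_mul_cancel₀ _ (sub_pos.2 hsr).ne'
  have hC := P.concave.concaveOn
  have h1 : σ * (a / 2) ≤ φ a - φ (a / 2) := by
    have h2 : φ (a / 2) + σ * (a / 2) ≤ φ a := by
      have h3 : σ ≤ (φ a - φ (a / 2)) / (a - a / 2) := by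
        rcases has.eq_or_lt with rfl | has'
        · exact hC.slope_anti_adjacent (show (0 : ℝ) ≤ a / 2 by positivity) hr.le (by linarith) hsr
        · exact (hC.slope_anti_adjacent ha.le hr.le has' hsr).trans
            (hC.slope_anti_adjacent (show (0 : ℝ) ≤ a / 2 by positivity) hs.le (by linarith) has')
      rw [le_div_iff₀ (by linarith)] at h3
      linarith
    linarith
  have h2 : σ * (s - a) ≤ φ s - φ a := by
    rcases has.eq_or_lt with rfl | has'
    · simp
    · have := hC.slope_anti_adjacent ha.le hr.le has' hsr
      rwa [le_div_iff₀ (by linarith)] at this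
  have h3 : r * σ ≤ φ r - (2 * φ (a / 2) - φ a) := by nlinarith
  have h4 : r * σ ≤ (1 - (2 * φ (a / 2) - φ a) / L) * φ r := by
    have : (2 * φ (a / 2) - φ a) / L * φ r ≤ 2 * φ (a / 2) - φ a := by
      rw [div_mul_eq_mul_div, div_le_iff₀ hL]
      exact mul_le_mul_of_nonneg_left (P.le r) hη.le
    linarith
  have e1 : 1 - φ s / φ r = σ * (r - s) / φ r := by rw [hσe]; field_simp
  have e2 : 1 - s / r = (r - s) / r := by field_simp
  rw [e1, e2, div_le_iff₀ hφr]
  have h5 : 0 ≤ (r - s) / r := div_nonneg (by linarith) hr.le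
  calc σ * (r - s) = r * σ * ((r - s) / r) := by field_simp
    _ ≤ (1 - (2 * φ (a / 2) - φ a) / L) * φ r * ((r - s) / r) := by gcongr
    _ = _ := by ring

end Profile

section Radial
variable {Θ : Type*}

/-- The radial fibre map with profile `φ`. -/
def radMap (A : Θ → Matrix (Fin 2) (Fin 2) ℝ) (φ : ℝ → ℝ) (θ : Θ) (v : R2) : R2 :=
  (φ ‖v‖ / ‖v‖) • mulVecE (A θ) v

lemma fibMap_eq_radMap (A : Θ → Matrix (Fin 2) (Fin 2) ℝ) (h : ℝ → ℝ) (β : ℝ) :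
    fibMap A h β = radMap A (fun x => h (β * max x 0)) := by
  ext1 θ
  ext1 v
  by_cases hv : v = 0
  · simp [fibMap, radMap, hv, mulVecE_zero]
  · simp only [fibMap, radMap, hv, if_false, max_eq_left (norm_nonneg v)]

/-- The pullback radius: the boundary of the `n`-th pullback image of the unit disc over `θ`, in
the direction of `x`. -/
def radius (γ : Θ ≃ Θ) (A : Θ → Matrix (Fin 2) (Fin 2) ℝ) (φ : ℝ → ℝ) : ℕ → Θ → R2 → ℝ
  | 0, _, _ => 1
  | n + 1, θ, x => φ (radius γ A φ n (γ.symm θ) (mulVecE (invGen γ A θ) x)) *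
      (‖x‖ / ‖mulVecE (invGen γ A θ) x‖)

/-- The limit of the pullback radii. -/
def limRadius (γ : Θ ≃ Θ) (A : Θ → Matrix (Fin 2) (Fin 2) ℝ) (φ : ℝ → ℝ) (θ : Θ) (x : R2) : ℝ :=
  ⨅ n, radius γ A φ n θ x

/-- A radial skew product: unimodular cocycle, concave profile, unit disc forward invariant. -/
structure RadSys (A : Θ → Matrix (Fin 2) (Fin 2) ℝ) (φ : ℝ → ℝ) (β L : ℝ) : Prop where
  det : ∀ θ, (A θ).det = 1
  prof : Profile φ β L
  le_one : ∀ θ, L * opNorm (A θ) ≤ 1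

namespace RadSys
variable {γ : Θ ≃ Θ} {A : Θ → Matrix (Fin 2) (Fin 2) ℝ} {φ : ℝ → ℝ} {β L : ℝ}

lemma invGen_mulVecE (H : RadSys A φ β L) (θ : Θ) (v : R2) :
    mulVecE (invGen γ A (γ θ)) (mulVecE (A θ) v) = v := by
  rw [invGen_apply, mulVecE_inv_mulVecE (H.det θ)]

lemma exists_eq_mulVecE (H : RadSys A φ β L) (θ : Θ) (x : R2) : ∃ v, x = mulVecE (A θ) v :=
  ⟨_, (mulVecE_mulVecE_inv (H.det θ) x).symm⟩

lemma radius_succ (H : RadSys A φ β L) (n : ℕ) (θ : Θ) (v : R2) :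
    radius γ A φ (n + 1) (γ θ) (mulVecE (A θ) v) =
      φ (radius γ A φ n θ v) * (‖mulVecE (A θ) v‖ / ‖v‖) := by
  rw [radius, Equiv.symm_apply_apply, H.invGen_mulVecE]

lemma norm_div_le (H : RadSys A φ β L) (θ : Θ) (v : R2) :
    L * (‖mulVecE (A θ) v‖ / ‖v‖) ≤ 1 := by
  refine le_trans ?_ (H.le_one θ)
  refine mul_le_mul_of_nonneg_left ?_ H.prof.L_pos.le
  exact div_le_of_le_mul₀ (norm_nonneg _) (opNorm_nonneg _) (norm_mulVecE_le _ _)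

lemma induct_fibre {γ : Θ ≃ Θ} {p : ℕ → Θ → Prop} (h0 : ∀ θ, p 0 θ)
    (hs : ∀ n θ, p n θ → p (n + 1) (γ θ)) (n : ℕ) (θ : Θ) : p n θ := by
  induction n generalizing θ with
  | zero => exact h0 θ
  | succ n ih => simpa using hs n (γ.symm θ) (ih _)

lemma radius_mem_Icc (H : RadSys A φ β L) (n : ℕ) (θ : Θ) (x : R2) :
    radius γ A φ n θ x ∈ Icc (0 : ℝ) 1 := by
  revert x
  refine induct_fibre (γ := γ) (p := fun n θ => ∀ x, radius γ A φ n θ x ∈ Icc (0 : ℝ) 1)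
    (fun θ x => by simp [radius]) (fun n θ ih x => ?_) n θ
  obtain ⟨v, rfl⟩ := H.exists_eq_mulVecE θ x
  rw [H.radius_succ]
  have h1 := H.prof.nonneg (ih v).1
  exact ⟨by positivity, (mul_le_mul_of_nonneg_right (H.prof.le _) (by positivity)).trans
    (H.norm_div_le θ v)⟩

lemma radius_pos (H : RadSys A φ β L) (n : ℕ) (θ : Θ) {x : R2} (hx : x ≠ 0) :
    0 < radius γ A φ n θ x := by
  suffices h : ∀ x, x ≠ 0 → 0 < radius γ A φ n θ x from h x hx
  clear! x
  refine induct_fibre (γ := γ) (p := fun n θ => ∀ x, x ≠ 0 → 0 < radius γ A φ n θ x)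
    (fun θ x _ => by simp [radius]) (fun n θ ih x hx => ?_) n θ
  obtain ⟨v, rfl⟩ := H.exists_eq_mulVecE θ x
  have hv : v ≠ 0 := by rintro rfl; exact hx (mulVecE_zero _)
  rw [H.radius_succ]
  have h1 := H.prof.pos (ih v hv)
  have := norm_pos_iff.2 hx
  have := norm_pos_iff.2 hv
  positivity

lemma radius_antitone (H : RadSys A φ β L) (θ : Θ) (x : R2) :
    Antitone fun n => radius γ A φ n θ x := by
  refine antitone_nat_of_succ_le fun n => ?_
  revert x
  refine induct_fibre (γ := γ)
    (p := fun n θ => ∀ x, radius γ A φ (n + 1) θ x ≤ radius γ A φ n θ x)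
    (fun θ x => (H.radius_mem_Icc 1 θ x).2) (fun n θ ih x => ?_) n θ
  obtain ⟨v, rfl⟩ := H.exists_eq_mulVecE θ x
  rw [H.radius_succ, H.radius_succ]
  exact mul_le_mul_of_nonneg_right (H.prof.mono' (H.radius_mem_Icc _ _ _).1 (ih v)) (by positivity)

lemma radius_smul {t : ℝ} (ht : t ≠ 0) (n : ℕ) (θ : Θ) (x : R2) :
    radius γ A φ n θ (t • x) = radius γ A φ n θ x := by
  induction n generalizing θ x with
  | zero => rfl
  | succ n ih =>
    rw [radius, radius, mulVecE_smul, ih, norm_smul, norm_smul,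
      mul_div_mul_left _ _ (norm_ne_zero_iff.2 ht)]

lemma continuousOn_radius (H : RadSys A φ β L) (n : ℕ) (θ : Θ) :
    ContinuousOn (radius γ A φ n θ) {0}ᶜ := by
  induction n generalizing θ with
  | zero => exact continuousOn_const
  | succ n ih =>
    have hne : ∀ x ∈ ({0} : Set R2)ᶜ, mulVecE (invGen γ A θ) x ≠ 0 := fun x hx =>
      mulVecE_ne_zero (det_invGen γ H.det θ) hx
    refine (H.prof.cont.comp_continuousOn
      ((ih (γ.symm θ)).comp (continuous_mulVecE _).continuousOn hne)).mul ?_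
    exact continuous_norm.continuousOn.div (continuous_mulVecE _).norm.continuousOn
      fun x hx => norm_ne_zero_iff.2 (hne x hx)

lemma tendsto_radius (H : RadSys A φ β L) (θ : Θ) (x : R2) :
    Tendsto (fun n => radius γ A φ n θ x) atTop (𝓝 (limRadius γ A φ θ x)) :=
  tendsto_atTop_ciInf (H.radius_antitone θ x) ⟨0, by
    rintro _ ⟨n, rfl⟩
    exact (H.radius_mem_Icc n θ x).1⟩

lemma limRadius_le (H : RadSys A φ β L) (n : ℕ) (θ : Θ) (x : R2) :
    limRadius γ A φ θ x ≤ radius γ A φ n θ x :=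
  (H.radius_antitone θ x).le_of_tendsto (H.tendsto_radius θ x) n

lemma limRadius_mem_Icc (H : RadSys A φ β L) (θ : Θ) (x : R2) :
    limRadius γ A φ θ x ∈ Icc (0 : ℝ) 1 :=
  isClosed_Icc.mem_of_tendsto (H.tendsto_radius θ x)
    (Eventually.of_forall fun n => H.radius_mem_Icc n θ x)

lemma limRadius_apply (H : RadSys A φ β L) (θ : Θ) (v : R2) :
    limRadius γ A φ (γ θ) (mulVecE (A θ) v) =
      φ (limRadius γ A φ θ v) * (‖mulVecE (A θ) v‖ / ‖v‖) := by
  refine tendsto_nhds_unique ((tendsto_add_atTop_iff_nat 1).2 (H.tendsto_radius _ _)) ?_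
  simp only [H.radius_succ]
  exact ((H.prof.cont.tendsto _).comp (H.tendsto_radius θ v)).mul_const _

lemma limRadius_smul {t : ℝ} (ht : t ≠ 0) (θ : Θ) (x : R2) :
    limRadius γ A φ θ (t • x) = limRadius γ A φ θ x := by
  simp only [limRadius, radius_smul ht]

lemma measurable_radius [MeasurableSpace Θ] (H : RadSys A φ β L) (hγ' : Measurable γ.symm)
    (hA : ∀ i j, Measurable fun θ => A θ i j) (n : ℕ) :
    Measurable fun p : Θ × R2 => radius γ A φ n p.1 p.2 := by
  induction n with
  | zero => exact measurable_const
  | succ n ih =>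
    have hm : Measurable fun p : Θ × R2 => mulVecE (invGen γ A p.1) p.2 :=
      measurable_mulVecE (fun i j => (measurable_invGen hγ' H.det hA i j).comp measurable_fst)
        measurable_snd
    exact (H.prof.cont.measurable.comp (ih.comp ((hγ'.comp measurable_fst).prodMk hm))).mul
      (measurable_snd.norm.div hm.norm)

lemma measurable_limRadius [MeasurableSpace Θ] (H : RadSys A φ β L) (hγ' : Measurable γ.symm)
    (hA : ∀ i j, Measurable fun θ => A θ i j) :
    Measurable fun p : Θ × R2 => limRadius γ A φ p.1 p.2 :=
  measurable_of_tendsto_metrizable (fun n => H.measurable_radius hγ' hA n)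
    (tendsto_pi_nhds.2 fun p => H.tendsto_radius p.1 p.2)

lemma norm_radMap (H : RadSys A φ β L) (θ : Θ) (v : R2) :
    ‖radMap A φ θ v‖ = φ ‖v‖ * (‖mulVecE (A θ) v‖ / ‖v‖) := by
  rw [radMap, norm_smul, norm_div, norm_norm, Real.norm_of_nonneg (H.prof.nonneg (norm_nonneg v))]
  ring

lemma norm_radMap_le_one (H : RadSys A φ β L) (θ : Θ) (v : R2) : ‖radMap A φ θ v‖ ≤ 1 := by
  rw [H.norm_radMap]
  exact (mul_le_mul_of_nonneg_right (H.prof.le _) (by positivity)).trans (H.norm_div_le θ v)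

lemma radMap_zero (θ : Θ) : radMap A φ θ 0 = 0 := by simp [radMap]

lemma ratio_ne_zero (H : RadSys A φ β L) {v : R2} (hv : v ≠ 0) : φ ‖v‖ / ‖v‖ ≠ 0 :=
  (div_pos (H.prof.pos (norm_pos_iff.2 hv)) (norm_pos_iff.2 hv)).ne'

lemma radius_radMap (H : RadSys A φ β L) (n : ℕ) (θ : Θ) {v : R2} (hv : v ≠ 0) :
    radius γ A φ (n + 1) (γ θ) (radMap A φ θ v) =
      φ (radius γ A φ n θ v) * (‖mulVecE (A θ) v‖ / ‖v‖) := by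
  rw [radMap, radius_smul (H.ratio_ne_zero hv), H.radius_succ]

lemma limRadius_radMap (H : RadSys A φ β L) (θ : Θ) {v : R2} (hv : v ≠ 0) :
    limRadius γ A φ (γ θ) (radMap A φ θ v) =
      φ (limRadius γ A φ θ v) * (‖mulVecE (A θ) v‖ / ‖v‖) := by
  rw [radMap, limRadius_smul (H.ratio_ne_zero hv), H.limRadius_apply]

/-- Explicit preimage of `A v` under the radial map. -/
lemma radMap_smul_eq {θ : Θ} {v : R2} (hv : v ≠ 0) {t : ℝ} (ht : 0 < t) (h : φ t = ‖v‖) :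
    radMap A φ θ ((t / ‖v‖) • v) = mulVecE (A θ) v := by
  have hn := norm_pos_iff.2 hv
  have : ‖(t / ‖v‖) • v‖ = t := by
    rw [norm_smul, norm_div, norm_norm, Real.norm_of_nonneg ht.le, div_mul_cancel₀ _ hn.ne']
  rw [radMap, this, mulVecE_smul, smul_smul, h]
  have e : ‖v‖ / t * (t / ‖v‖) = 1 := by field_simp
  rw [e, one_smul]

lemma image_disc (H : RadSys A φ β L) (n : ℕ) (θ : Θ) :
    radMap A φ θ '' {x | ‖x‖ ≤ radius γ A φ n θ x} =
      {x | ‖x‖ ≤ radius γ A φ (n + 1) (γ θ) x} := by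
  ext x
  constructor
  · rintro ⟨v, hv, rfl⟩
    rcases eq_or_ne v 0 with rfl | h0
    · rw [radMap_zero]
      simpa using (H.radius_mem_Icc (n + 1) (γ θ) 0).1
    · rw [Set.mem_ofPred_eq, H.norm_radMap, H.radius_radMap n θ h0]
      exact mul_le_mul_of_nonneg_right (H.prof.mono' (norm_nonneg _) hv) (by positivity)
  · intro hx
    rcases eq_or_ne x 0 with rfl | h0
    · exact ⟨0, by simpa using (H.radius_mem_Icc n θ 0).1, radMap_zero θ⟩
    obtain ⟨v, rfl⟩ := H.exists_eq_mulVecE θ x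
    have hv : v ≠ 0 := by rintro rfl; exact h0 (mulVecE_zero _)
    have hn := norm_pos_iff.2 hv
    rw [Set.mem_ofPred_eq, H.radius_succ, ← mul_div_assoc, le_div_iff₀ hn, mul_comm] at hx
    have hle : ‖v‖ ≤ φ (radius γ A φ n θ v) := le_of_mul_le_mul_right hx (norm_pos_iff.2 h0)
    obtain ⟨t, ht, hte⟩ := intermediate_value_Icc (H.radius_mem_Icc (γ := γ) n θ v).1
      H.prof.cont.continuousOn (show ‖v‖ ∈ Icc _ _ from ⟨by rw [H.prof.zero]; exact hn.le, hle⟩)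
    have ht0 : 0 < t := ht.1.lt_of_ne (by
      rintro rfl
      rw [H.prof.zero] at hte
      exact hn.ne hte)
    refine ⟨(t / ‖v‖) • v, ?_, radMap_smul_eq hv ht0 hte⟩
    rw [Set.mem_ofPred_eq, radius_smul (by positivity), norm_smul, norm_div, norm_norm,
      Real.norm_of_nonneg ht0.le, div_mul_cancel₀ _ hn.ne']
    exact ht.2

lemma skewProd_apply {h : ℝ → ℝ} {β : ℝ} (hf : fibMap A h β = radMap A φ) (p : Θ × R2) :
    skewProd γ A h β p = (γ p.1, radMap A φ p.1 p.2) := by rw [skewProd, hf]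

lemma skewProd_image (H : RadSys A φ β L) {h : ℝ → ℝ} {b : ℝ} (hf : fibMap A h b = radMap A φ)
    (n : ℕ) : (skewProd γ A h b)^[n] '' (univ ×ˢ closedBall (0 : R2) 1) =
      {p | ‖p.2‖ ≤ radius γ A φ n p.1 p.2} := by
  induction n with
  | zero => ext p; simp [radius]
  | succ n ih =>
    rw [Function.iterate_succ', image_comp, ih]
    ext ⟨θ, x⟩
    obtain ⟨θ, rfl⟩ := γ.surjective θ
    have := Set.ext_iff.1 (H.image_disc (γ := γ) n θ) x
    simp only [Set.mem_ofPred_eq, mem_image] at this ⊢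
    rw [← this]
    constructor
    · rintro ⟨⟨θ', v⟩, hv, he⟩
      rw [skewProd_apply hf] at he
      obtain ⟨h1, h2⟩ := Prod.mk.inj he
      obtain rfl := γ.injective h1
      exact ⟨v, hv, h2⟩
    · rintro ⟨v, hv, rfl⟩
      exact ⟨(θ, v), hv, skewProd_apply hf _⟩

lemma attractorFib_eq (H : RadSys A φ β L) {h : ℝ → ℝ} {b : ℝ} (hf : fibMap A h b = radMap A φ)
    (θ : Θ) : attractorFib γ A h b θ = {x | ‖x‖ ≤ limRadius γ A φ θ x} := by
  ext x
  simp only [attractorFib, globalAttractor, H.skewProd_image hf, mem_iInter, Set.mem_ofPred_eq]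
  exact ⟨fun hx => le_ciInf hx, fun hx n => hx.trans (H.limRadius_le n θ x)⟩

end RadSys
end Radial

namespace Profile
variable {φ : ℝ → ℝ} {β L : ℝ}

lemma one_sub_mul_le (P : Profile φ β L) {s r ε : ℝ} (hs : 0 ≤ s) (hr : 0 ≤ r) (hε : 0 ≤ ε)
    (h : (1 - ε) * r ≤ s) :
    (1 - ε) * φ r ≤ φ s := by
  rcases le_total r s with hrs | hsr
  · nlinarith [P.mono' hr hrs, P.nonneg hr]
  rcases hr.eq_or_lt with rfl | hr
  · rw [P.zero, mul_zero]; exact P.nonneg hs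
  refine le_trans ?_ (P.div_le hs hsr hr)
  refine mul_le_mul_of_nonneg_right ?_ (P.nonneg hr.le)
  rwa [le_div_iff₀ hr]

lemma exists_contraction' (P : Profile φ β L) {a : ℝ} (ha : 0 < a) :
    ∃ k, 0 ≤ k ∧ k < 1 ∧ ∀ s r ε, a ≤ s → 0 ≤ r →
    0 ≤ ε → (1 - ε) * r ≤ s → (1 - k * ε) * φ r ≤ φ s := by
  obtain ⟨k, hk0, hk1, hk⟩ := P.exists_contraction ha
  refine ⟨k, hk0, hk1, fun s r ε hs hr hε h => ?_⟩
  rcases le_total r s with hrs | hsr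
  · nlinarith [P.mono' hr hrs, P.nonneg hr, mul_nonneg hk0 hε]
  have hs0 : 0 < s := ha.trans_le hs
  have hr0 : 0 < r := hs0.trans_le hsr
  have hφ := P.pos hr0
  have h1 := hk s r hs hsr
  have h2 : 1 - s / r ≤ ε := by
    rw [← le_div_iff₀ hr0] at h
    linarith
  have h3 : 1 - k * ε ≤ φ s / φ r := by nlinarith
  rwa [le_div_iff₀ hφ] at h3

end Profile

/-- A quantity that never increases along orbits of `T`, and is contracted on visits to `Q`,
eventually becomes arbitrarily small along recurrent orbits. -/
lemma eventually_pow_of_recurrent {Θ : Type*} {T : Θ → Θ} {Q : Set Θ} {k : ℝ} (hk : 0 ≤ k)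
    {Φ : ℕ → Θ → ℝ → Prop} (h0 : ∀ n θ, Φ n θ 1)
    (h1 : ∀ n θ ε, 0 ≤ ε → Φ n (T θ) ε → Φ (n + 1) θ ε)
    (h2 : ∀ n θ ε, 0 ≤ ε → T θ ∈ Q → Φ n (T θ) ε → Φ (n + 1) θ (k * ε))
    {θ : Θ} (hθ : ∃ᶠ n in atTop, T^[n] θ ∈ Q) (j : ℕ) : ∃ N, ∀ n ≥ N, Φ n θ (k ^ j) := by
  induction j generalizing θ with
  | zero => exact ⟨0, fun n _ => by simpa using h0 n θ⟩
  | succ j ih =>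
    have hlift : ∀ (p n : ℕ) (θ : Θ) (ε : ℝ), 0 ≤ ε → Φ n (T^[p] θ) ε → Φ (n + p) θ ε := by
      intro p
      induction p with
      | zero => intro n θ ε _ h; exact h
      | succ p ihp =>
        intro n θ ε hε h
        exact h1 _ _ _ hε (ihp n (T θ) ε hε h)
    obtain ⟨p, hp1, hp⟩ := frequently_atTop.1 hθ 1
    obtain ⟨p, rfl⟩ : ∃ p', p = p' + 1 := ⟨p - 1, by omega⟩
    have hθ' : ∃ᶠ n in atTop, T^[n] (T^[p + 1] θ) ∈ Q := by
      rw [frequently_atTop] at hθ ⊢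
      intro N
      obtain ⟨b, hb, hbQ⟩ := hθ (N + (p + 1))
      refine ⟨b - (p + 1), by omega, ?_⟩
      rwa [← Function.iterate_add_apply, Nat.sub_add_cancel (by omega)]
    obtain ⟨N, hN⟩ := ih hθ'
    refine ⟨N + (p + 1), fun n hn => ?_⟩
    have h3 : Φ (n - (p + 1) + 1) (T^[p] θ) (k * k ^ j) := by
      refine h2 _ _ _ (by positivity) ?_ ?_
      · rwa [← Function.iterate_succ_apply' T p θ]
      · rw [← Function.iterate_succ_apply' T p θ]
        exact hN _ (by omega)
    have h4 := hlift p _ θ _ (by positivity) h3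
    rw [pow_succ']
    convert h4 using 1
    omega

section Radial
variable {Θ : Type*}

/-- Points of the unit disc whose backward linear orbit grows like `d * q ^ k` at some time. -/
def annulus (γ : Θ ≃ Θ) (A : Θ → Matrix (Fin 2) (Fin 2) ℝ) (q d : ℝ) : Set (Θ × R2) :=
  {p | ‖p.2‖ ≤ 1 ∧ ∃ k : ℕ, d * q ^ k ≤ ‖mulVecE (bcoc γ A k p.1) p.2‖}

/-- Base points where the backward cocycle is bounded by `q ^ k / a`. -/
def slowSet (γ : Θ ≃ Θ) (A : Θ → Matrix (Fin 2) (Fin 2) ℝ) (q a : ℝ) : Set Θ :=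
  {θ | ∀ k : ℕ, opNorm (bcoc γ A k θ) ≤ q ^ k / a}

/-- The admissible parameters of `annulus`. -/
structure AnnParams (φ : ℝ → ℝ) (q d : ℝ) : Prop where
  q_pos : 0 < q
  d_pos : 0 < d
  d_le : d ≤ 1 / 2
  slope : ∀ x ∈ Icc 0 d, q * x ≤ φ x

lemma Profile.exists_annParams {φ : ℝ → ℝ} {β L q δ : ℝ} (P : Profile φ β L) (hq : 0 < q)
    (hqβ : q < β) (hδ : 0 < δ) : ∃ d, AnnParams φ q d ∧ d ≤ δ := by
  obtain ⟨x₀, hx₀, hx⟩ := P.slope q hqβ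
  exact ⟨min x₀ (min δ (1 / 2)), ⟨hq, by positivity,
    (min_le_right _ _).trans (min_le_right _ _),
    fun x hx' => hx x ⟨hx'.1, hx'.2.trans (min_le_left _ _)⟩⟩,
    (min_le_right _ _).trans (min_le_left _ _)⟩

namespace RadSys
variable {γ : Θ ≃ Θ} {A : Θ → Matrix (Fin 2) (Fin 2) ℝ} {φ : ℝ → ℝ} {β L q d a : ℝ}

lemma ne_zero_of_mem_annulus (hp : AnnParams φ q d) {θ : Θ} {x : R2}
    (hx : (θ, x) ∈ annulus γ A q d) : x ≠ 0 := by
  rintro rfl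
  obtain ⟨-, k, hk⟩ := hx
  have h1 : 0 < d * q ^ k := mul_pos hp.d_pos (pow_pos hp.q_pos k)
  simp only [mulVecE_zero, norm_zero] at hk
  linarith

lemma radMap_mem_annulus (H : RadSys A φ β L) (hp : AnnParams φ q d) {θ : Θ} {x : R2}
    (hx : (θ, x) ∈ annulus γ A q d) : (γ θ, radMap A φ θ x) ∈ annulus γ A q d := by
  have hn := norm_pos_iff.2 (ne_zero_of_mem_annulus hp hx)
  obtain ⟨-, k, hk⟩ := hx
  refine ⟨H.norm_radMap_le_one θ x, ?_⟩
  have hφ := H.prof.pos hn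
  have key : ∀ k, ‖mulVecE (bcoc γ A (k + 1) (γ θ)) (radMap A φ θ x)‖ =
      φ ‖x‖ / ‖x‖ * ‖mulVecE (bcoc γ A k θ) x‖ := fun k => by
    rw [radMap, mulVecE_smul, bcoc_succ_mulVecE γ H.det, norm_smul,
      Real.norm_of_nonneg (by positivity)]
  by_cases hle : q ≤ φ ‖x‖ / ‖x‖
  · refine ⟨k + 1, ?_⟩
    simp only [key] at hk ⊢
    calc d * q ^ (k + 1) = q * (d * q ^ k) := by ring
      _ ≤ _ := mul_le_mul hle hk (mul_nonneg hp.d_pos.le (pow_nonneg hp.q_pos.le k))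
        (hp.q_pos.le.trans hle)
  · refine ⟨1, ?_⟩
    have hd : d < ‖x‖ := by
      by_contra hcon
      exact hle ((le_div_iff₀ hn).2 (hp.slope _ ⟨hn.le, not_lt.1 hcon⟩))
    have := key 0
    simp only [zero_add] at this
    rw [show bcoc γ A 0 θ = 1 from rfl, mulVecE_one, div_mul_cancel₀ _ hn.ne'] at this
    change d * q ^ 1 ≤ ‖mulVecE (bcoc γ A 1 (γ θ)) (radMap A φ θ x)‖
    rw [this, pow_one]
    have h1 := hp.slope d ⟨hp.d_pos.le, le_rfl⟩
    linarith [H.prof.mono' hp.d_pos.le hd.le]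

lemma le_norm_of_mem_annulus (hp : AnnParams φ q d) (ha : 0 < a) {θ : Θ} (hθ : θ ∈ slowSet γ A q a)
    {x : R2} (hx : (θ, x) ∈ annulus γ A q d) : d * a ≤ ‖x‖ := by
  obtain ⟨-, k, hk⟩ := hx
  have h1 := hk.trans ((norm_mulVecE_le _ _).trans
    (mul_le_mul_of_nonneg_right (hθ k) (norm_nonneg _)))
  have h2 := pow_pos hp.q_pos k
  rw [div_mul_eq_mul_div, le_div_iff₀ ha] at h1
  have h3 : q ^ k * (d * a) ≤ q ^ k * ‖x‖ := by simp only at h1; linarith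
  exact le_of_mul_le_mul_left h3 h2

lemma radius_mem_annulus (H : RadSys A φ β L) (hp : AnnParams φ q d) (n : ℕ) (θ : Θ) {x : R2}
    (hx : x ≠ 0) : (θ, (radius γ A φ n θ x / ‖x‖) • x) ∈ annulus γ A q d := by
  suffices h : ∀ x, x ≠ 0 → (θ, (radius γ A φ n θ x / ‖x‖) • x) ∈ annulus γ A q d from h x hx
  clear! x
  refine induct_fibre (γ := γ)
    (p := fun n θ => ∀ x, x ≠ 0 → (θ, (radius γ A φ n θ x / ‖x‖) • x) ∈ annulus γ A q d)
    (fun θ x hx => ?_) (fun n θ ih x hx => ?_) n θ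
  · have e : ‖(radius γ A φ 0 θ x / ‖x‖) • x‖ = 1 := by
      rw [radius, norm_smul, norm_div, norm_one, norm_norm, one_div_mul_cancel
          (norm_ne_zero_iff.2 hx)]
    refine ⟨e.le, 0, ?_⟩
    simp only [coc, mulVecE_one, e]
    linarith [hp.d_le]
  · obtain ⟨v, rfl⟩ := H.exists_eq_mulVecE θ x
    have hv : v ≠ 0 := by rintro rfl; exact hx (mulVecE_zero _)
    have hn := norm_pos_iff.2 hv
    have hn' := norm_pos_iff.2 hx
    convert H.radMap_mem_annulus hp (ih v hv) using 2
    have hr := H.radius_pos (γ := γ) n θ hv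
    have e : ‖(radius γ A φ n θ v / ‖v‖) • v‖ = radius γ A φ n θ v := by
      rw [norm_smul, norm_div, norm_norm, Real.norm_of_nonneg hr.le, div_mul_cancel₀ _ hn.ne']
    rw [radMap, e, mulVecE_smul, smul_smul, H.radius_succ]
    congr 1
    field_simp

lemma le_limRadius (H : RadSys A φ β L) (hp : AnnParams φ q d) (ha : 0 < a) {θ : Θ}
    (hθ : θ ∈ slowSet γ A q a) {x : R2} (hx : x ≠ 0) : d * a ≤ limRadius γ A φ θ x := by
  refine le_ciInf fun n => ?_
  have h := le_norm_of_mem_annulus hp ha hθ (H.radius_mem_annulus hp n θ hx)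
  rwa [norm_smul, norm_div, norm_norm, Real.norm_of_nonneg (H.radius_mem_Icc n θ x).1,
    div_mul_cancel₀ _ (norm_ne_zero_iff.2 hx)] at h

lemma eventually_limRadius (H : RadSys A φ β L) (hp : AnnParams φ q d) (ha : 0 < a) {θ : Θ}
    (hθ : ∃ᶠ n in atTop, γ.symm^[n] θ ∈ slowSet γ A q a) {ε : ℝ} (hε : 0 < ε) :
    ∃ N, ∀ n ≥ N, ∀ x, x ≠ 0 → (1 - ε) * radius γ A φ n θ x ≤ limRadius γ A φ θ x := by
  obtain ⟨k, hk0, hk1, hk⟩ := H.prof.exists_contraction' (mul_pos hp.d_pos ha)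
  obtain ⟨j, hj⟩ := exists_pow_lt_of_lt_one hε hk1
  have hpos : ∀ n θ x, 0 ≤ radius γ A φ n θ x := fun n θ x => (H.radius_mem_Icc n θ x).1
  obtain ⟨N, hN⟩ : ∃ N, ∀ n ≥ N, ∀ x, x ≠ 0 →
      (1 - k ^ j) * radius γ A φ n θ x ≤ limRadius γ A φ θ x := by
    refine eventually_pow_of_recurrent hk0
        (Φ := fun n θ ε => ∀ x, x ≠ 0 → (1 - ε) * radius γ A φ n θ x ≤ limRadius γ A φ θ x)
        (fun n θ x _ => by simpa using (H.limRadius_mem_Icc θ x).1)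
        (fun n θ ε hε h x hx => ?_) (fun n θ ε hε hQ h x hx => ?_) hθ j
    · obtain ⟨θ, rfl⟩ := γ.surjective θ
      obtain ⟨v, rfl⟩ := H.exists_eq_mulVecE θ x
      have hv : v ≠ 0 := by rintro rfl; exact hx (mulVecE_zero _)
      rw [Equiv.symm_apply_apply] at h
      rw [H.limRadius_apply, H.radius_succ, ← mul_assoc]
      exact mul_le_mul_of_nonneg_right (H.prof.one_sub_mul_le (H.limRadius_mem_Icc θ v).1
        (hpos _ _ _) hε (h v hv)) (by positivity)
    · obtain ⟨θ, rfl⟩ := γ.surjective θ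
      obtain ⟨v, rfl⟩ := H.exists_eq_mulVecE θ x
      have hv : v ≠ 0 := by rintro rfl; exact hx (mulVecE_zero _)
      rw [Equiv.symm_apply_apply] at h hQ
      rw [H.limRadius_apply, H.radius_succ, ← mul_assoc]
      exact mul_le_mul_of_nonneg_right (hk _ _ _ (H.le_limRadius hp ha hQ hv)
        (hpos _ _ _) hε (h v hv)) (by positivity)
  refine ⟨N, fun n hn x hx => le_trans ?_ (hN n hn x hx)⟩
  exact mul_le_mul_of_nonneg_right (by linarith) (hpos n θ x)

lemma limRadius_pos (H : RadSys A φ β L) (hp : AnnParams φ q d) (ha : 0 < a) {θ : Θ}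
    (hθ : ∃ᶠ n in atTop, γ.symm^[n] θ ∈ slowSet γ A q a) {x : R2} (hx : x ≠ 0) :
    0 < limRadius γ A φ θ x := by
  obtain ⟨N, hN⟩ := H.eventually_limRadius hp ha hθ (ε := 1 / 2) (by norm_num)
  have := hN N le_rfl x hx
  linarith [H.radius_pos (γ := γ) N θ hx]

lemma continuousOn_limRadius (H : RadSys A φ β L) (hp : AnnParams φ q d) (ha : 0 < a) {θ : Θ}
    (hθ : ∃ᶠ n in atTop, γ.symm^[n] θ ∈ slowSet γ A q a) :
    ContinuousOn (limRadius γ A φ θ) {0}ᶜ := by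
  have hu : TendstoUniformlyOn (fun n => radius γ A φ n θ) (limRadius γ A φ θ) atTop {0}ᶜ := by
    rw [Metric.tendstoUniformlyOn_iff]
    intro ε hε
    obtain ⟨N, hN⟩ := H.eventually_limRadius hp ha hθ (ε := ε / 2) (by linarith)
    filter_upwards [eventually_ge_atTop N] with n hn x hx
    have h1 := hN n hn x hx
    have h2 := H.limRadius_le (γ := γ) n θ x
    have h3 := H.radius_mem_Icc (γ := γ) n θ x
    rw [Real.dist_eq, abs_lt]
    constructor <;> nlinarith [h3.1, h3.2]
  exact hu.continuousOn (Frequently.of_forall fun n => H.continuousOn_radius n θ)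

/-- The fibre of the `n`-th image of a set under the skew product. -/
def imageFib (γ : Θ ≃ Θ) (A : Θ → Matrix (Fin 2) (Fin 2) ℝ) (h : ℝ → ℝ) (b : ℝ) (K : Set (Θ × R2))
    (n : ℕ) (θ : Θ) : Set R2 :=
  (fun v => ((skewProd γ A h b)^[n] (γ.symm^[n] θ, v)).2) '' {x | (γ.symm^[n] θ, x) ∈ K}

lemma skewProd_iterate_fst {h : ℝ → ℝ} {b : ℝ} (n : ℕ) (p : Θ × R2) :
    ((skewProd γ A h b)^[n] p).1 = γ^[n] p.1 := by
  induction n with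
  | zero => rfl
  | succ n ih => rw [Function.iterate_succ_apply', Function.iterate_succ_apply', skewProd, ih]

lemma imageFib_succ {h : ℝ → ℝ} {b : ℝ} (hf : fibMap A h b = radMap A φ) (K : Set (Θ × R2)) (n : ℕ)
    (θ : Θ) : imageFib γ A h b K (n + 1) (γ θ) = radMap A φ θ '' imageFib γ A h b K n θ := by
  have e : γ.symm^[n + 1] (γ θ) = γ.symm^[n] θ := by
    rw [Function.iterate_succ_apply, Equiv.symm_apply_apply]
  have e2 : γ^[n] (γ.symm^[n] θ) = θ := Function.LeftInverse.iterate γ.apply_symm_apply n θ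
  rw [imageFib, imageFib, e, image_image]
  refine image_congr fun v _ => ?_
  rw [Function.iterate_succ_apply', skewProd_apply hf, skewProd_iterate_fst, e2]

lemma imageFib_annulus_subset (H : RadSys A φ β L) {h : ℝ → ℝ} {b : ℝ}
    (hf : fibMap A h b = radMap A φ) (hp : AnnParams φ q d) (n : ℕ) (θ : Θ) :
    imageFib γ A h b (annulus γ A q d) n θ ⊆ {x | (θ, x) ∈ annulus γ A q d} := by
  refine induct_fibre (γ := γ) (p := fun n θ =>
    imageFib γ A h b (annulus γ A q d) n θ ⊆ {x | (θ, x) ∈ annulus γ A q d}) (fun θ => ?_)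
    (fun n θ ih => ?_) n θ
  · simp [imageFib]
  · rw [imageFib_succ hf]
    rintro _ ⟨v, hv, rfl⟩
    exact H.radMap_mem_annulus hp (ih hv)

lemma imageFib_annulus_subset_disc (H : RadSys A φ β L) {h : ℝ → ℝ} {b : ℝ}
    (hf : fibMap A h b = radMap A φ) (n : ℕ) (θ : Θ) :
    imageFib γ A h b (annulus γ A q d) n θ ⊆ {x | ‖x‖ ≤ radius γ A φ n θ x} := by
  refine induct_fibre (γ := γ) (p := fun n θ =>
    imageFib γ A h b (annulus γ A q d) n θ ⊆ {x | ‖x‖ ≤ radius γ A φ n θ x}) (fun θ => ?_)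
    (fun n θ ih => ?_) n θ
  · rintro _ ⟨x, hx, rfl⟩
    exact hx.1
  · rw [imageFib_succ hf, ← H.image_disc]
    exact image_mono ih

lemma le_norm_of_mem_imageFib (H : RadSys A φ β L) {h : ℝ → ℝ} {b : ℝ}
    (hf : fibMap A h b = radMap A φ) (hp : AnnParams φ q d) (ha : 0 < a) {θ : Θ}
    (hθ : ∃ᶠ n in atTop, γ.symm^[n] θ ∈ slowSet γ A q a) {ε : ℝ} (hε : 0 < ε) :
    ∃ N, ∀ n ≥ N, ∀ x ∈ imageFib γ A h b (annulus γ A q d) n θ,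
      (1 - ε) * limRadius γ A φ θ x ≤ ‖x‖ := by
  obtain ⟨k, hk0, hk1, hk⟩ := H.prof.exists_contraction' (mul_pos hp.d_pos ha)
  obtain ⟨j, hj⟩ := exists_pow_lt_of_lt_one hε hk1
  have hpos : ∀ θ x, 0 ≤ limRadius γ A φ θ x := fun θ x => (H.limRadius_mem_Icc θ x).1
  obtain ⟨N, hN⟩ : ∃ N, ∀ n ≥ N, ∀ x ∈ imageFib γ A h b (annulus γ A q d) n θ,
      (1 - k ^ j) * limRadius γ A φ θ x ≤ ‖x‖ := by
    refine eventually_pow_of_recurrent hk0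
        (Φ := fun n θ ε => ∀ x ∈ imageFib γ A h b (annulus γ A q d) n θ,
          (1 - ε) * limRadius γ A φ θ x ≤ ‖x‖)
        (fun n θ x _ => by simp)
        (fun n θ ε hε hΦ x hx => ?_) (fun n θ ε hε hQ hΦ x hx => ?_) hθ j
    · obtain ⟨θ, rfl⟩ := γ.surjective θ
      rw [imageFib_succ hf] at hx
      obtain ⟨v, hvm, rfl⟩ := hx
      have hv := ne_zero_of_mem_annulus hp (H.imageFib_annulus_subset hf hp n θ hvm)
      rw [Equiv.symm_apply_apply] at hΦ
      rw [H.limRadius_radMap θ hv, H.norm_radMap, ← mul_assoc]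
      exact mul_le_mul_of_nonneg_right (H.prof.one_sub_mul_le (norm_nonneg _)
        (hpos _ _) hε (hΦ v hvm)) (by positivity)
    · obtain ⟨θ, rfl⟩ := γ.surjective θ
      rw [imageFib_succ hf] at hx
      obtain ⟨v, hvm, rfl⟩ := hx
      have hvK := H.imageFib_annulus_subset hf hp n θ hvm
      have hv := ne_zero_of_mem_annulus hp hvK
      rw [Equiv.symm_apply_apply] at hΦ hQ
      rw [H.limRadius_radMap θ hv, H.norm_radMap, ← mul_assoc]
      exact mul_le_mul_of_nonneg_right (hk _ _ _ (le_norm_of_mem_annulus hp ha hQ hvK)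
        (hpos _ _) hε (hΦ v hvm)) (by positivity)
  refine ⟨N, fun n hn x hx => le_trans ?_ (hN n hn x hx)⟩
  exact mul_le_mul_of_nonneg_right (by linarith) (hpos θ x)

/-- The circle bounding the attractor over `θ`. -/
def circ (γ : Θ ≃ Θ) (A : Θ → Matrix (Fin 2) (Fin 2) ℝ) (φ : ℝ → ℝ) (θ : Θ) : Set R2 :=
  {x | x ≠ 0 ∧ ‖x‖ = limRadius γ A φ θ x}

lemma circ_subset_image (H : RadSys A φ β L) {θ : Θ} :
    circ γ A φ (γ θ) ⊆ radMap A φ θ '' circ γ A φ θ := by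
  rintro x ⟨hx, hxr⟩
  obtain ⟨v, rfl⟩ := H.exists_eq_mulVecE θ x
  have hv : v ≠ 0 := by rintro rfl; exact hx (mulVecE_zero _)
  have hn := norm_pos_iff.2 hv
  have hn' := norm_pos_iff.2 hx
  rw [H.limRadius_apply, ← mul_div_assoc, eq_div_iff hn.ne', mul_comm] at hxr
  have hφ := mul_right_cancel₀ hn'.ne' hxr
  have hr : 0 < limRadius γ A φ θ v := (H.limRadius_mem_Icc θ v).1.lt_of_ne fun h0 => by
    rw [← h0, H.prof.zero] at hφ
    exact hn.ne' hφ
  refine ⟨(limRadius γ A φ θ v / ‖v‖) • v, ⟨by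
    simp only [ne_eq, smul_eq_zero, not_or]
    exact ⟨(by positivity), hv⟩, ?_⟩, radMap_smul_eq hv hr hφ.symm⟩
  rw [limRadius_smul (by positivity), norm_smul, norm_div, norm_norm, Real.norm_of_nonneg hr.le,
    div_mul_cancel₀ _ hn.ne']

lemma isCompact_annulus (γ : Θ ≃ Θ) (A : Θ → Matrix (Fin 2) (Fin 2) ℝ) (hq : 0 < q) (hd : 0 < d)
    {θ : Θ} (hθ : Tendsto (fun k => opNorm (bcoc γ A k θ) / q ^ k) atTop (𝓝 0)) :
    IsCompact {x | (θ, x) ∈ annulus γ A q d} := by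
  obtain ⟨N, hN⟩ := eventually_atTop.1 (hθ.eventually (gt_mem_nhds hd))
  have e : {x | (θ, x) ∈ annulus γ A q d} = closedBall 0 1 ∩
      ⋃ k ∈ Finset.range N, {x | d * q ^ k ≤ ‖mulVecE (bcoc γ A k θ) x‖} := by
    ext x
    simp only [annulus, Set.mem_ofPred_eq, mem_inter_iff, mem_closedBall, dist_zero_right,
      mem_iUnion, Finset.mem_range, exists_prop]
    refine and_congr_right fun hx => exists_congr fun k => ⟨fun hk => ⟨?_, hk⟩, fun hk => hk.2⟩
    by_contra hcon
    have h1 := hN k (not_lt.1 hcon)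
    rw [div_lt_iff₀ (pow_pos hq k)] at h1
    have h2 := (norm_mulVecE_le (bcoc γ A k θ) x).trans
      (mul_le_of_le_one_right (opNorm_nonneg _) hx)
    linarith
  rw [e]
  refine (isCompact_closedBall 0 1).inter_right ?_
  exact isClosed_biUnion_finset fun k _ =>
    isClosed_le continuous_const (continuous_mulVecE _).norm

lemma circ_subset_annulus (H : RadSys A φ β L) (hp : AnnParams φ q d)
    {θ : Θ} (hθ : Tendsto (fun k => opNorm (bcoc γ A k θ) / q ^ k) atTop (𝓝 0)) :
    circ γ A φ θ ⊆ {x | (θ, x) ∈ annulus γ A q d} := by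
  rintro x ⟨hx, hxr⟩
  have hcl := (isCompact_annulus γ A hp.q_pos hp.d_pos hθ).isClosed
  have ht : Tendsto (fun n => (radius γ A φ n θ x / ‖x‖) • x) atTop (𝓝 x) := by
    have := ((H.tendsto_radius (γ := γ) θ x).div_const ‖x‖).smul_const x
    rwa [← hxr, div_self (norm_ne_zero_iff.2 hx), one_smul] at this
  exact hcl.mem_of_tendsto ht (Eventually.of_forall fun n => H.radius_mem_annulus hp n θ hx)

/-- The bounding circle is the pullback attractor of the annuli. -/
theorem circ_eq_iInter (H : RadSys A φ β L) {h : ℝ → ℝ} {b : ℝ}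
    (hf : fibMap A h b = radMap A φ) (hp : AnnParams φ q d) (ha : 0 < a) {θ : Θ}
    (hθ : ∃ᶠ n in atTop, γ.symm^[n] θ ∈ slowSet γ A q a)
    (hθ' : ∀ n, Tendsto (fun k => opNorm (bcoc γ A k (γ.symm^[n] θ)) / q ^ k) atTop (𝓝 0)) :
    circ γ A φ θ = ⋂ n, imageFib γ A h b (annulus γ A q d) n θ := by
  refine Subset.antisymm (subset_iInter fun n => ?_) fun x hx => ?_
  · have key : ∀ n θ, circ γ A φ (γ.symm^[n] θ) ⊆ {x | (γ.symm^[n] θ, x) ∈ annulus γ A q d} →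
        circ γ A φ θ ⊆ imageFib γ A h b (annulus γ A q d) n θ := by
      refine induct_fibre (γ := γ) (fun θ hθ => ?_) (fun n θ ih hθ => ?_)
      · simpa [imageFib] using hθ
      · rw [Function.iterate_succ_apply, Equiv.symm_apply_apply] at hθ
        rw [imageFib_succ hf]
        exact H.circ_subset_image.trans (image_mono (ih hθ))
    exact key n θ (H.circ_subset_annulus hp (hθ' n))
  · rw [mem_iInter] at hx
    refine ⟨ne_zero_of_mem_annulus hp (H.imageFib_annulus_subset hf hp 0 θ (hx 0)), ?_⟩
    refine le_antisymm (le_ciInf fun n => H.imageFib_annulus_subset_disc hf n θ (hx n)) ?_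
    refine le_of_forall_pos_le_add fun ε hε => ?_
    obtain ⟨N, hN⟩ := H.le_norm_of_mem_imageFib hf hp ha hθ hε
    nlinarith [hN N le_rfl x (hx N), (H.limRadius_mem_Icc (γ := γ) θ x).2]

/-- The bounding circle is the topological boundary of the fibre of the attractor. -/
theorem frontier_disc (H : RadSys A φ β L) {θ : Θ} (hpos : ∀ x, x ≠ 0 → 0 < limRadius γ A φ θ x)
    (hc : ContinuousOn (limRadius γ A φ θ) {0}ᶜ) :
    frontier {x | ‖x‖ ≤ limRadius γ A φ θ x} = circ γ A φ θ := by
  have hopen : IsOpen ({0}ᶜ : Set R2) := isOpen_compl_singleton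
  have hcl : IsClosed {x | ‖x‖ ≤ limRadius γ A φ θ x} := by
    have : {x | ‖x‖ ≤ limRadius γ A φ θ x}ᶜ =
        {0}ᶜ ∩ (fun x => ‖x‖ - limRadius γ A φ θ x) ⁻¹' Ioi 0 := by
      ext x
      simp only [mem_compl_iff, Set.mem_ofPred_eq, not_le, mem_inter_iff, mem_singleton_iff,
        mem_preimage, mem_Ioi, sub_pos]
      refine ⟨fun hx => ⟨?_, hx⟩, fun hx => hx.2⟩
      rintro rfl
      rw [norm_zero] at hx
      linarith [(H.limRadius_mem_Icc (γ := γ) θ 0).1]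
    rw [← isOpen_compl_iff, this]
    exact (continuous_norm.continuousOn.sub hc).isOpen_inter_preimage hopen isOpen_Ioi
  have hint : interior {x | ‖x‖ ≤ limRadius γ A φ θ x} =
      {x | x = 0 ∨ ‖x‖ < limRadius γ A φ θ x} := by
    refine Subset.antisymm (fun x hx => ?_) (fun x hx => ?_)
    · by_cases h0 : x = 0
      · exact Or.inl h0
      right
      have ht : Tendsto (fun t : ℝ => t • x) (𝓝[>] 1) (𝓝 x) := by
        have : Continuous fun t : ℝ => t • x := by fun_prop
        simpa using (this.tendsto 1).mono_left nhdsWithin_le_nhds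
      have hev := ht.eventually (mem_interior_iff_mem_nhds.1 hx)
      obtain ⟨t, ht1, ht2⟩ := (hev.and self_mem_nhdsWithin).exists
      have ht2 : 1 < t := ht2
      have ht1 : ‖t • x‖ ≤ limRadius γ A φ θ (t • x) := ht1
      rw [limRadius_smul (by positivity), norm_smul, Real.norm_of_nonneg (by positivity)] at ht1
      have := norm_pos_iff.2 h0
      exact lt_of_lt_of_le (by nlinarith) ht1
    · rw [mem_interior_iff_mem_nhds]
      by_cases h0 : x = 0
      · subst h0
        obtain ⟨y, hy, hymin⟩ := (isCompact_sphere (0 : R2) 1).exists_isMinOn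
          ⟨vFull 0, by simp [norm_vFull]⟩ (hc.mono fun y hy => by
            rintro rfl
            simp at hy)
        have hy0 : y ≠ 0 := by rintro rfl; simp at hy
        filter_upwards [ball_mem_nhds (0 : R2) (hpos y hy0)] with z hz
        rcases eq_or_ne z 0 with rfl | hz0
        · simpa using (H.limRadius_mem_Icc (γ := γ) θ 0).1
        have hnz := norm_pos_iff.2 hz0
        have h1 : limRadius γ A φ θ y ≤ limRadius γ A φ θ (‖z‖⁻¹ • z) :=
          hymin (by simp [norm_smul, hnz.ne'])
        rw [limRadius_smul (by positivity)] at h1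
        rw [mem_ball, dist_zero_right] at hz
        exact hz.le.trans h1
      · have hx' : ‖x‖ < limRadius γ A φ θ x := hx.resolve_left h0
        have hat : ContinuousAt (fun x => limRadius γ A φ θ x - ‖x‖) x :=
          ((hc.sub continuous_norm.continuousOn).continuousAt (hopen.mem_nhds h0))
        filter_upwards [hat.eventually (lt_mem_nhds (sub_pos.2 hx'))] with z hz
        exact (sub_pos.1 hz).le
  rw [hcl.frontier_eq, hint]
  ext x
  simp only [Set.mem_sdiff, Set.mem_ofPred_eq, not_or, not_lt, circ]
  exact ⟨fun hx => ⟨hx.2.1, le_antisymm hx.1 hx.2.2⟩, fun hx => ⟨hx.2.le, hx.1, hx.2.ge⟩⟩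

lemma measurable_infDist_annulus [MeasurableSpace Θ] (H : RadSys A φ β L) (hγ' : Measurable γ.symm)
    (hA : ∀ i j, Measurable fun θ => A θ i j) (hp : AnnParams φ q d) (x : R2) :
    Measurable fun θ => infDist x {y | (θ, y) ∈ annulus γ A q d} := by
  set U : Θ → Set R2 := fun θ =>
    {y | ‖y‖ < 1 ∧ ∃ k : ℕ, d * q ^ k < ‖mulVecE (bcoc γ A k θ) y‖} with hU
  have hUK : ∀ θ, U θ ⊆ {y | (θ, y) ∈ annulus γ A q d} := fun θ y hy =>
    ⟨hy.1.le, hy.2.imp fun _ hk => hk.le⟩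
  have hKU : ∀ θ, {y | (θ, y) ∈ annulus γ A q d} ⊆ closure (U θ) := fun θ y hy => by
    have hcont : Continuous fun t : ℝ => t • y := by fun_prop
    have hne := norm_pos_iff.2 (ne_zero_of_mem_annulus hp hy)
    obtain ⟨hy1, k, hk⟩ := hy
    have hy1 : ‖y‖ ≤ 1 := hy1
    rcases hy1.eq_or_lt with h1 | h1
    · have ht : Tendsto (fun t : ℝ => t • y) (𝓝[<] 1) (𝓝 y) := by
        simpa using (hcont.tendsto 1).mono_left nhdsWithin_le_nhds
      refine mem_closure_of_tendsto ht ?_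
      filter_upwards [Ioo_mem_nhdsLT (show (1 / 2 : ℝ) < 1 by norm_num)] with t ht
      have e : ‖t • y‖ = t := by
        rw [norm_smul, h1, mul_one, Real.norm_of_nonneg (by linarith [ht.1])]
      refine ⟨e.trans_lt ht.2, 0, ?_⟩
      simp only [coc, mulVecE_one, e, pow_zero, mul_one]
      linarith [hp.d_le, ht.1]
    · have ht : Tendsto (fun t : ℝ => t • y) (𝓝[>] 1) (𝓝 y) := by
        simpa using (hcont.tendsto 1).mono_left nhdsWithin_le_nhds
      refine mem_closure_of_tendsto ht ?_
      filter_upwards [Ioo_mem_nhdsGT (show (1 : ℝ) < 1 / ‖y‖ by rwa [lt_div_iff₀ hne, one_mul])]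
        with t ht
      have ht0 : 0 < t := zero_lt_one.trans ht.1
      refine ⟨?_, k, ?_⟩
      · rw [norm_smul, Real.norm_of_nonneg ht0.le, ← lt_div_iff₀ hne]
        exact ht.2
      · rw [mulVecE_smul, norm_smul, Real.norm_of_nonneg ht0.le]
        have h0 : 0 < d * q ^ k := mul_pos hp.d_pos (pow_pos hp.q_pos k)
        simp only at hk
        nlinarith [ht.1]
  have hUne : ∀ θ, (U θ).Nonempty := fun θ => by
    have : (θ, (radius γ A φ 0 θ (vFull 0) / ‖vFull 0‖) • vFull 0) ∈ annulus γ A q d :=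
      H.radius_mem_annulus hp 0 θ (norm_ne_zero_iff.1 (by simp [norm_vFull]))
    exact closure_nonempty_iff.1 ⟨_, hKU θ this⟩
  have hUo : ∀ θ, IsOpen (U θ) := fun θ => by
    have : U θ = {y | ‖y‖ < 1} ∩ ⋃ k : ℕ, {y | d * q ^ k < ‖mulVecE (bcoc γ A k θ) y‖} := by
      ext y; simp [hU]
    rw [this]
    exact (isOpen_lt continuous_norm continuous_const).inter
      (isOpen_iUnion fun k => isOpen_lt continuous_const (continuous_mulVecE _).norm)
  have heq : ∀ θ, infDist x {y | (θ, y) ∈ annulus γ A q d} = infDist x (U θ) := fun θ =>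
    le_antisymm (infDist_le_infDist_of_subset (hUK θ) (hUne θ)) (by
      rw [← infDist_closure (s := U θ)]
      exact infDist_le_infDist_of_subset (hKU θ) ((hUne θ).mono (hUK θ)))
  simp only [heq]
  refine measurable_of_Iio fun c => ?_
  have : (fun θ => infDist x (U θ)) ⁻¹' Iio c = ⋃ n : ℕ, ⋃
      (_ : dist x (TopologicalSpace.denseSeq R2 n) < c),
      {θ | TopologicalSpace.denseSeq R2 n ∈ U θ} := by
    ext θ
    simp only [mem_preimage, mem_Iio, mem_iUnion, exists_prop, Set.mem_ofPred_eq]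
    rw [infDist_lt_iff (hUne θ)]
    constructor
    · rintro ⟨y, hy, hyc⟩
      obtain ⟨_, ⟨hz1, hz2⟩, n, rfl⟩ := (TopologicalSpace.denseRange_denseSeq
          R2).inter_open_nonempty
        (U θ ∩ {z | dist x z < c})
        ((hUo θ).inter (isOpen_lt (continuous_const.dist continuous_id) continuous_const))
            ⟨y, hy, hyc⟩
      exact ⟨n, hz2, hz1⟩
    · rintro ⟨n, hn, hm⟩
      exact ⟨_, hm, hn⟩
  rw [this]
  refine MeasurableSet.iUnion fun n => MeasurableSet.iUnion fun _ => ?_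
  simp only [hU, Set.mem_ofPred_eq]
  refine (MeasurableSet.const _).inter ?_
  refine MeasurableSet.congr (MeasurableSet.iUnion fun k => measurableSet_lt measurable_const
    (measurable_mulVecE (measurable_coc hγ' (measurable_invGen hγ' H.det hA) k)
      measurable_const).norm) (s := ⋃ k, {θ | d * q ^ k <
        ‖mulVecE (bcoc γ A k θ) (TopologicalSpace.denseSeq R2 n)‖})
            (by ext; simp only [mem_iUnion]; rfl)

end RadSys
end Radial

namespace Profile
variable {φ : ℝ → ℝ} {β L : ℝ}

lemma abs_log_sub_log_le (P : Profile φ β L) {s r : ℝ} (hs : 0 < s) (hr : 0 < r) :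
    |Real.log (φ s) - Real.log (φ r)| ≤ |Real.log s - Real.log r| := by
  wlog hsr : s ≤ r generalizing s r
  · rw [abs_sub_comm, abs_sub_comm (Real.log s)]
    exact this hr hs (le_of_not_ge hsr)
  have h1 := Real.log_le_log (mul_pos (div_pos hs hr) (P.pos hr)) (P.div_le hs.le hsr hr)
  rw [Real.log_mul (div_pos hs hr).ne' (P.pos hr).ne', Real.log_div hs.ne' hr.ne'] at h1
  rw [abs_of_nonpos (sub_nonpos.2 (Real.log_le_log (P.pos hs) (P.mono' hs.le hsr))),
    abs_of_nonpos (sub_nonpos.2 (Real.log_le_log hs hsr))]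
  linarith

lemma exists_exp_contraction (P : Profile φ β L) {a : ℝ} (ha : 0 < a) :
    ∃ k < 1, ∀ s r, a ≤ s → a ≤ r →
    1 - k * (1 - Real.exp (-|Real.log s - Real.log r|)) ≤
      Real.exp (-|Real.log (φ s) - Real.log (φ r)|) := by
  obtain ⟨k, -, hk1, hk⟩ := P.exists_contraction ha
  refine ⟨k, hk1, fun s r hs hr => ?_⟩
  wlog hsr : s ≤ r generalizing s r
  · rw [abs_sub_comm, abs_sub_comm (Real.log (φ s))]
    exact this r s hr hs (le_of_not_ge hsr)
  have hs0 := ha.trans_le hs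
  have hr0 := ha.trans_le hr
  rw [abs_of_nonpos (sub_nonpos.2 (Real.log_le_log (P.pos hs0) (P.mono' hs0.le hsr))),
    abs_of_nonpos (sub_nonpos.2 (Real.log_le_log hs0 hsr)), neg_neg, neg_neg,
    ← Real.log_div hs0.ne' hr0.ne', ← Real.log_div (P.pos hs0).ne' (P.pos hr0).ne',
    Real.exp_log (div_pos hs0 hr0), Real.exp_log (div_pos (P.pos hs0) (P.pos hr0))]
  linarith [hk s r hs hsr]

/-- Two orbits of the profile driven by summably close multipliers merge, provided one of them
keeps returning to a region bounded away from zero. -/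
lemma tendsto_log_sub_log (P : Profile φ β L) {x y a b ε : ℕ → ℝ} (hx : ∀ n, 0 < x n)
    (hy : ∀ n, 0 < y n)
    (ha : ∀ n, 0 < a n) (hb : ∀ n, 0 < b n) (hxs : ∀ n, x (n + 1) = φ (x n) * a n)
    (hys : ∀ n, y (n + 1) = φ (y n) * b n)
    (hε : ∀ n, |Real.log (a n) - Real.log (b n)| ≤ ε n) (hsum : Summable ε) {δ : ℝ} (hδ : 0 < δ)
    (hf : ∃ᶠ n in atTop, δ ≤ y n) :
    Tendsto (fun n => Real.log (x n) - Real.log (y n)) atTop (𝓝 0) := by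
  have hε0 : ∀ n, 0 ≤ ε n := fun n => (abs_nonneg _).trans (hε n)
  set D : ℕ → ℝ := fun n => |Real.log (x n) - Real.log (y n)| with hD
  have hstep : ∀ n, D (n + 1) ≤ |Real.log (φ (x n)) - Real.log (φ (y n))| + ε n := fun n => by
    simp only [hD]
    rw [hxs, hys, Real.log_mul (P.pos (hx n)).ne' (ha n).ne',
      Real.log_mul (P.pos (hy n)).ne' (hb n).ne', add_sub_add_comm]
    exact (abs_add_le _ _).trans (add_le_add_right (hε n) _)
  have hanti : Antitone fun n => D n - ∑ i ∈ Finset.range n, ε i :=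
    antitone_nat_of_succ_le fun n => by
      rw [Finset.sum_range_succ]
      linarith [hstep n, P.abs_log_sub_log_le (hx n) (hy n)]
  have hbdd : ∀ n, D n ≤ D 0 + ∑' i, ε i := fun n => by
    have h1 := hanti (Nat.zero_le n)
    have h2 := hsum.sum_le_tsum (Finset.range n) fun i _ => hε0 i
    simp only [Finset.range_zero, Finset.sum_empty] at h1
    linarith
  obtain ⟨l, hl⟩ : ∃ l, Tendsto D atTop (𝓝 l) := by
    have h1 := tendsto_atTop_ciInf hanti ⟨-∑' i, ε i, by
      rintro _ ⟨n, rfl⟩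
      have h2 := hsum.sum_le_tsum (Finset.range n) fun i _ => hε0 i
      have h3 : 0 ≤ D n := abs_nonneg _
      simp only
      linarith⟩
    have h2 := h1.add hsum.hasSum.tendsto_sum_nat
    simp only [sub_add_cancel] at h2
    exact ⟨_, h2⟩
  have hl0 : 0 ≤ l := ge_of_tendsto' hl fun n => abs_nonneg _
  set M := D 0 + ∑' i, ε i
  have hM : 0 ≤ M := (abs_nonneg _).trans (hbdd 0)
  obtain ⟨k, hk1, hk⟩ := P.exists_exp_contraction (mul_pos hδ (Real.exp_pos (-M)))
  have hlim : 1 - k * (1 - Real.exp (-l)) ≤ Real.exp (0 - l) := by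
    refine le_of_tendsto_of_tendsto_of_frequently (f := fun n => 1 - k * (1 - Real.exp (-D n)))
      (g := fun n => Real.exp (ε n - D (n + 1))) (b := atTop) ?_ ?_ (hf.mono fun n hn => ?_)
    · exact ((((Real.continuous_exp.tendsto _).comp hl.neg).const_sub 1).const_mul k).const_sub 1
    · exact (Real.continuous_exp.tendsto _).comp
        (hsum.tendsto_atTop_zero.sub ((tendsto_add_atTop_iff_nat 1).2 hl))
    · have h1 : δ * Real.exp (-M) ≤ y n :=
        (mul_le_of_le_one_right hδ.le (Real.exp_le_one_iff.2 (by linarith))).trans hn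
      have h2 : δ * Real.exp (-M) ≤ x n := by
        have h3 : Real.log (y n) - M ≤ Real.log (x n) := by
          linarith [neg_abs_le (Real.log (x n) - Real.log (y n)), hbdd n]
        have h4 := Real.exp_le_exp.2 h3
        rw [sub_eq_add_neg, Real.exp_add, Real.exp_log (hy n), Real.exp_log (hx n)] at h4
        exact (mul_le_mul_of_nonneg_right hn (Real.exp_pos _).le).trans h4
      refine (hk _ _ h2 h1).trans (Real.exp_le_exp.2 ?_)
      linarith [hstep n]
  have hl1 : l = 0 := by
    rw [zero_sub] at hlim
    have : 1 ≤ Real.exp (-l) := by nlinarith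
    have := Real.one_le_exp_iff.1 this
    linarith
  rw [hl1] at hl
  exact (tendsto_zero_iff_abs_tendsto_zero _).2 hl

end Profile

lemma exists_sign_norm_sub_le {x y : R2} (hx : ‖x‖ = 1) (hy : ‖y‖ = 1) :
    ∃ σ : ℝ, (σ = 1 ∨ σ = -1) ∧ ‖x - σ • y‖ ≤ 2 * |wedge x y| := by
  have h := wedge_sq_add_inner_sq x y
  have hx2 := R2.norm_sq x
  have hy2 := R2.norm_sq y
  rw [hx] at h hx2
  rw [hy] at h hy2
  obtain ⟨σ, hσ, hs⟩ : ∃ σ : ℝ, (σ = 1 ∨ σ = -1) ∧ 0 ≤ σ * (x 0 * y 0 + x 1 * y 1) := by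
    rcases le_total 0 (x 0 * y 0 + x 1 * y 1) with h | h
    · exact ⟨1, Or.inl rfl, by linarith⟩
    · exact ⟨-1, Or.inr rfl, by linarith⟩
  refine ⟨σ, hσ, ?_⟩
  refine le_of_sq_le_sq ?_ (by positivity)
  have hσ2 : σ ^ 2 = 1 := by rcases hσ with rfl | rfl <;> norm_num
  have e : ‖x - σ • y‖ ^ 2 = 2 - 2 * (σ * (x 0 * y 0 + x 1 * y 1)) := by
    rw [R2.norm_sq]
    simp only [PiLp.sub_apply, PiLp.smul_apply, smul_eq_mul]
    linear_combination (-1) * hx2 - σ ^ 2 * hy2 + hσ2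
  rw [e, mul_pow, sq_abs]
  set t := σ * (x 0 * y 0 + x 1 * y 1) with ht
  have ht2 : t ^ 2 = (x 0 * y 0 + x 1 * y 1) ^ 2 := by rw [ht, mul_pow, hσ2, one_mul]
  nlinarith [sq_nonneg (wedge x y)]

lemma abs_log_sub_log_le_div {a b c : ℝ} (hc : 0 < c) (ha : c ≤ a) (hb : c ≤ b) :
    |Real.log a - Real.log b| ≤ |a - b| / c := by
  wlog hab : a ≤ b generalizing a b
  · rw [abs_sub_comm, abs_sub_comm a]
    exact this hb ha (le_of_not_ge hab)
  have ha0 := hc.trans_le ha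
  have hb0 := hc.trans_le hb
  rw [abs_of_nonpos (sub_nonpos.2 (Real.log_le_log ha0 hab)), abs_of_nonpos (sub_nonpos.2 hab),
    neg_sub, neg_sub, ← Real.log_div hb0.ne' ha0.ne']
  refine (Real.log_le_sub_one_of_pos (div_pos hb0 ha0)).trans ?_
  rw [div_sub_one ha0.ne']
  exact div_le_div_of_nonneg_left (sub_nonneg.2 hab) hc ha

lemma abs_sub_le_abs_log_sub_log {a b : ℝ} (ha0 : 0 < a) (ha : a ≤ 1) (hb0 : 0 < b) (hb : b ≤ 1) :
    |a - b| ≤ |Real.log a - Real.log b| := by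
  wlog hab : a ≤ b generalizing a b
  · rw [abs_sub_comm, abs_sub_comm (Real.log a)]
    exact this hb0 hb ha0 ha (le_of_not_ge hab)
  rw [abs_of_nonpos (sub_nonpos.2 (Real.log_le_log ha0 hab)), abs_of_nonpos (sub_nonpos.2 hab),
    neg_sub, neg_sub]
  have h1 := Real.log_le_sub_one_of_pos (div_pos ha0 hb0)
  rw [Real.log_div ha0.ne' hb0.ne'] at h1
  have h2 : b - a ≤ 1 - a / b := by
    rw [one_sub_div hb0.ne']
    exact le_div_self (sub_nonneg.2 hab) hb0 hb
  linarith

lemma mulVecE_sub (M : Matrix (Fin 2) (Fin 2) ℝ) (v w : R2) :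
    mulVecE M (v - w) = mulVecE M v - mulVecE M w :=
  (Matrix.toEuclideanCLM (𝕜 := ℝ) M : R2 →L[ℝ] R2).map_sub v w

namespace RadSys
variable {Θ : Type*} {γ : Θ ≃ Θ} {A : Θ → Matrix (Fin 2) (Fin 2) ℝ} {φ h : ℝ → ℝ} {β b L : ℝ}

lemma skewProd_iterate_succ_snd (hf : fibMap A h b = radMap A φ) (n : ℕ) (p : Θ × R2) :
    ((skewProd γ A h b)^[n + 1] p).2 =
      radMap A φ (γ^[n] p.1) ((skewProd γ A h b)^[n] p).2 := by
  rw [Function.iterate_succ_apply', skewProd_apply hf, skewProd_iterate_fst]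

lemma exists_skewProd_iterate (H : RadSys A φ β L) (hf : fibMap A h b = radMap A φ) (θ : Θ)
    {v : R2} (hv : v ≠ 0) (n : ℕ) :
    ∃ t > (0 : ℝ), ((skewProd γ A h b)^[n] (θ, v)).2 = t • mulVecE (coc γ A n θ) v := by
  induction n with
  | zero => exact ⟨1, one_pos, by simp [coc, mulVecE_one]⟩
  | succ n ih =>
    obtain ⟨t, ht, he⟩ := ih
    have hn : 0 < ‖t • mulVecE (coc γ A n θ) v‖ :=
      norm_pos_iff.2 (smul_ne_zero ht.ne' (mulVecE_ne_zero (det_coc H.det n θ) hv))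
    refine ⟨_, mul_pos (div_pos (H.prof.pos hn) hn) ht, ?_⟩
    rw [skewProd_iterate_succ_snd hf, he, radMap, mulVecE_smul, smul_smul, coc_succ, mulVecE_mul]

/-- Orbits transverse to the contracted direction approach the invariant pair of points. -/
theorem tendsto_infDist_pair (H : RadSys A φ β L) (hf : fibMap A h b = radMap A φ) {C δ : ℝ}
    (hC : ∀ θ, opNorm (A θ) ≤ C) {u : Θ → R2} (hu : ∀ θ, ‖u θ‖ = 1) {θ : Θ}
    (hinv : ∀ n, wedge (mulVecE (A (γ^[n] θ)) (u (γ^[n] θ))) (u (γ^[n + 1] θ)) = 0)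
    (hpos : ∀ n, 0 < limRadius γ A φ (γ^[n] θ) (u (γ^[n] θ))) (hδ : 0 < δ)
    (hrec : ∃ᶠ n in atTop, δ ≤ limRadius γ A φ (γ^[n] θ) (u (γ^[n] θ))) {v : R2} (hv : v ≠ 0)
    (hsum : Summable fun n =>
      (‖mulVecE (coc γ A n θ) v‖ * ‖mulVecE (coc γ A n θ) (u θ)‖)⁻¹) :
    Tendsto (fun n => infDist ((skewProd γ A h b)^[n] (θ, v)).2
      ({limRadius γ A φ (γ^[n] θ) (u (γ^[n] θ)) • u (γ^[n] θ),
        -(limRadius γ A φ (γ^[n] θ) (u (γ^[n] θ)) • u (γ^[n] θ))} : Set R2)) atTop (𝓝 0) := by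
  have hC1 : 1 ≤ C := (one_le_opNorm (H.det θ)).trans (hC θ)
  have hC0 : 0 < C := one_pos.trans_le hC1
  have hu0 : ∀ θ, u θ ≠ 0 := fun θ h => by simpa [h] using hu θ
  have hstep : ∀ n, ∃ s : ℝ, |s| = ‖mulVecE (A (γ^[n] θ)) (u (γ^[n] θ))‖ ∧
      mulVecE (A (γ^[n] θ)) (u (γ^[n] θ)) = s • u (γ^[n + 1] θ) := fun n =>
    exists_smul_of_wedge_eq_zero (hu _) (hinv n)
  have horb : ∀ n, ∃ s : ℝ, mulVecE (coc γ A n θ) (u θ) = s • u (γ^[n] θ) := by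
    intro n
    induction n with
    | zero => exact ⟨1, by simp [coc, mulVecE_one]⟩
    | succ n ih =>
      obtain ⟨s, hs⟩ := ih
      obtain ⟨s', -, hs'⟩ := hstep n
      exact ⟨s * s', by rw [coc_succ, mulVecE_mul, hs, mulVecE_smul, hs', smul_smul]⟩
  set w : ℕ → R2 := fun n => ((skewProd γ A h b)^[n] (θ, v)).2 with hw
  set y : ℕ → ℝ := fun n => limRadius γ A φ (γ^[n] θ) (u (γ^[n] θ)) with hy
  have hwz : ∀ n, w n ≠ 0 := fun n => by
    obtain ⟨t, ht, he⟩ := H.exists_skewProd_iterate (γ := γ) hf θ hv n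
    simp only [hw, he]
    exact smul_ne_zero ht.ne' (mulVecE_ne_zero (det_coc H.det n θ) hv)
  have hwn : ∀ n, 0 < ‖w n‖ := fun n => norm_pos_iff.2 (hwz n)
  have hunit : ∀ n, ‖‖w n‖⁻¹ • w n‖ = 1 := fun n => by
    rw [norm_smul, norm_inv, norm_norm, inv_mul_cancel₀ (hwn n).ne']
  set η : ℕ → ℝ := fun n => |wedge v (u θ)| *
    (‖mulVecE (coc γ A n θ) v‖ * ‖mulVecE (coc γ A n θ) (u θ)‖)⁻¹ with hη
  have hwedge : ∀ n, |wedge (‖w n‖⁻¹ • w n) (u (γ^[n] θ))| = η n := fun n => by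
    obtain ⟨t, ht, he⟩ := H.exists_skewProd_iterate (γ := γ) hf θ hv n
    obtain ⟨s, hs⟩ := horb n
    have h1 := wedge_mulVecE (coc γ A n θ) v (u θ)
    have hs0 : s ≠ 0 := by
      rintro rfl
      exact mulVecE_ne_zero (det_coc H.det n θ) (hu0 θ) (by rw [hs, zero_smul])
    have hv0 := norm_pos_iff.2 (mulVecE_ne_zero (det_coc (T := γ) H.det n θ) hv)
    rw [det_coc H.det, one_mul, hs, wedge_smul_right] at h1
    simp only [hη, hw]
    rw [he, hs, ← h1, wedge_smul_left, wedge_smul_left, norm_smul, norm_smul, hu, abs_mul, abs_mul,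
      abs_mul, abs_inv, abs_mul, Real.norm_of_nonneg ht.le, abs_of_pos ht,
      Real.norm_eq_abs]
    have := abs_pos.2 hs0
    field_simp
    rw [abs_norm, mul_comm]
  have hηs : Summable η := hsum.mul_left _
  choose σ hσ hσle using fun n => exists_sign_norm_sub_le (hunit n) (hu (γ^[n] θ))
  simp only [hwedge] at hσle
  have hσ1 : ∀ n, |σ n| = 1 := fun n => by rcases hσ n with h | h <;> simp [h]
  have hlow : ∀ n {x : R2}, ‖x‖ = 1 → 1 / C ≤ ‖mulVecE (A (γ^[n] θ)) x‖ := fun n x hx => by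
    rw [div_le_iff₀ hC0, mul_comm, ← hx]
    exact (norm_le_opNorm_mul (H.det _) x).trans
      (mul_le_mul_of_nonneg_right (hC _) (norm_nonneg _))
  have hlog : Tendsto (fun n => Real.log ‖w n‖ - Real.log (y n)) atTop (𝓝 0) := by
    refine H.prof.tendsto_log_sub_log
      (a := fun n => ‖mulVecE (A (γ^[n] θ)) (‖w n‖⁻¹ • w n)‖)
      (b := fun n => ‖mulVecE (A (γ^[n] θ)) (u (γ^[n] θ))‖)
      (ε := fun n => C * (2 * η n) / (1 / C)) hwn hpos ?_ ?_ ?_ ?_ ?_ ?_ hδ hrec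
    · exact fun n => (one_div_pos.2 hC0).trans_le (hlow n (hunit n))
    · exact fun n => (one_div_pos.2 hC0).trans_le (hlow n (hu _))
    · intro n
      simp only [hw, skewProd_iterate_succ_snd hf, H.norm_radMap]
      rw [mulVecE_smul, norm_smul, norm_inv, norm_norm]
      ring
    · intro n
      obtain ⟨s, hs1, hs⟩ := hstep n
      have hs0 : s ≠ 0 := by
        rintro rfl
        exact mulVecE_ne_zero (H.det _) (hu0 _) (by rw [hs, zero_smul])
      have h1 := H.limRadius_apply (γ := γ) (γ^[n] θ) (u (γ^[n] θ))
      rw [hs, limRadius_smul hs0, ← hs, hu, div_one, ← Function.iterate_succ_apply' γ n θ] at h1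
      exact h1
    · intro n
      refine (abs_log_sub_log_le_div (one_div_pos.2 hC0) (hlow n (hunit n)) (hlow n (hu _))).trans
          ?_
      refine div_le_div_of_nonneg_right ?_ (one_div_pos.2 hC0).le
      have e : ‖mulVecE (A (γ^[n] θ)) (u (γ^[n] θ))‖ =
          ‖mulVecE (A (γ^[n] θ)) (σ n • u (γ^[n] θ))‖ := by
        rw [mulVecE_smul, norm_smul, Real.norm_eq_abs, hσ1, one_mul]
      rw [e]
      refine (abs_norm_sub_norm_le _ _).trans ?_
      rw [← mulVecE_sub]
      exact (norm_mulVecE_le _ _).trans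
        (mul_le_mul (hC _) (hσle n) (norm_nonneg _) hC0.le)
    · exact ((hηs.mul_left 2).mul_left C).div_const _
  have hlim : Tendsto (fun n => |Real.log ‖w n‖ - Real.log (y n)| + 2 * η n) atTop (𝓝 0) := by
    simpa using hlog.abs.add (hηs.tendsto_atTop_zero.const_mul 2)
  refine squeeze_zero' (Eventually.of_forall fun n => infDist_nonneg) ?_ hlim
  filter_upwards [eventually_ge_atTop 1] with n hn
  have hy1 : y n ≤ 1 := (H.limRadius_mem_Icc _ _).2
  have hw1 : ‖w n‖ ≤ 1 := by
    obtain ⟨n, rfl⟩ := Nat.exists_eq_add_of_le' hn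
    simp only [hw, skewProd_iterate_succ_snd hf]
    exact H.norm_radMap_le_one _ _
  have hmem : σ n • y n • u (γ^[n] θ) ∈ ({y n • u (γ^[n] θ), -(y n • u (γ^[n] θ))} : Set R2) := by
    rcases hσ n with h | h <;> simp [h]
  refine (infDist_le_dist_of_mem hmem).trans ?_
  have e : w n - σ n • y n • u (γ^[n] θ) =
      (‖w n‖ - y n) • ‖w n‖⁻¹ • w n + y n • (‖w n‖⁻¹ • w n - σ n • u (γ^[n] θ)) := by
    rw [smul_sub, ← add_sub_assoc, ← add_smul, sub_add_cancel, smul_smul (‖w n‖),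
      mul_inv_cancel₀ (hwn n).ne', one_smul, smul_comm (σ n)]
  rw [dist_eq_norm, e]
  refine (norm_add_le _ _).trans (add_le_add ?_ ?_)
  · rw [norm_smul, hunit, mul_one, Real.norm_eq_abs]
    exact abs_sub_le_abs_log_sub_log (hwn n) hw1 (hpos n) hy1
  · rw [norm_smul, Real.norm_of_nonneg (hpos n).le]
    exact (mul_le_of_le_one_left (norm_nonneg _) hy1).trans (hσle n)

end RadSys

section Polar

lemma vFull_add_half (α : ℝ) : vFull (α + 1 / 2) = (-1 : ℝ) • vFull α := by
  have e : 2 * Real.pi * (α + 1 / 2) = 2 * Real.pi * α + Real.pi := by ring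
  apply R2.ext
  · rw [PiLp.smul_apply, vFull_zero_coord, vFull_zero_coord, e, Real.cos_add_pi, neg_one_smul]
  · rw [PiLp.smul_apply, vFull_one_coord, vFull_one_coord, e, Real.sin_add_pi, neg_one_smul]

lemma vFull_fract (α : ℝ) : vFull (Int.fract α) = vFull α := by
  have e : 2 * Real.pi * Int.fract α = 2 * Real.pi * α - ⌊α⌋ * (2 * Real.pi) := by
    rw [Int.fract]; ring
  apply R2.ext
  · rw [vFull_zero_coord, vFull_zero_coord, e, Real.cos_sub_int_mul_two_pi]
  · rw [vFull_one_coord, vFull_one_coord, e, Real.sin_sub_int_mul_two_pi]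

lemma vFull_ne_zero (α : ℝ) : vFull α ≠ 0 := fun h => by simpa [h] using norm_vFull α

lemma continuous_vFull : Continuous vFull := by
  have : vFull = fun α => WithLp.toLp 2 ![Real.cos (2 * Real.pi * α), Real.sin (2 * Real.pi * α)] :=
    rfl
  rw [this]
  refine (PiLp.continuous_toLp 2 _).comp (continuous_pi fun i => ?_)
  fin_cases i
  · exact Real.continuous_cos.comp (by fun_prop)
  · exact Real.continuous_sin.comp (by fun_prop)

lemma exists_eq_norm_smul_vFull (x : R2) : ∃ α ∈ Ico (0 : ℝ) 1, x = ‖x‖ • vFull α := by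
  set z : ℂ := ⟨x 0, x 1⟩ with hz
  have hn : ‖z‖ = ‖x‖ := by
    rw [← sq_eq_sq₀ (norm_nonneg _) (norm_nonneg _), R2.norm_sq, ← Complex.normSq_eq_norm_sq,
      Complex.normSq_apply]
    ring
  have e : 2 * Real.pi * (z.arg / (2 * Real.pi)) = z.arg :=
    mul_div_cancel₀ _ Real.two_pi_pos.ne'
  refine ⟨Int.fract (z.arg / (2 * Real.pi)), ⟨Int.fract_nonneg _, Int.fract_lt_one _⟩, ?_⟩
  rw [vFull_fract]
  apply R2.ext
  · rw [PiLp.smul_apply, vFull_zero_coord, e, smul_eq_mul, ← hn, Complex.norm_mul_cos_arg]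
  · rw [PiLp.smul_apply, vFull_one_coord, e, smul_eq_mul, ← hn, Complex.norm_mul_sin_arg]

end Polar

section RegularPoints
variable {Θ : Type*} {γ : Θ ≃ Θ} {A : Θ → Matrix (Fin 2) (Fin 2) ℝ} {lam q : ℝ}

lemma exists_opNorm_coc_le {T : Θ → Θ} (hdet : ∀ θ, (A θ).det = 1) {θ : Θ}
    (h : Tendsto (fun n : ℕ => logCoc T A n θ / n) atTop (𝓝 lam)) (hq : Real.exp lam < q) :
    ∃ D, ∀ n, opNorm (coc T A n θ) ≤ D * q ^ n := by
  have hq0 : 0 < q := (Real.exp_pos lam).trans hq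
  obtain ⟨D, -, hD⟩ := exists_abs_sub_le_of_tendsto_div h
    (sub_pos.2 ((Real.lt_log_iff_exp_lt hq0).2 hq))
  refine ⟨Real.exp D, fun n => ?_⟩
  rw [← exp_logCoc hdet, ← Real.exp_log (pow_pos hq0 n), ← Real.exp_add, Real.log_pow]
  refine Real.exp_le_exp.2 ?_
  have := (abs_le.1 (hD n)).2
  linarith

lemma tendsto_opNorm_coc_div {T : Θ → Θ} (hdet : ∀ θ, (A θ).det = 1) {θ : Θ}
    (h : Tendsto (fun n : ℕ => logCoc T A n θ / n) atTop (𝓝 lam)) (hq : Real.exp lam < q) :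
    Tendsto (fun n => opNorm (coc T A n θ) / q ^ n) atTop (𝓝 0) := by
  obtain ⟨p, hp, hpq⟩ := exists_between hq
  have hp0 : 0 < p := (Real.exp_pos lam).trans hp
  have hq0 := hp0.trans hpq
  obtain ⟨D, hD⟩ := exists_opNorm_coc_le hdet h hp
  have hlim : Tendsto (fun n => D * (p / q) ^ n) atTop (𝓝 0) := by
    simpa using (tendsto_pow_atTop_nhds_zero_of_lt_one (div_pos hp0 hq0).le
      ((div_lt_one hq0).2 hpq)).const_mul D
  refine squeeze_zero (fun n => div_nonneg (opNorm_nonneg _) (pow_nonneg hq0.le n)) (fun n => ?_)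
      hlim
  rw [div_pow, ← mul_div_assoc]
  exact div_le_div_of_nonneg_right (hD n) (pow_nonneg hq0.le n)

/-- Base points with exact exponential growth and recurrent slow backward growth. -/
structure RegularPoint (γ : Θ ≃ Θ) (A : Θ → Matrix (Fin 2) (Fin 2) ℝ) (lam : ℝ) (θ : Θ) :
    Prop where
  forward : Tendsto (fun n : ℕ => logCoc γ A n θ / n) atTop (𝓝 lam)
  backward : Tendsto (fun n : ℕ => logCoc γ.symm (invGen γ A) n θ / n) atTop (𝓝 lam)
  recurrent : ∀ q : ℚ, Real.exp lam < q → ∃ a > 0, (∃ᶠ n in atTop, γ.symm^[n] θ ∈ slowSet γ A q a) ∧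
    ∃ᶠ n in atTop, γ^[n] θ ∈ slowSet γ A q a

lemma exists_mem_slowSet (hdet : ∀ θ, (A θ).det = 1) {θ : Θ}
    (h : Tendsto (fun n : ℕ => logCoc γ.symm (invGen γ A) n θ / n) atTop (𝓝 lam))
    (hq : Real.exp lam < q) : ∃ j : ℕ, θ ∈ slowSet γ A q (1 / (j + 1)) := by
  obtain ⟨D, hD⟩ := exists_opNorm_coc_le (det_invGen γ hdet) h hq
  obtain ⟨j, hj⟩ := exists_nat_ge D
  refine ⟨j, fun k => (hD k).trans ?_⟩
  rw [div_div_eq_mul_div, div_one, mul_comm]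
  exact mul_le_mul_of_nonneg_left (by linarith) (pow_nonneg ((Real.exp_pos lam).trans hq).le k)

lemma measurableSet_slowSet [MeasurableSpace Θ] (hγ' : Measurable γ.symm)
    (hdet : ∀ θ, (A θ).det = 1) (hA : ∀ i j, Measurable fun θ => A θ i j) (q a : ℝ) :
    MeasurableSet (slowSet γ A q a) := by
  have : slowSet γ A q a = ⋂ k, {θ | opNorm (bcoc γ A k θ) ≤ q ^ k / a} := by
    ext θ
    simp only [mem_iInter]
    rfl
  rw [this]
  exact MeasurableSet.iInter fun k => measurableSet_le (measurable_opNorm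
    (measurable_coc hγ' (measurable_invGen hγ' hdet hA) k)) measurable_const

lemma ae_regularPoint [MeasurableSpace Θ] {m : Measure Θ} [IsProbabilityMeasure m]
    (hγ' : Measurable γ.symm) (herg : Ergodic γ m) (hdet : ∀ θ, (A θ).det = 1)
    (hA : ∀ i j, Measurable fun θ => A θ i j) {C : ℝ} (hC : ∀ θ, opNorm (A θ) ≤ C)
    (hlam : Tendsto (fun n : ℕ => (∫ θ, logCoc γ A n θ ∂m) / n) atTop (𝓝 lam)) :
    ∀ᵐ θ ∂m, RegularPoint γ A lam θ := by
  have hmp := herg.toMeasurePreserving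
  have hsymm := herg.equiv_symm hmp.measurable hγ'
  have hlam' : Tendsto (fun n : ℕ => (∫ θ, logCoc γ.symm (invGen γ A) n θ ∂m) / n) atTop
      (𝓝 lam) := by
    simpa only [integral_logCoc_inv hmp hγ' hdet hA] using hlam
  have hrec : ∀ {T : Θ → Θ}, MeasurePreserving T m m → ∀ᵐ θ ∂m, ∀ (q : ℚ) (j : ℕ),
      θ ∈ slowSet γ A q (1 / (j + 1)) → ∃ᶠ n in atTop, T^[n] θ ∈ slowSet γ A q (1 / (j + 1)) :=
    fun hT => ae_all_iff.2 fun q => ae_all_iff.2 fun j =>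
      hT.conservative.ae_mem_imp_frequently_image_mem
        (measurableSet_slowSet hγ' hdet hA _ _).nullMeasurableSet
  filter_upwards [ae_tendsto_logCoc herg hdet hA hC hlam,
    ae_tendsto_logCoc hsymm (det_invGen γ hdet) (measurable_invGen hγ' hdet hA)
      (fun θ => (opNorm_inv (hdet _)).trans_le (hC _)) hlam',
    hrec hmp, hrec hsymm.toMeasurePreserving] with θ h1 h2 h3 h4
  refine ⟨h1, h2, fun q hq => ?_⟩
  obtain ⟨j, hj⟩ := exists_mem_slowSet hdet h2 hq
  exact ⟨1 / (j + 1), by positivity, h4 q j hj, h3 q j hj⟩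

lemma summable_inv_mul_of_growth {T : Θ → Θ} (hdet : ∀ θ, (A θ).det = 1) (hpos : 0 < lam) {θ : Θ}
    (h : Tendsto (fun n : ℕ => logCoc T A n θ / n) atTop (𝓝 lam)) {f g : ℕ → ℝ}
    (hf : ∃ c > 0, ∀ᶠ n in atTop, c * opNorm (coc T A n θ) ≤ f n)
    (hg : ∃ c > 0, ∀ᶠ n in atTop, c * opNorm (coc T A n θ) ≤ g n) :
    Summable fun n => (f n * g n)⁻¹ := by
  obtain ⟨c, hc, hf⟩ := hf
  obtain ⟨c', hc', hg⟩ := hg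
  have hgeo : Summable fun n : ℕ => (c * c')⁻¹ * Real.exp (-lam) ^ n :=
    (summable_geometric_of_lt_one (Real.exp_pos _).le
      (Real.exp_lt_one_iff.2 (by linarith))).mul_left _
  refine hgeo.of_norm_bounded_eventually_nat ?_
  filter_upwards [hf, hg, h.eventually (lt_mem_nhds (half_lt_self hpos)), eventually_gt_atTop 0]
    with n hfn hgn hn hn0
  rw [lt_div_iff₀ (by exact_mod_cast hn0)] at hn
  have h1 : Real.exp (lam / 2 * n) ≤ opNorm (coc T A n θ) := by
    rw [← exp_logCoc hdet]
    exact Real.exp_le_exp.2 hn.le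
  have h2 : Real.exp lam ^ n = Real.exp (lam / 2 * n) * Real.exp (lam / 2 * n) := by
    rw [← Real.exp_nat_mul, ← Real.exp_add]
    ring_nf
  have h3 : c * c' * Real.exp lam ^ n ≤ f n * g n := by
    rw [h2, mul_mul_mul_comm]
    have e := Real.exp_pos (lam / 2 * n)
    exact mul_le_mul ((mul_le_mul_of_nonneg_left h1 hc.le).trans hfn)
      ((mul_le_mul_of_nonneg_left h1 hc'.le).trans hgn) (by positivity)
      ((mul_nonneg hc.le (opNorm_nonneg _)).trans hfn)
  have h4 : 0 < c * c' * Real.exp lam ^ n := by positivity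
  rw [Real.norm_of_nonneg (inv_nonneg.2 (h4.le.trans h3)), Real.exp_neg, inv_pow, ← mul_inv]
  exact inv_anti₀ h4 h3

end RegularPoints

namespace RadSys
variable {Θ : Type*} {γ : Θ ≃ Θ} {A : Θ → Matrix (Fin 2) (Fin 2) ℝ} {h φ : ℝ → ℝ} {β L : ℝ}

lemma limRadius_vFull {θ : Θ} {x : R2} {α : ℝ} (hx : x ≠ 0) (hxα : x = ‖x‖ • vFull α) :
    limRadius γ A φ θ (vFull α) = limRadius γ A φ θ x := by
  rw [← limRadius_smul (norm_ne_zero_iff.2 hx) θ (vFull α), ← hxα]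

lemma setOf_polar_eq_circ {θ : Θ} (hpos : ∀ x ≠ 0, 0 < limRadius γ A φ θ x) :
    {x : R2 | ∃ α ∈ Ico (0 : ℝ) 1, x = limRadius γ A φ θ (vFull α) • vFull α} =
      circ γ A φ θ := by
  ext x
  constructor
  · rintro ⟨α, -, rfl⟩
    have hα := hpos _ (vFull_ne_zero α)
    refine ⟨smul_ne_zero hα.ne' (vFull_ne_zero α), ?_⟩
    rw [limRadius_smul hα.ne', norm_smul, norm_vFull, mul_one, Real.norm_of_nonneg hα.le]
  · rintro ⟨hx0, hx⟩
    obtain ⟨α, hα, hxα⟩ := exists_eq_norm_smul_vFull x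
    refine ⟨α, hα, ?_⟩
    rwa [limRadius_vFull hx0 hxα, ← hx]

lemma setOf_norm_le_eq_polar {θ : Θ} (hpos : ∀ x ≠ 0, 0 < limRadius γ A φ θ x)
    (h0 : limRadius γ A φ θ 0 ∈ Icc (0 : ℝ) 1) :
    {x : R2 | ‖x‖ ≤ limRadius γ A φ θ x} = {x : R2 | ∃ α ∈ Ico (0 : ℝ) 1, ∃ s : ℝ,
      0 ≤ s ∧ s ≤ limRadius γ A φ θ (vFull α) ∧ x = s • vFull α} := by
  ext x
  constructor
  · intro hx
    obtain ⟨α, hα, hxα⟩ := exists_eq_norm_smul_vFull x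
    refine ⟨α, hα, ‖x‖, norm_nonneg x, ?_, hxα⟩
    rcases eq_or_ne x 0 with rfl | hx0
    · rw [norm_zero]
      exact (hpos _ (vFull_ne_zero α)).le
    · rw [limRadius_vFull hx0 hxα]
      exact hx
  · rintro ⟨α, -, s, hs, hsr, rfl⟩
    change ‖s • vFull α‖ ≤ _
    rcases hs.eq_or_lt with rfl | hs0
    · rw [zero_smul, norm_zero]
      exact h0.1
    · rwa [limRadius_smul hs0.ne', norm_smul, norm_vFull, mul_one, Real.norm_of_nonneg hs]

lemma closedBall_sdiff_ball_subset_annulus {q d δ : ℝ} (hd : d ≤ δ) (θ : Θ) :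
    closedBall (0 : R2) 1 \ ball (0 : R2) δ ⊆ {x : R2 | (θ, x) ∈ annulus γ A q d} := by
  rintro x ⟨hx1, hxδ⟩
  rw [mem_closedBall_zero_iff] at hx1
  rw [mem_ball_zero_iff, not_lt] at hxδ
  refine ⟨hx1, 0, ?_⟩
  simp only [pow_zero, mul_one, bcoc, coc, mulVecE_one]
  exact hd.trans hxδ

lemma of_goodH (hdet : ∀ θ, (A θ).det = 1) (hA : ∃ C : ℝ, ∀ θ, opNorm (A θ) ≤ C)
    (hh : GoodH h) (hscale : Scaled A h) (hβ : 0 < β) :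
    RadSys A (fun x => h (β * max x 0)) β (⨆ θ, opNorm (A θ))⁻¹ := by
  obtain ⟨C, hC⟩ := hA
  refine ⟨hdet, hh.profile hβ hscale, fun θ => ?_⟩
  have hle : opNorm (A θ) ≤ ⨆ θ, opNorm (A θ) := le_ciSup ⟨C, forall_mem_range.2 hC⟩ θ
  rw [inv_mul_le_one₀ (zero_lt_one.trans_le ((one_le_opNorm (hdet θ)).trans hle))]
  exact hle

end RadSys

/-- The invariance and growth properties of the two Oseledets directions at a base point. -/
structure HyperbolicPoint {Θ : Type*} (γ : Θ ≃ Θ) (A : Θ → Matrix (Fin 2) (Fin 2) ℝ)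
    (αu αs : Θ → ℝ) (θ : Θ) : Prop where
  transverse : wedge (vFull (αu θ)) (vFull (αs θ)) ≠ 0
  invariant : wedge (mulVecE (A θ) (vFull (αu θ))) (vFull (αu (γ θ))) = 0
  growth : ∀ v, wedge v (vFull (αs θ)) ≠ 0 →
    ∃ c > 0, ∀ᶠ n in atTop, c * opNorm (coc γ A n θ) ≤ ‖mulVecE (coc γ A n θ) v‖

/-- If `β > β₂^m`, there are a γ-invariant full-measure set `Θ₀`
(independent of β) and a measurable `r_β : Θ × ℝ → [0,1]`, (1/2)-periodic in the second
variable, such that on `Θ₀` the fibre maps `α ↦ r_β(θ,α)` are continuous and strictly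
positive, the attractor fibres are the corresponding topological disks, the fibrewise
boundary `𝒯_β(θ)` is the global pullback attractor outside the zero section (witnessed
by forward invariant random compact sets `K_{β,δ}`), and when `λ_m(A) > 0` the random
two-point forward attractor `Ψ_β ⊆ 𝒯_β` persists. -/
theorem stmt5 {Θ : Type*} [MeasurableSpace Θ]
    (γ : Θ ≃ Θ) (hγ : Measurable ⇑γ) (hγ' : Measurable ⇑γ.symm)
    (m : Measure Θ) [IsProbabilityMeasure m] (herg : Ergodic ⇑γ m)
    (A : Θ → Matrix (Fin 2) (Fin 2) ℝ) (hdet : ∀ θ, (A θ).det = 1)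
    (hAmeas : ∀ i j, Measurable fun θ => A θ i j)
    (hAbdd : ∃ C : ℝ, ∀ θ, opNorm (A θ) ≤ C)
    (h : ℝ → ℝ) (hh : GoodH h) (hscale : Scaled A h)
    (lam : ℝ)
    (hlam : Filter.Tendsto
      (fun n : ℕ => (∫ θ, Real.log (opNorm (coc ⇑γ A n θ)) ∂m) / n)
      Filter.atTop (𝓝 lam)) :
    ∃ Θ₀ : Set Θ, MeasurableSet Θ₀ ∧ ⇑γ ⁻¹' Θ₀ = Θ₀ ∧ m Θ₀ = 1 ∧
      ∀ β : ℝ, Real.exp lam < β →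
        ∃ r : Θ × ℝ → ℝ,
          Measurable r ∧
          (∀ θ α, r (θ, α + 1 / 2) = r (θ, α)) ∧
          (∀ p, r p ∈ Set.Icc (0 : ℝ) 1) ∧
          (∀ θ ∈ Θ₀,
            (Continuous fun α => r (θ, α)) ∧
            (∀ α, 0 < r (θ, α)) ∧
            attractorFib ⇑γ A h β θ =
              {x : R2 | ∃ α ∈ Set.Ico (0 : ℝ) 1, ∃ s : ℝ,
                0 ≤ s ∧ s ≤ r (θ, α) ∧ x = s • vFull α} ∧
            {x : R2 | ∃ α ∈ Set.Ico (0 : ℝ) 1, x = r (θ, α) • vFull α} =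
              frontier (attractorFib ⇑γ A h β θ)) ∧
          (∀ δ : ℝ, 0 < δ →
            ∃ K : Set (Θ × R2),
              (∀ᵐ θ ∂m, IsCompact {x : R2 | (θ, x) ∈ K}) ∧
              (∀ x : R2, Measurable fun θ => Metric.infDist x {y : R2 | (θ, y) ∈ K}) ∧
              (∀ᵐ θ ∂m,
                Set.MapsTo (fibMap A h β θ) {x : R2 | (θ, x) ∈ K} {x : R2 | (γ θ, x) ∈ K}) ∧
              (∀ θ ∈ Θ₀,
                Metric.closedBall (0 : R2) 1 \ Metric.ball (0 : R2) δ ⊆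
                  {x : R2 | (θ, x) ∈ K}) ∧
              (∀ θ ∈ Θ₀,
                {x : R2 | ∃ α ∈ Set.Ico (0 : ℝ) 1, x = r (θ, α) • vFull α} =
                  ⋂ n : ℕ, (fun v => ((skewProd ⇑γ A h β)^[n] ((⇑γ.symm)^[n] θ, v)).2) ''
                    {x : R2 | ((⇑γ.symm)^[n] θ, x) ∈ K})) ∧
          (0 < lam →
            ∃ αu αs : Θ → ℝ, Measurable αu ∧ Measurable αs ∧
              ∃ c : Θ → ℝ, ∀ θ ∈ Θ₀,
                0 < c θ ∧
                ({c θ • vFull (αu θ), -(c θ • vFull (αu θ))} : Set R2) ⊆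
                  {x : R2 | ∃ α ∈ Set.Ico (0 : ℝ) 1, x = r (θ, α) • vFull α} ∧
                ∀ v : R2, (¬ ∃ t : ℝ, v = t • vFull (αs θ)) →
                  Filter.Tendsto (fun n : ℕ =>
                      Metric.infDist ((skewProd ⇑γ A h β)^[n] (θ, v)).2
                        ({c ((⇑γ)^[n] θ) • vFull (αu ((⇑γ)^[n] θ)),
                          -(c ((⇑γ)^[n] θ) • vFull (αu ((⇑γ)^[n] θ)))} : Set R2))
                    Filter.atTop (𝓝 0)) := by
  obtain ⟨C, hC⟩ := hAbdd
  have hmp := herg.toMeasurePreserving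
  have hsymm := (herg.equiv_symm hγ hγ').toMeasurePreserving
  obtain ⟨αu, αs, hmu, hms, hos⟩ : ∃ αu αs : Θ → ℝ, Measurable αu ∧ Measurable αs ∧
      ∀ᵐ θ ∂m, 0 < lam → HyperbolicPoint γ A αu αs θ := by
    by_cases hpos : 0 < lam
    · obtain ⟨αu, αs, hmu, hms, hos⟩ := exists_oseledets hγ' herg hdet hAmeas hC hpos hlam
      exact ⟨αu, αs, hmu, hms, hos.mono fun θ hθ _ => ⟨hθ.1, hθ.2.1, hθ.2.2⟩⟩
    · exact ⟨0, 0, measurable_const, measurable_const, .of_forall fun θ hp => (hpos hp).elim⟩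
  obtain ⟨Θ₀, hΘm, hΘγ, hΘ1, hΘ⟩ := exists_invariant_full_measure γ hmp hsymm
    ((ae_regularPoint hγ' herg hdet hAmeas hC hlam).and hos)
  have hfwd : MapsTo γ Θ₀ Θ₀ := fun θ hθ => by rwa [← hΘγ] at hθ
  have hbwd : MapsTo γ.symm Θ₀ Θ₀ := fun θ hθ => by
    rw [← hΘγ, mem_preimage, γ.apply_symm_apply]
    exact hθ
  have hae : ∀ᵐ θ ∂m, θ ∈ Θ₀ := (mem_ae_iff_prob_eq_one hΘm).2 hΘ1
  refine ⟨Θ₀, hΘm, hΘγ, hΘ1, fun β hβ => ?_⟩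
  have hβ0 : 0 < β := (Real.exp_pos lam).trans hβ
  obtain ⟨q, hlq, hqβ⟩ := exists_rat_btwn hβ
  have hq0 : (0 : ℝ) < q := (Real.exp_pos lam).trans hlq
  set φ : ℝ → ℝ := fun x => h (β * max x 0) with hφ
  have H : RadSys A φ β (⨆ θ, opNorm (A θ))⁻¹ := .of_goodH hdet ⟨C, hC⟩ hh hscale hβ0
  have hf : fibMap A h β = radMap A φ := fibMap_eq_radMap A h β
  obtain ⟨d₀, hd₀, -⟩ := H.prof.exists_annParams hq0 hqβ one_pos
  have hpos : ∀ θ ∈ Θ₀, ∀ x ≠ 0, 0 < limRadius γ A φ θ x := fun θ hθ x hx => by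
    obtain ⟨a, ha, hrec, -⟩ := (hΘ θ hθ).1.recurrent q hlq
    exact H.limRadius_pos hd₀ ha hrec hx
  have hcont : ∀ θ ∈ Θ₀, ContinuousOn (limRadius γ A φ θ) {0}ᶜ := fun θ hθ => by
    obtain ⟨a, ha, hrec, -⟩ := (hΘ θ hθ).1.recurrent q hlq
    exact H.continuousOn_limRadius hd₀ ha hrec
  have hdecay : ∀ θ ∈ Θ₀, Tendsto (fun k => opNorm (bcoc γ A k θ) / (q : ℝ) ^ k) atTop (𝓝 0) :=
    fun θ hθ => tendsto_opNorm_coc_div (det_invGen γ hdet) (hΘ θ hθ).1.backward hlq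
  refine ⟨fun p => limRadius γ A φ p.1 (vFull p.2), ?_, fun θ α => ?_,
    fun p => H.limRadius_mem_Icc p.1 _, fun θ hθ => ⟨?_, fun α => hpos θ hθ _ (vFull_ne_zero α),
      ?_, ?_⟩, fun δ hδ => ?_, fun hlpos => ⟨αu, αs, hmu, hms,
        fun θ => limRadius γ A φ θ (vFull (αu θ)), fun θ hθ => ⟨?_, ?_, fun v hv => ?_⟩⟩⟩
  · exact (H.measurable_limRadius hγ' hAmeas).comp
      (measurable_fst.prodMk (measurable_vFull.comp measurable_snd))
  · simp only
    rw [vFull_add_half, RadSys.limRadius_smul (neg_ne_zero.2 one_ne_zero)]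
  · exact (hcont θ hθ).comp_continuous continuous_vFull vFull_ne_zero
  · rw [H.attractorFib_eq hf]
    exact RadSys.setOf_norm_le_eq_polar (hpos θ hθ) (H.limRadius_mem_Icc θ 0)
  · rw [H.attractorFib_eq hf, H.frontier_disc (hpos θ hθ) (hcont θ hθ)]
    exact RadSys.setOf_polar_eq_circ (hpos θ hθ)
  · obtain ⟨d, hd, hdδ⟩ := H.prof.exists_annParams hq0 hqβ hδ
    refine ⟨annulus γ A q d, hae.mono fun θ hθ => RadSys.isCompact_annulus γ A hq0 hd.d_pos
      (hdecay θ hθ), H.measurable_infDist_annulus hγ' hAmeas hd, .of_forall fun θ x hx => ?_,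
      fun θ _ => RadSys.closedBall_sdiff_ball_subset_annulus hdδ θ, fun θ hθ => ?_⟩
    · rw [hf]
      exact H.radMap_mem_annulus hd hx
    · obtain ⟨a, ha, hrec, -⟩ := (hΘ θ hθ).1.recurrent q hlq
      exact (RadSys.setOf_polar_eq_circ (hpos θ hθ)).trans
        (H.circ_eq_iInter hf hd ha hrec fun n => hdecay _ (hbwd.iterate n hθ))
  · exact hpos θ hθ _ (vFull_ne_zero _)
  · have hc := hpos θ hθ _ (vFull_ne_zero (αu θ))
    simp only
    rw [RadSys.setOf_polar_eq_circ (hpos θ hθ), insert_subset_iff, singleton_subset_iff,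
      ← neg_smul]
    constructor
    · refine ⟨smul_ne_zero hc.ne' (vFull_ne_zero _), ?_⟩
      rw [RadSys.limRadius_smul hc.ne', norm_smul, norm_vFull, mul_one, Real.norm_of_nonneg hc.le]
    · refine ⟨smul_ne_zero (neg_ne_zero.2 hc.ne') (vFull_ne_zero _), ?_⟩
      rw [RadSys.limRadius_smul (neg_ne_zero.2 hc.ne'), norm_smul, norm_vFull, mul_one, norm_neg,
        Real.norm_of_nonneg hc.le]
  · have hreg := (hΘ θ hθ).1
    have hyp := (hΘ θ hθ).2 hlpos
    obtain ⟨a, ha, -, hrec⟩ := hreg.recurrent q hlq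
    have hv0 : v ≠ 0 := fun h0 => hv ⟨0, by rw [h0, zero_smul]⟩
    have hvs : wedge v (vFull (αs θ)) ≠ 0 := fun h0 =>
      hv ((exists_smul_of_wedge_eq_zero (norm_vFull _) h0).imp fun _ ht => ht.2)
    refine H.tendsto_infDist_pair hf hC (u := fun θ => vFull (αu θ)) (fun θ => norm_vFull _)
      (fun n => ?_) (fun n => hpos _ (hfwd.iterate n hθ) _ (vFull_ne_zero _))
      (mul_pos hd₀.d_pos ha) (hrec.mono fun n hn => H.le_limRadius hd₀ ha hn (vFull_ne_zero _)) hv0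
      (summable_inv_mul_of_growth hdet hlpos hreg.forward (hyp.growth v hvs)
        (hyp.growth _ hyp.transverse))
    rw [Function.iterate_succ_apply']
    exact ((hΘ _ (hfwd.iterate n hθ)).2 hlpos).invariant
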